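/- arXiv:2512.04236 — 6 statements merged into one kernel-verified Lean document; each statement's English description precedes it below -/
import Mathlib

section
/- Let γ > 1 be an integer, let T : [0,1] → [0,1] be the map T x = γx mod 1, and let (f_n : [0,1] → [0,1])_{n≥1} be an equicontinuous sequence of functions. Then for every α ∈ (0, 1/2), the set BA((f_n)_n) = {x ∈ [0,1] : liminf_{n→∞} |T^n x − f_n(x)| > 0} is α-winning for Schmidt's game on [0,1]. -/
/-- Schmidt's `(α, β)`-game on a metric space `X`: Bob plays closed balls
`B(z k, r k)` with `r (k+1) = β * (α * r k)`, Alice (given the history of Bob's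
moves so far) plays the center of a closed ball of radius `α * r k` which must be
contained in Bob's current ball, and Bob must play inside Alice's ball.  A set `S`
is `(α, β)`-winning if Alice has a strategy whose moves are always legal and which
guarantees that `⋂ k, B(z k, r k)` meets `S`, for every legal play by Bob. -/
def SchmidtWinning {X : Type*} [MetricSpace X] (S : Set X) (α β : ℝ) : Prop :=
  ∃ strat : List (X × ℝ) → X,
    ∀ (z : ℕ → X) (r : ℕ → ℝ),
      0 < r 0 →
      (∀ k, r (k + 1) = β * (α * r k)) →
      (∀ k, Metric.closedBall (z (k + 1)) (r (k + 1)) ⊆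
        Metric.closedBall (strat ((List.range (k + 1)).map fun i => (z i, r i)))
          (α * r k)) →
      (∀ k, Metric.closedBall (strat ((List.range (k + 1)).map fun i => (z i, r i)))
          (α * r k) ⊆ Metric.closedBall (z k) (r k)) ∧
        ((⋂ k, Metric.closedBall (z k) (r k)) ∩ S).Nonempty

open Set Filter Metric Topology

lemma exists_mul_lt_two_pow (s : ℕ) : ∃ t : ℕ, 0 < t ∧ s * t < 2 ^ t := by
  refine ⟨2 * (s + 1), by omega, ?_⟩
  have h : s + 1 ≤ 2 ^ s := Nat.lt_two_pow_self
  calc s * (2 * (s + 1)) < 4 * ((s + 1) * (s + 1)) := by nlinarith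
    _ ≤ 4 * (2 ^ s * 2 ^ s) := by gcongr
    _ = 2 ^ (2 * (s + 1)) := by ring

/-- The iterates of `x ↦ γ x mod 1` agree with `γ ^ n x` up to an integer. -/
lemma exists_int_iterate_eq {γ : ℤ} {T : Icc (0 : ℝ) 1 → Icc (0 : ℝ) 1}
    (hT : ∀ x : Icc (0 : ℝ) 1, (T x : ℝ) = Int.fract ((γ : ℝ) * (x : ℝ)))
    (n : ℕ) (x : Icc (0 : ℝ) 1) : ∃ m : ℤ, (T^[n] x : ℝ) = (γ : ℝ) ^ n * x - m := by
  induction n with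
  | zero => exact ⟨0, by simp⟩
  | succ n ih =>
    obtain ⟨m, hm⟩ := ih
    refine ⟨γ * m + ⌊(γ : ℝ) * (T^[n] x : ℝ)⌋, ?_⟩
    rw [Function.iterate_succ_apply', hT, Int.fract]
    push_cast
    nth_rewrite 1 [hm]
    ring

/-- Two points of a ball that is small at scale `γ ^ (-n)` whose `n`-th iterates are both `c`-close
to their targets are `3 c γ ^ (-n)`-close to each other. -/
lemma pow_mul_abs_sub_lt {γ : ℤ} (hγ : 1 < γ) {T : Icc (0 : ℝ) 1 → Icc (0 : ℝ) 1}
    (hT : ∀ x : Icc (0 : ℝ) 1, (T x : ℝ) = Int.fract ((γ : ℝ) * (x : ℝ)))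
    {g : Icc (0 : ℝ) 1 → Icc (0 : ℝ) 1} {n : ℕ} {c : ℝ} (hc : 3 * c < 1 / 2)
    {x y : Icc (0 : ℝ) 1} (hx : |(T^[n] x : ℝ) - g x| < c) (hy : |(T^[n] y : ℝ) - g y| < c)
    (hg : |(g x : ℝ) - g y| < c) (hxy : (γ : ℝ) ^ n * |(x : ℝ) - y| < 1 / 2) :
    (γ : ℝ) ^ n * |(x : ℝ) - y| < 3 * c := by
  obtain ⟨m, hm⟩ := exists_int_iterate_eq hT n x
  obtain ⟨m', hm'⟩ := exists_int_iterate_eq hT n y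
  have hpos : (0 : ℝ) < (γ : ℝ) ^ n := pow_pos (by exact_mod_cast (by omega : 0 < γ)) n
  rw [← abs_of_pos hpos, ← abs_mul] at hxy ⊢
  rw [hm] at hx
  rw [hm'] at hy
  rw [abs_lt] at *
  have hmm : m = m' := by
    have h1 : (m : ℝ) - m' < 1 := by linarith
    have h2 : (-1 : ℝ) < (m : ℝ) - m' := by linarith
    have h1' : m - m' < 1 := by exact_mod_cast h1
    have h2' : -1 < m - m' := by exact_mod_cast h2
    omega
  subst hmm
  constructor <;> linarith

/-- The times `n` for which `γ ^ (-n)` is comparable to the scale `4 a`. -/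
def scaleIndices (γ : ℤ) (κ a : ℝ) : Set ℕ :=
  {n | 4 * a * (γ : ℝ) ^ n < 1 ∧ κ ≤ 4 * a * (γ : ℝ) ^ n}

lemma scaleIndices_finite_and_ncard_le {γ : ℤ} (hγ : 1 < γ) {κ a : ℝ} (hκ : 0 < κ) {M : ℕ}
    (hM : 1 ≤ κ * (γ : ℝ) ^ M) :
    (scaleIndices γ κ a).Finite ∧ (scaleIndices γ κ a).ncard ≤ M := by
  have hγ' : (1 : ℝ) ≤ γ := by exact_mod_cast hγ.le
  have hsub : scaleIndices γ κ a ⊆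
      (Finset.Ico (sInf (scaleIndices γ κ a)) (sInf (scaleIndices γ κ a) + M) : Finset ℕ) := by
    intro n hn
    have hmin := Nat.sInf_mem ⟨n, hn⟩
    have hle : sInf (scaleIndices γ κ a) ≤ n := Nat.sInf_le hn
    set m := sInf (scaleIndices γ κ a)
    simp only [Finset.coe_Ico, mem_Ico]
    refine ⟨hle, ?_⟩
    by_contra! hcon
    have hpow : (γ : ℝ) ^ (m + M) ≤ (γ : ℝ) ^ n := pow_le_pow_right₀ hγ' hcon
    have hm0 : (0 : ℝ) < (γ : ℝ) ^ m := by positivity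
    have hM0 : (0 : ℝ) < (γ : ℝ) ^ M := by positivity
    have ha : 0 < 4 * a := pos_of_mul_pos_left (hκ.trans_le hmin.2) hm0.le
    have h1 : 4 * a * (γ : ℝ) ^ (m + M) ≤ 4 * a * (γ : ℝ) ^ n := by gcongr
    have h2 : κ * (γ : ℝ) ^ M ≤ 4 * a * (γ : ℝ) ^ m * (γ : ℝ) ^ M :=
      mul_le_mul_of_nonneg_right hmin.2 hM0.le
    rw [pow_add] at h1
    linarith [hn.1]
  refine ⟨(Finset.finite_toSet _).subset hsub, ?_⟩
  have h := ncard_le_ncard hsub (Finset.finite_toSet _)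
  rwa [ncard_coe_finset, Nat.card_Ico, Nat.add_sub_cancel_left] at h

/-- The indices in `I` whose obstacle meets `U`. -/
def hits {X : Type*} (A : ℕ → Set X) (I : Set ℕ) (U : Set X) : Set ℕ :=
  {n ∈ I | (A n ∩ U).Nonempty}

lemma hits_mono {X : Type*} {A : ℕ → Set X} {I : Set ℕ} {U V : Set X} (h : U ⊆ V) :
    hits A I U ⊆ hits A I V :=
  fun _ hn => ⟨hn.1, hn.2.mono (inter_subset_inter_right _ h)⟩

/-- The center obtained by moving from `z` by `σ (1 - α) r` inside the unit interval. -/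
noncomputable def sideCenter (α : ℝ) (z : Icc (0 : ℝ) 1) (r σ : ℝ) : Icc (0 : ℝ) 1 :=
  projIcc 0 1 zero_le_one ((z : ℝ) + σ * ((1 - α) * r))

open Classical in
/-- The side on which Alice plays: away from an end point of `[0, 1]` lying in Bob's ball, and
otherwise the side meeting fewer obstacles. -/
noncomputable def sideSign (A : ℕ → Set (Icc (0 : ℝ) 1)) (I : Set ℕ) (α : ℝ)
    (z : Icc (0 : ℝ) 1) (r : ℝ) : ℝ :=
  if (z : ℝ) ≤ r then 1 else if 1 ≤ (z : ℝ) + r then -1 else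
    if (hits A I (closedBall (sideCenter α z r 1) (α * r))).ncard ≤
      (hits A I (closedBall (sideCenter α z r (-1)) (α * r))).ncard then 1 else -1

lemma sideSign_eq (A : ℕ → Set (Icc (0 : ℝ) 1)) (I : Set ℕ) (α : ℝ) (z : Icc (0 : ℝ) 1) (r : ℝ) :
    sideSign A I α z r = 1 ∨ sideSign A I α z r = -1 := by
  unfold sideSign
  split_ifs <;> simp

lemma closedBall_sideCenter_subset {α r σ : ℝ} (hα : α < 1 / 2) (hr : 0 < r)
    (hσ : σ = 1 ∨ σ = -1) (z : Icc (0 : ℝ) 1) :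
    closedBall (sideCenter α z r σ) (α * r) ⊆ closedBall z r := by
  apply closedBall_subset_closedBall'
  have hpos : 0 < (1 - α) * r := mul_pos (by linarith) hr
  have hd : dist (sideCenter α z r σ) z ≤ (1 - α) * r := by
    have h0 := z.2.1
    have h1 := z.2.2
    rw [Subtype.dist_eq, Real.dist_eq, sideCenter, coe_projIcc, abs_le]
    rcases hσ with rfl | rfl
    · constructor
      · have : (z : ℝ) ≤ max 0 (min 1 ((z : ℝ) + 1 * ((1 - α) * r))) :=
          le_max_of_le_right (le_min h1 (by linarith))
        linarith
      · have : max 0 (min 1 ((z : ℝ) + 1 * ((1 - α) * r))) ≤ (z : ℝ) + 1 * ((1 - α) * r) :=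
          max_le (by linarith) (min_le_right _ _)
        linarith
    · constructor
      · have : (z : ℝ) + -1 * ((1 - α) * r) ≤ max 0 (min 1 ((z : ℝ) + -1 * ((1 - α) * r))) :=
          le_max_of_le_right (le_min (by linarith) le_rfl)
        linarith
      · have : max 0 (min 1 ((z : ℝ) + -1 * ((1 - α) * r))) ≤ (z : ℝ) :=
          max_le h0 (min_le_of_right_le (by linarith))
        linarith
  linarith

lemma coe_sideCenter {α r σ : ℝ} {z : Icc (0 : ℝ) 1} (h0 : 0 ≤ (z : ℝ) + σ * ((1 - α) * r))
    (h1 : (z : ℝ) + σ * ((1 - α) * r) ≤ 1) :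
    (sideCenter α z r σ : ℝ) = (z : ℝ) + σ * ((1 - α) * r) := by
  rw [sideCenter, coe_projIcc, min_eq_right h1, max_eq_right h0]

/-- Once Bob's radius is below `1 / 2`, Alice's ball avoids both end points. -/
lemma sideCenter_sideSign_mem_Ioo {A : ℕ → Set (Icc (0 : ℝ) 1)} {I : Set ℕ} {α r : ℝ}
    (hα : α ∈ Ioo (0 : ℝ) (1 / 2)) (hr : 0 < r) (hr' : r < 1 / 2) (z : Icc (0 : ℝ) 1) :
    α * r < sideCenter α z r (sideSign A I α z r) ∧
      sideCenter α z r (sideSign A I α z r) + α * r < 1 := by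
  have h0 := z.2.1
  have h1 := z.2.2
  have hαr : 0 < α * r := mul_pos hα.1 hr
  have hαr' : α * r < 1 / 2 * r := mul_lt_mul_of_pos_right hα.2 hr
  by_cases hz : (z : ℝ) ≤ r
  · have hs : sideSign A I α z r = 1 := by simp [sideSign, hz]
    rw [hs, coe_sideCenter (by linarith) (by linarith)]
    constructor <;> linarith
  · by_cases hz' : 1 ≤ (z : ℝ) + r
    · have hs : sideSign A I α z r = -1 := by simp [sideSign, hz, hz']
      rw [hs, coe_sideCenter (by linarith) (by linarith)]
      constructor <;> linarith
    · rcases sideSign_eq A I α z r with hs | hs <;>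
      · rw [hs, coe_sideCenter (by linarith) (by linarith)]
        constructor <;> linarith

/-- Alice's move at least halves the number of obstacles, provided each of them is small. -/
lemma two_mul_ncard_hits_le {A : ℕ → Set (Icc (0 : ℝ) 1)} {I : Set ℕ} (hI : I.Finite) {α r : ℝ}
    (hα : α ∈ Ioo (0 : ℝ) (1 / 2)) (hr : 0 < r) {z : Icc (0 : ℝ) 1} (hz : r < z)
    (hz' : (z : ℝ) + r < 1)
    (hA : ∀ n ∈ I, ∀ x ∈ A n, ∀ y ∈ A n, x ∈ closedBall z r → y ∈ closedBall z r →
      |(x : ℝ) - y| < 2 * ((1 - 2 * α) * r)) :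
    2 * (hits A I (closedBall (sideCenter α z r (sideSign A I α z r)) (α * r))).ncard ≤
      (hits A I (closedBall z r)).ncard := by
  have hαr : 0 < α * r := mul_pos hα.1 hr
  have hαr' : α * r < 1 / 2 * r := mul_lt_mul_of_pos_right hα.2 hr
  have hfin : ∀ U, (hits A I U).Finite := fun U => hI.subset fun n hn => hn.1
  have hsub : ∀ σ : ℝ, σ = 1 ∨ σ = -1 →
      closedBall (sideCenter α z r σ) (α * r) ⊆ closedBall z r :=
    fun σ hσ => closedBall_sideCenter_subset hα.2 hr hσ z
  have hdisj : Disjoint (hits A I (closedBall (sideCenter α z r 1) (α * r)))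
      (hits A I (closedBall (sideCenter α z r (-1)) (α * r))) := by
    rw [Set.disjoint_left]
    rintro n ⟨hn, x, hxA, hx⟩ ⟨-, y, hyA, hy⟩
    have hd := hA n hn x hxA y hyA (hsub 1 (by simp) hx) (hsub (-1) (by simp) hy)
    rw [mem_closedBall, Subtype.dist_eq, Real.dist_eq,
      coe_sideCenter (by linarith) (by linarith), abs_le] at hx hy
    have := (abs_lt.1 hd).2
    linarith [hx.1, hy.2]
  have hsum := ncard_le_ncard (union_subset (hits_mono (A := A) (I := I) (hsub 1 (by simp)))
    (hits_mono (A := A) (I := I) (hsub (-1) (by simp)))) (hfin _)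
  rw [ncard_union_eq hdisj (hfin _) (hfin _)] at hsum
  have hz1 : ¬ (z : ℝ) ≤ r := not_le.2 hz
  have hz2 : ¬ 1 ≤ (z : ℝ) + r := not_le.2 hz'
  by_cases hle : (hits A I (closedBall (sideCenter α z r 1) (α * r))).ncard ≤
      (hits A I (closedBall (sideCenter α z r (-1)) (α * r))).ncard
  · have hs : sideSign A I α z r = 1 := by simp only [sideSign, hz1, hz2, hle, if_true, if_false]
    rw [hs]
    omega
  · have hs : sideSign A I α z r = -1 := by simp only [sideSign, hz1, hz2, hle, if_false]
    rw [hs]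
    omega

/-- In the unit interval, a closed ball contained in a ball avoiding the end points avoids them. -/
lemma Ioo_of_closedBall_subset {z w : Icc (0 : ℝ) 1} {r s : ℝ}
    (h : closedBall z r ⊆ closedBall w s) (hw : s < w) (hw' : (w : ℝ) + s < 1) :
    r < z ∧ (z : ℝ) + r < 1 := by
  have h0 : (0 : Icc (0 : ℝ) 1) ∉ closedBall w s := by
    rw [mem_closedBall, Subtype.dist_eq, Real.dist_eq]
    intro hcon
    have := (abs_le.1 hcon).1
    norm_num at this
    linarith
  have h1 : (1 : Icc (0 : ℝ) 1) ∉ closedBall w s := by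
    rw [mem_closedBall, Subtype.dist_eq, Real.dist_eq]
    intro hcon
    have := (abs_le.1 hcon).2
    norm_num at this
    linarith
  have h0' := fun hh => h0 (h hh)
  have h1' := fun hh => h1 (h hh)
  have hz0 := z.2.1
  have hz1 := z.2.2
  rw [mem_closedBall, Subtype.dist_eq, Real.dist_eq] at h0' h1'
  constructor
  · by_contra! hcon
    exact h0' (by simpa [abs_of_nonneg hz0] using hcon)
  · by_contra! hcon
    refine h1' ?_
    rw [abs_of_nonneg (by simpa using hz1)]
    simp only [Icc.coe_one]
    linarith

/-- After `t` moves Alice has avoided all of fewer than `2 ^ t` small obstacles. -/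
lemma hits_eq_empty_of_play {A : ℕ → Set (Icc (0 : ℝ) 1)} {I : Set ℕ} (hI : I.Finite) {α : ℝ}
    (hα : α ∈ Ioo (0 : ℝ) (1 / 2)) {t : ℕ} (hcard : I.ncard < 2 ^ t)
    {z : ℕ → Icc (0 : ℝ) 1} {r : ℕ → ℝ} (hr : ∀ i, 0 < r i)
    (hz : ∀ i, r i < z i ∧ (z i : ℝ) + r i < 1)
    (hA : ∀ i < t, ∀ n ∈ I, ∀ x ∈ A n, ∀ y ∈ A n, x ∈ closedBall (z i) (r i) →
      y ∈ closedBall (z i) (r i) → |(x : ℝ) - y| < 2 * ((1 - 2 * α) * r i))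
    (hplay : ∀ i < t, closedBall (z (i + 1)) (r (i + 1)) ⊆
      closedBall (sideCenter α (z i) (r i) (sideSign A I α (z i) (r i))) (α * r i)) :
    hits A I (closedBall (z t) (r t)) = ∅ := by
  have hfin : ∀ U, (hits A I U).Finite := fun U => hI.subset fun n hn => hn.1
  have key : ∀ i ≤ t, 2 ^ i * (hits A I (closedBall (z i) (r i))).ncard < 2 ^ t := by
    intro i
    induction i with
    | zero =>
      intro _
      simpa using (ncard_le_ncard (fun n hn => hn.1) hI).trans_lt hcard
    | succ i ih =>
      intro hi
      have h1 := two_mul_ncard_hits_le hI hα (hr i) (hz i).1 (hz i).2 (hA i hi)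
      have h2 := ncard_le_ncard (hits_mono (A := A) (I := I) (hplay i hi)) (hfin _)
      calc 2 ^ (i + 1) * (hits A I (closedBall (z (i + 1)) (r (i + 1)))).ncard
          = 2 ^ i * (2 * (hits A I (closedBall (z (i + 1)) (r (i + 1)))).ncard) := by ring
        _ ≤ 2 ^ i * (hits A I (closedBall (z i) (r i))).ncard := by gcongr; omega
        _ < 2 ^ t := ih (by omega)
  have h := key t le_rfl
  rw [← ncard_eq_zero (hfin _)]
  by_contra hne
  have := Nat.le_mul_of_pos_right (2 ^ t) (Nat.pos_of_ne_zero hne)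
  omega

/-- Alice's strategy: during each block of `t` turns she avoids the obstacles whose indices are
comparable to the radius at the beginning of the block. -/
noncomputable def avoidingStrategy (γ : ℤ) (A : ℕ → Set (Icc (0 : ℝ) 1)) (α θ : ℝ) (t : ℕ)
    (l : List (Icc (0 : ℝ) 1 × ℝ)) : Icc (0 : ℝ) 1 :=
  match l.getLast? with
  | none => 0
  | some (z, r) => sideCenter α z r
      (sideSign A (scaleIndices γ (θ ^ t) (r / θ ^ ((l.length - 1) % t))) α z r)

lemma avoidingStrategy_map_range (γ : ℤ) (A : ℕ → Set (Icc (0 : ℝ) 1)) (α θ : ℝ) (t : ℕ)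
    (z : ℕ → Icc (0 : ℝ) 1) (r : ℕ → ℝ) (k : ℕ) :
    avoidingStrategy γ A α θ t ((List.range (k + 1)).map fun i => (z i, r i)) =
      sideCenter α (z k) (r k)
        (sideSign A (scaleIndices γ (θ ^ t) (r k / θ ^ (k % t))) α (z k) (r k)) := by
  simp [avoidingStrategy, List.range_succ]

/-- For the `γ`-adic map `T x = γ x mod 1` on `[0,1]` with integer
`γ > 1` and any equicontinuous sequence `(f n)` of self-maps of `[0,1]`, the set
`BA((f n)) = {x : liminf_n |T^n x - f n x| > 0}` is `α`-winning for Schmidt's game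
on `[0,1]` (i.e. `(α, β)`-winning for every `β ∈ (0,1)`), for every `α ∈ (0, 1/2)`. -/
theorem betaMap_twisted_badly_approximable_schmidt_winning
    (γ : ℤ) (hγ : 1 < γ)
    (T : Set.Icc (0:ℝ) 1 → Set.Icc (0:ℝ) 1)
    (hT : ∀ x : Set.Icc (0:ℝ) 1, ((T x : ℝ)) = Int.fract ((γ : ℝ) * (x : ℝ)))
    (f : ℕ → Set.Icc (0:ℝ) 1 → Set.Icc (0:ℝ) 1)
    (hf : ∀ ε : ℝ, 0 < ε → ∃ δ : ℝ, 0 < δ ∧ ∀ (n : ℕ) (x y : Set.Icc (0:ℝ) 1),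
      |(x : ℝ) - (y : ℝ)| < δ → |((f n x : ℝ)) - ((f n y : ℝ))| < ε)
    (α : ℝ) (hα : α ∈ Set.Ioo (0:ℝ) (1/2)) :
    ∀ β ∈ Set.Ioo (0:ℝ) 1,
      SchmidtWinning
        {x : Set.Icc (0:ℝ) 1 |
          0 < Filter.liminf (fun n => |((T^[n] x : ℝ)) - ((f n x : ℝ))|) Filter.atTop}
        α β := by
  intro β hβ
  set θ := β * α with hθ
  have hθ0 : 0 < θ := mul_pos hβ.1 hα.1
  have hθ1 : θ < 1 := mul_lt_one_of_nonneg_of_lt_one_left hβ.1.le hβ.2 (by linarith [hα.2])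
  have hγ1 : (1 : ℝ) < γ := by exact_mod_cast hγ
  obtain ⟨s, hs⟩ := pow_unbounded_of_one_lt θ⁻¹ hγ1
  obtain ⟨t, ht0, ht⟩ := exists_mul_lt_two_pow s
  have hθt : 0 < θ ^ t := pow_pos hθ0 t
  have hθt1 : θ ^ t ≤ 1 := pow_le_one₀ hθ0.le hθ1.le
  have hst : 1 ≤ θ ^ t * (γ : ℝ) ^ (s * t) := by
    rw [pow_mul, ← mul_pow]
    refine one_le_pow₀ ?_
    rw [inv_lt_iff_one_lt_mul₀ hθ0] at hs
    linarith
  have hα' : 0 < 1 - 2 * α := by linarith [hα.2]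
  obtain ⟨c, hc⟩ : ∃ c, c = (1 - 2 * α) * (θ ^ t * θ ^ t) / 16 := ⟨_, rfl⟩
  have hc0 : 0 < c := by rw [hc]; positivity
  have hc1 : 3 * c < 1 / 2 := by
    have h1 : (1 - 2 * α) * (θ ^ t * θ ^ t) ≤ 1 :=
      mul_le_one₀ (by linarith [hα.1]) (by positivity) (mul_le_one₀ hθt1 hθt.le hθt1)
    linarith
  obtain ⟨δ, hδ0, hδ⟩ := hf c hc0
  let A : ℕ → Set (Icc (0 : ℝ) 1) := fun n => {x | |(T^[n] x : ℝ) - f n x| < c}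
  refine ⟨avoidingStrategy γ A α θ t, fun z r hr0 hr hplay => ?_⟩
  simp only [avoidingStrategy_map_range] at hplay ⊢
  have hrk : ∀ j i, r (j + i) = r j * θ ^ i := by
    intro j i
    induction i with
    | zero => simp
    | succ i ih => rw [← add_assoc, hr, ih, hθ]; ring
  have hrpos : ∀ k, 0 < r k := fun k => by
    rw [← zero_add k, hrk]
    positivity
  have hlegal : ∀ k, closedBall (sideCenter α (z k) (r k)
      (sideSign A (scaleIndices γ (θ ^ t) (r k / θ ^ (k % t))) α (z k) (r k))) (α * r k) ⊆
      closedBall (z k) (r k) := fun k =>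
    closedBall_sideCenter_subset hα.2 (hrpos k) (sideSign_eq _ _ _ _ _) _
  refine ⟨hlegal, ?_⟩
  obtain ⟨x, hx⟩ := IsCompact.nonempty_iInter_of_sequence_nonempty_isCompact_isClosed
    (fun k => closedBall (z k) (r k)) (fun k => (hplay k).trans (hlegal k))
    (fun k => ⟨z k, mem_closedBall_self (hrpos k).le⟩) isClosed_closedBall.isCompact
    (fun k => isClosed_closedBall)
  refine ⟨x, hx, ?_⟩
  rw [mem_iInter] at hx
  have hrlim : Tendsto r atTop (𝓝 0) := by
    have h := (tendsto_pow_atTop_nhds_zero_of_lt_one hθ0.le hθ1).const_mul (r 0)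
    rw [mul_zero] at h
    refine h.congr fun k => ?_
    rw [← hrk, zero_add]
  obtain ⟨K, hK⟩ := eventually_atTop.1
    (hrlim.eventually (gt_mem_nhds (lt_min (by norm_num : (0 : ℝ) < 1 / 2) (half_pos hδ0))))
  have hedge : ∀ k, K + 1 ≤ k → r k < z k ∧ (z k : ℝ) + r k < 1 := by
    intro k hk
    obtain ⟨k, rfl⟩ := Nat.exists_eq_add_of_le' hk
    have h := sideCenter_sideSign_mem_Ioo (A := A)
      (I := scaleIndices γ (θ ^ t) (r (k + K) / θ ^ ((k + K) % t))) hα (hrpos (k + K))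
      ((hK (k + K) (by omega)).trans_le (min_le_left _ _)) (z (k + K))
    exact Ioo_of_closedBall_subset (hplay (k + K)) h.1 h.2
  have hblock : ∀ j, K + 1 ≤ j → ∀ n ∈ scaleIndices γ (θ ^ t) (r (j * t)), x ∉ A n := by
    intro j hj n hn hxn
    have hjt : K + 1 ≤ j * t := hj.trans (Nat.le_mul_of_pos_right j ht0)
    obtain ⟨hfin, hcard⟩ := scaleIndices_finite_and_ncard_le (a := r (j * t)) hγ hθt hst
    have hempty := hits_eq_empty_of_play (A := A) hfin hα (hcard.trans_lt ht)
      (z := fun i => z (j * t + i)) (r := fun i => r (j * t + i)) (fun i => hrpos _)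
      (fun i => hedge _ (by omega)) ?_ ?_
    · exact hempty.le ⟨hn, x, hxn, hx _⟩
    · intro i hi m hm u hu v hv hur hvr
      have hrle : r (j * t + i) ≤ r (j * t) := by
        rw [hrk]
        exact mul_le_of_le_one_right (hrpos _).le (pow_le_one₀ hθ0.le hθ1.le)
      have hrge : r (j * t) * θ ^ t ≤ r (j * t + i) := by
        rw [hrk]
        exact mul_le_mul_of_nonneg_left (pow_le_pow_of_le_one hθ0.le hθ1.le hi.le) (hrpos _).le
      have hρδ := (hK (j * t) (by omega)).trans_le (min_le_right _ _)
      have huv : |(u : ℝ) - v| ≤ 2 * r (j * t) := by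
        have h := dist_triangle_right u v (z (j * t + i))
        rw [Subtype.dist_eq, Real.dist_eq] at h
        linarith [mem_closedBall.1 hur, mem_closedBall.1 hvr]
      have hγm : (0 : ℝ) < (γ : ℝ) ^ m := by positivity
      have hsep := pow_mul_abs_sub_lt hγ hT hc1 hu hv (hδ m u v (by linarith)) <| by
        have h := mul_le_mul_of_nonneg_left huv hγm.le
        linarith [hm.1]
      have h1 : θ ^ t * |(u : ℝ) - v| ≤ 4 * r (j * t) * (γ : ℝ) ^ m * |(u : ℝ) - v| :=
        mul_le_mul_of_nonneg_right hm.2 (abs_nonneg _)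
      have h2 : 4 * r (j * t) * ((γ : ℝ) ^ m * |(u : ℝ) - v|) < 4 * r (j * t) * (3 * c) :=
        mul_lt_mul_of_pos_left hsep (by linarith [hrpos (j * t)])
      have h3 : θ ^ t * ((1 - 2 * α) * (r (j * t) * θ ^ t)) ≤
          θ ^ t * ((1 - 2 * α) * r (j * t + i)) := by gcongr
      have h4 : 0 < θ ^ t * ((1 - 2 * α) * r (j * t + i)) :=
        mul_pos hθt (mul_pos hα' (hrpos _))
      rw [hc] at h2
      refine lt_of_mul_lt_mul_left (a := θ ^ t) ?_ hθt.le
      linarith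
    · intro i hi
      have h := hplay (j * t + i)
      have hmod : (j * t + i) % t = i := by
        rw [Nat.mul_comm, Nat.mul_add_mod, Nat.mod_eq_of_lt hi]
      rwa [hmod, hrk (j * t) i, mul_div_cancel_right₀ _ (pow_pos hθ0 i).ne', ← hrk] at h
  have hev : ∀ᶠ n in atTop, c ≤ |(T^[n] x : ℝ) - f n x| := by
    have h := (tendsto_pow_atTop_atTop_of_one_lt hγ1).const_mul_atTop
      (mul_pos (by norm_num : (0 : ℝ) < 4) (hrpos ((K + 1) * t)))
    filter_upwards [h.eventually_ge_atTop 1] with n hn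
    have hγn : (0 : ℝ) < (γ : ℝ) ^ n := by positivity
    have hlim : Tendsto (fun j => 4 * r ((K + 1 + j) * t) * (γ : ℝ) ^ n) atTop (𝓝 0) := by
      have h1 : Tendsto (fun j => (K + 1 + j) * t) atTop atTop :=
        tendsto_atTop_mono (fun j => (by nlinarith : j ≤ (K + 1 + j) * t)) tendsto_id
      simpa using ((hrlim.comp h1).const_mul 4).mul_const ((γ : ℝ) ^ n)
    have hex : ∃ j, 4 * r ((K + 1 + j) * t) * (γ : ℝ) ^ n < 1 :=
      (hlim.eventually (gt_mem_nhds one_pos)).exists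
    obtain ⟨j, hj, hmin⟩ : ∃ j, 4 * r ((K + 1 + (j + 1)) * t) * (γ : ℝ) ^ n < 1 ∧
        1 ≤ 4 * r ((K + 1 + j) * t) * (γ : ℝ) ^ n := by
      by_contra! hcon
      obtain ⟨j, hj⟩ := hex
      have hall : ∀ i, 1 ≤ 4 * r ((K + 1 + i) * t) * (γ : ℝ) ^ n := by
        intro i
        induction i with
        | zero => exact hn
        | succ i ih => exact not_lt.1 fun hlt => (hcon i hlt).not_ge ih
      exact (hall j).not_gt hj
    refine not_lt.1 (hblock (K + 1 + (j + 1)) (by omega) n ⟨hj, ?_⟩)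
    have hstep : r ((K + 1 + (j + 1)) * t) = r ((K + 1 + j) * t) * θ ^ t := by
      rw [← hrk]
      congr 1
      ring
    have h2 := mul_le_mul_of_nonneg_right hmin hθt.le
    rw [hstep]
    linarith
  refine hc0.trans_le (le_liminf_of_le ?_ hev)
  refine IsBoundedUnder.isCoboundedUnder_ge ⟨1, ?_⟩
  refine eventually_map.2 (Eventually.of_forall fun n => ?_)
  have h1 := (T^[n] x).2
  have h2 := (f n x).2
  exact abs_le.2 ⟨by linarith [h1.1, h2.2], by linarith [h1.2, h2.1]⟩
end

section
/- Let T : [0,1] → [0,1] be the Gauss map, T(0) = 0 and T(x) = 1/x mod 1 for x ≠ 0, and let (f_n : [0,1] → [0,1])_{n≥1} be an equicontinuous sequence of functions. Then for every α ∈ (0, 1/2), the set BA((f_n)_n) = {x ∈ [0,1] : liminf_{n→∞} |T^n x − f_n(x)| > 0} is α-winning for Schmidt's game on [0,1]. -/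
/-- The inverse branch `t ↦ 1 / (a₁ + 1 + 1 / (a₂ + 1 + ⋯ + t))` of an iterate of the Gauss map
attached to the word `a₁ a₂ ⋯`. -/
noncomputable def gaussBranch : List ℕ → ℝ → ℝ
  | [], t => t
  | a :: w, t => 1 / (a + 1 + gaussBranch w t)

/-- The denominator of the Möbius map `gaussBranch w`, as a function of the variable. -/
noncomputable def gaussDen : List ℕ → ℝ → ℝ
  | [], _ => 1
  | a :: w, t => (a + 1 + gaussBranch w t) * gaussDen w t

theorem gaussBranch_nonneg (w : List ℕ) {t : ℝ} (ht : 0 ≤ t) : 0 ≤ gaussBranch w t := by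
  induction w with
  | nil => exact ht
  | cons a w ih => rw [gaussBranch]; positivity

theorem gaussBranch_le_one (w : List ℕ) {t : ℝ} (ht : 0 ≤ t) (ht1 : t ≤ 1) :
    gaussBranch w t ≤ 1 := by
  cases w with
  | nil => exact ht1
  | cons a w =>
    have := gaussBranch_nonneg w ht
    have ha : (0 : ℝ) ≤ a := a.cast_nonneg
    rw [gaussBranch, div_le_one (by positivity)]
    linarith

theorem one_le_gaussDen (w : List ℕ) {t : ℝ} (ht : 0 ≤ t) : 1 ≤ gaussDen w t := by
  induction w with
  | nil => exact le_rfl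
  | cons a w ih =>
    have := gaussBranch_nonneg w ht
    have ha : (0 : ℝ) ≤ a := a.cast_nonneg
    rw [gaussDen]
    nlinarith

theorem gaussBranch_append (w v : List ℕ) (t : ℝ) :
    gaussBranch (w ++ v) t = gaussBranch w (gaussBranch v t) := by
  induction w with
  | nil => rfl
  | cons a w ih => simp [gaussBranch, ih]

theorem gaussDen_append (w v : List ℕ) (t : ℝ) :
    gaussDen (w ++ v) t = gaussDen w (gaussBranch v t) * gaussDen v t := by
  induction w with
  | nil => simp [gaussDen]
  | cons a w ih => simp [gaussDen, ih, gaussBranch_append, mul_assoc]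

theorem gaussBranch_mul_gaussDen_cons (a : ℕ) (w : List ℕ) {t : ℝ} (ht : 0 ≤ t) :
    gaussBranch (a :: w) t * gaussDen (a :: w) t = gaussDen w t := by
  have := gaussBranch_nonneg w ht
  rw [gaussBranch, gaussDen]
  field_simp

theorem gaussDen_zero_le (w : List ℕ) {t : ℝ} (ht : 0 ≤ t) : gaussDen w 0 ≤ gaussDen w t := by
  suffices h : gaussDen w 0 ≤ gaussDen w t ∧
      gaussBranch w 0 * gaussDen w 0 ≤ gaussBranch w t * gaussDen w t from h.1
  induction w with
  | nil => simpa [gaussDen, gaussBranch] using ht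
  | cons a w ih =>
    rw [gaussBranch_mul_gaussDen_cons _ _ ht, gaussBranch_mul_gaussDen_cons _ _ le_rfl]
    refine ⟨?_, ih.1⟩
    have ha : (0 : ℝ) ≤ a := a.cast_nonneg
    simp only [gaussDen]
    nlinarith

theorem gaussDen_le_two_mul (w : List ℕ) {t : ℝ} (ht : 0 ≤ t) (ht1 : t ≤ 1) :
    gaussDen w t ≤ 2 * gaussDen w 0 := by
  suffices h : gaussDen w t ≤ 2 * gaussDen w 0 ∧
      gaussBranch w t * gaussDen w t + gaussDen w t ≤
        2 * (gaussBranch w 0 * gaussDen w 0 + gaussDen w 0) from h.1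
  induction w with
  | nil => simp [gaussDen, gaussBranch]; linarith
  | cons a w ih =>
    rw [gaussBranch_mul_gaussDen_cons _ _ ht, gaussBranch_mul_gaussDen_cons _ _ le_rfl]
    have ha : (0 : ℝ) ≤ a := a.cast_nonneg
    simp only [gaussDen]
    constructor <;> nlinarith

theorem abs_gaussBranch_sub (w : List ℕ) {s t : ℝ} (hs : 0 ≤ s) (ht : 0 ≤ t) :
    |gaussBranch w s - gaussBranch w t| = |s - t| / (gaussDen w s * gaussDen w t) := by
  induction w with
  | nil => simp [gaussBranch, gaussDen]
  | cons a w ih =>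
    have h1 := gaussBranch_nonneg w hs
    have h2 := gaussBranch_nonneg w ht
    have h3 := one_le_gaussDen w hs
    have h4 := one_le_gaussDen w ht
    have hA : 0 < a + 1 + gaussBranch w s := by positivity
    have hB : 0 < a + 1 + gaussBranch w t := by positivity
    simp only [gaussBranch, gaussDen]
    rw [div_sub_div _ _ hA.ne' hB.ne', abs_div, abs_of_pos (mul_pos hA hB),
      show 1 * (a + 1 + gaussBranch w t) - (a + 1 + gaussBranch w s) * 1 =
        -(gaussBranch w s - gaussBranch w t) by ring, abs_neg, ih, div_div]
    congr 1
    ring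

theorem abs_gaussBranch_sub_le (w : List ℕ) {s t : ℝ} (hs : 0 ≤ s) (ht : 0 ≤ t) :
    |gaussBranch w s - gaussBranch w t| ≤ |s - t| / gaussDen w 0 ^ 2 := by
  have h0 := one_le_gaussDen w le_rfl
  rw [abs_gaussBranch_sub w hs ht, sq]
  have h1 := gaussDen_zero_le w hs
  have h2 := gaussDen_zero_le w ht
  have h3 : 0 < gaussDen w 0 := by linarith
  have h4 : 0 < gaussDen w s := by linarith
  gcongr

theorem two_pow_le_gaussDen (w : List ℕ) : (2 : ℝ) ^ (w.length / 2) ≤ gaussDen w 0 := by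
  induction w using List.twoStepInduction with
  | nil => simp [gaussDen]
  | singleton a => simpa using one_le_gaussDen [a] le_rfl
  | cons_cons a b w ih _ =>
    have h1 := one_le_gaussDen w le_rfl
    have h2 := gaussBranch_mul_gaussDen_cons b w le_rfl
    have h3 : gaussDen w 0 ≤ gaussDen (b :: w) 0 := by
      have := gaussBranch_nonneg w le_rfl
      have hb : (0 : ℝ) ≤ b := b.cast_nonneg
      rw [gaussDen]
      nlinarith
    have ha : (0 : ℝ) ≤ a := a.cast_nonneg
    have h4 : (a :: b :: w).length / 2 = w.length / 2 + 1 := by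
      simp only [List.length_cons]
      omega
    rw [h4, pow_succ, gaussDen]
    nlinarith

theorem gaussDen_mul_le_append (w v : List ℕ) :
    gaussDen w 0 * gaussDen v 0 ≤ gaussDen (w ++ v) 0 := by
  rw [gaussDen_append]
  have := one_le_gaussDen v le_rfl
  gcongr
  exact gaussDen_zero_le w (gaussBranch_nonneg v le_rfl)

/-- The first `n` partial quotients of `x`, each decreased by one. -/
noncomputable def gaussDigits : ℕ → ℝ → List ℕ
  | 0, _ => []
  | n + 1, x => (⌊1 / x⌋₊ - 1) :: gaussDigits n (Int.fract (1 / x))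

theorem length_gaussDigits (n : ℕ) (x : ℝ) : (gaussDigits n x).length = n := by
  induction n generalizing x with
  | zero => rfl
  | succ n ih => simp [gaussDigits, ih]

theorem gaussDigits_add (m n : ℕ) (x : ℝ) :
    ∃ v : List ℕ, v.length = n ∧ gaussDigits (m + n) x = gaussDigits m x ++ v := by
  induction m generalizing x with
  | zero => exact ⟨_, length_gaussDigits n x, by simp [gaussDigits]⟩
  | succ m ih =>
    obtain ⟨v, hv, h⟩ := ih (Int.fract (1 / x))
    exact ⟨v, hv, by rw [Nat.add_right_comm, gaussDigits, gaussDigits, h]; rfl⟩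

theorem Irrational.fract_one_div {x : ℝ} (hx : Irrational x) :
    Irrational (Int.fract (1 / x)) := by
  rw [one_div, Int.fract]
  exact hx.inv.sub_intCast _

theorem gaussBranch_gaussDigits (n : ℕ) {x : ℝ} (hx : Irrational x) (h0 : 0 ≤ x) (h1 : x ≤ 1) :
    gaussBranch (gaussDigits n x) ((fun y => Int.fract (1 / y))^[n] x) = x := by
  induction n generalizing x with
  | zero => rfl
  | succ n ih =>
    have hpos : 0 < x := lt_of_le_of_ne h0 hx.ne_zero.symm
    have h2 : 1 ≤ 1 / x := by rwa [le_div_iff₀ hpos, one_mul]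
    have h3 : 1 ≤ ⌊1 / x⌋₊ := Nat.le_floor (by simpa using h2)
    rw [gaussDigits, Function.iterate_succ_apply, gaussBranch,
      ih hx.fract_one_div (Int.fract_nonneg _) (Int.fract_lt_one _).le, Nat.cast_sub h3,
      ← Int.self_sub_floor, ← natCast_floor_eq_intCast_floor (by positivity)]
    simp

theorem eq_gaussDigits_of_gaussBranch_eq (w : List ℕ) {t x : ℝ} (hx : Irrational x)
    (ht : 0 ≤ t) (ht1 : t ≤ 1) (h : gaussBranch w t = x) : w = gaussDigits w.length x := by
  induction w generalizing x with
  | nil => rfl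
  | cons a w ih =>
    have h0 := gaussBranch_nonneg w ht
    have h1 := gaussBranch_le_one w ht ht1
    rw [gaussBranch] at h
    have hinv : 1 / x = a + 1 + gaussBranch w t := by rw [← h, one_div_one_div]
    have hlt : gaussBranch w t < 1 := by
      refine lt_of_le_of_ne h1 fun h2 => hx.inv.ne_nat (a + 2) ?_
      rw [← one_div, hinv, h2]
      push_cast
      ring
    have hfl : ⌊1 / x⌋ = (a + 1 : ℕ) := by
      rw [Int.floor_eq_iff, hinv]
      push_cast
      constructor <;> linarith
    have hfn : ⌊1 / x⌋₊ = a + 1 := by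
      rw [← Int.floor_toNat, hfl]
      simp
    have hfr : gaussBranch w t = Int.fract (1 / x) := by
      rw [Int.fract, hfl, hinv]
      push_cast
      ring
    rw [List.length_cons, gaussDigits, hfn, ← ih hx.fract_one_div hfr]
    rfl
open Metric Set in
/-- A set is winning as soon as, for each initial radius `r`, Alice has a winning strategy that only
looks at the number of the turn and at the centre of Bob's current ball. -/
theorem SchmidtWinning.of_positional {X : Type*} [MetricSpace X] [Nonempty X] {S : Set X}
    {α β : ℝ}
    (h : ∀ r : ℝ, 0 < r → ∃ g : ℕ → X → X,
      (∀ k z, closedBall (g k z) (α * ((α * β) ^ k * r)) ⊆ closedBall z ((α * β) ^ k * r)) ∧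
      ∀ z : ℕ → X,
        (∀ k, closedBall (z (k + 1)) ((α * β) ^ (k + 1) * r) ⊆
          closedBall (g k (z k)) (α * ((α * β) ^ k * r))) →
        ((⋂ k, closedBall (z k) ((α * β) ^ k * r)) ∩ S).Nonempty) :
    SchmidtWinning S α β := by
  choose! g hg hwin using h
  refine ⟨fun l => g (l.headD (Classical.arbitrary X, 0)).2 (l.length - 1) (l.getLastD (Classical.arbitrary X, 0)).1, ?_⟩
  intro z r h0 hr hB
  have hrk : ∀ k, r k = (α * β) ^ k * r 0 := by
    intro k
    induction k with
    | zero => simp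
    | succ k ih => rw [hr, ih]; ring
  have hstrat : ∀ k,
      g (((List.range (k + 1)).map fun i => (z i, r i)).headD (Classical.arbitrary X, 0)).2
        (((List.range (k + 1)).map fun i => (z i, r i)).length - 1)
        (((List.range (k + 1)).map fun i => (z i, r i)).getLastD (Classical.arbitrary X, 0)).1 =
      g (r 0) k (z k) := by
    intro k
    have h1 : ((List.range (k + 1)).map fun i => (z i, r i)).headD (Classical.arbitrary X, 0) = (z 0, r 0) := by
      simp [List.range_succ_eq_map]
    have h2 : ((List.range (k + 1)).map fun i => (z i, r i)).getLastD (Classical.arbitrary X, 0) =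
        (z k, r k) := by
      simp [List.range_succ]
    rw [h1, h2]
    simp
  simp only [hstrat] at hB ⊢
  refine ⟨fun k => ?_, ?_⟩
  · rw [hrk k]
    exact hg _ h0 k (z k)
  · have := hwin _ h0 z fun k => by
      have := hB k
      rwa [hrk, hrk k] at this
    simpa only [← hrk] using this

/-- The points of `F` lying within `γ` of `B`. -/
def nearPoints (F : Set ℝ) (γ : ℝ) (B : Set (Set.Icc (0 : ℝ) 1)) : Set ℝ :=
  {y ∈ F | ∃ x ∈ B, |(x : ℝ) - y| ≤ γ}

theorem nearPoints_mono (F : Set ℝ) (γ : ℝ) {A B : Set (Set.Icc (0 : ℝ) 1)} (h : A ⊆ B) :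
    nearPoints F γ A ⊆ nearPoints F γ B :=
  fun _ ⟨hy, x, hx, hxy⟩ => ⟨hy, x, h hx, hxy⟩

theorem abs_sub_le_of_mem_closedBall {x z : Set.Icc (0 : ℝ) 1} {r : ℝ}
    (h : x ∈ Metric.closedBall z r) : |(x : ℝ) - z| ≤ r := by
  simpa [Subtype.dist_eq, Real.dist_eq] using h

theorem closedBall_subset_closedBall_of_abs_sub_le {x z : Set.Icc (0 : ℝ) 1} {s r : ℝ}
    (h : |(x : ℝ) - z| ≤ r - s) : Metric.closedBall x s ⊆ Metric.closedBall z r := by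
  apply Metric.closedBall_subset_closedBall'
  rw [Subtype.dist_eq, Real.dist_eq]
  linarith

open Metric in
/-- In one move Alice can stay away from at least half of the points that are close to Bob's
ball. -/
theorem exists_closedBall_ncard_nearPoints_le {α r γ : ℝ} (hα1 : α < 1 / 2)
    (hr : 0 < r) (F : Set ℝ) (hγ : γ < (1 - 2 * α) * r) (z : Set.Icc (0 : ℝ) 1)
    (hz0 : r ≤ z) (hz1 : z + r ≤ 1) (hα : 0 < α)
    (hfin : (nearPoints F γ (closedBall z r)).Finite) :
    ∃ z' : Set.Icc (0 : ℝ) 1, closedBall z' (α * r) ⊆ closedBall z r ∧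
      (nearPoints F γ (closedBall z' (α * r))).ncard ≤
        (nearPoints F γ (closedBall z r)).ncard / 2 := by
  have har : 0 < α * r := by positivity
  have har1 : α * r < r := by nlinarith
  let u : Set.Icc (0 : ℝ) 1 := ⟨z - (1 - α) * r, by constructor <;> nlinarith⟩
  let v : Set.Icc (0 : ℝ) 1 := ⟨z + (1 - α) * r, by constructor <;> nlinarith⟩
  have hu : closedBall u (α * r) ⊆ closedBall z r := by
    apply closedBall_subset_closedBall_of_abs_sub_le
    rw [abs_le]
    constructor <;> simp only [u] <;> nlinarith
  have hv : closedBall v (α * r) ⊆ closedBall z r := by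
    apply closedBall_subset_closedBall_of_abs_sub_le
    rw [abs_le]
    constructor <;> simp only [v] <;> nlinarith
  have hdisj : Disjoint (nearPoints F γ (closedBall u (α * r)))
      (nearPoints F γ (closedBall v (α * r))) := by
    rw [Set.disjoint_left]
    rintro y ⟨-, x, hx, hxy⟩ ⟨-, x', hx', hxy'⟩
    have h1 := abs_le.1 (abs_sub_le_of_mem_closedBall hx)
    have h2 := abs_le.1 (abs_sub_le_of_mem_closedBall hx')
    have h3 := abs_le.1 hxy
    have h4 := abs_le.1 hxy'
    simp only [u, v] at h1 h2
    linarith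
  have hsum := Set.ncard_union_eq hdisj (hfin.subset (nearPoints_mono F γ hu))
    (hfin.subset (nearPoints_mono F γ hv))
  have hle := Set.ncard_le_ncard
    (Set.union_subset (nearPoints_mono F γ hu) (nearPoints_mono F γ hv)) hfin
  rcases le_total (nearPoints F γ (closedBall u (α * r))).ncard
    (nearPoints F γ (closedBall v (α * r))).ncard with h | h
  · exact ⟨u, hu, by omega⟩
  · exact ⟨v, hv, by omega⟩

open Metric in
/-- In one move Alice can leave a neighbourhood of the boundary of `[0, 1]`. -/
theorem exists_closedBall_away_from_boundary {α r : ℝ} (hα : 0 < α) (hα1 : α < 1 / 2)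
    (hr : 0 < r) (hr1 : r ≤ 1 / 4) (z : Set.Icc (0 : ℝ) 1) :
    ∃ z' : Set.Icc (0 : ℝ) 1, closedBall z' (α * r) ⊆ closedBall z r ∧
      ∀ x ∈ closedBall z' (α * r), (1 - 2 * α) * r ≤ x ∧ x + (1 - 2 * α) * r ≤ 1 := by
  have hz := z.2
  have har : 0 < α * r := by positivity
  have har1 : α * r < r := by nlinarith
  rcases le_total (z : ℝ) (1 / 2) with h | h
  · refine ⟨⟨z + (1 - α) * r, by constructor <;> nlinarith [hz.1]⟩, ?_, fun x hx => ?_⟩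
    · apply closedBall_subset_closedBall_of_abs_sub_le
      rw [abs_le]
      constructor <;> simp only <;> nlinarith
    · have h1 := abs_le.1 (abs_sub_le_of_mem_closedBall hx)
      simp only at h1
      constructor <;> nlinarith [hz.1]
  · refine ⟨⟨z - (1 - α) * r, by constructor <;> nlinarith [hz.2]⟩, ?_, fun x hx => ?_⟩
    · apply closedBall_subset_closedBall_of_abs_sub_le
      rw [abs_le]
      constructor <;> simp only <;> nlinarith
    · have h1 := abs_le.1 (abs_sub_le_of_mem_closedBall hx)
      simp only at h1
      constructor <;> nlinarith [hz.2]

open Metric in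
/-- If the points of `F j` lying in any ball of radius comparable to `(α * β) ^ (j * L)` number less
than `2 ^ L`, then Alice can stay away from all of them during the turns from `j * L` to
`(j + 1) * L`. -/
theorem SchmidtWinning.of_few_points {S : Set (Set.Icc (0 : ℝ) 1)} {α β : ℝ} (hα : 0 < α)
    (hα1 : α < 1 / 2) (hβ : 0 < β) (hβ1 : β < 1) {L : ℕ} (hL : 0 < L)
    (h : ∀ r : ℝ, 0 < r → ∃ F : ℕ → Set ℝ,
      (∀ j z, {y ∈ F j | |y - z| ≤ 2 * ((α * β) ^ (j * L) * r)}.Finite ∧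
        {y ∈ F j | |y - z| ≤ 2 * ((α * β) ^ (j * L) * r)}.ncard < 2 ^ L) ∧
      ∀ x : Set.Icc (0 : ℝ) 1,
        (∀ j, ∀ y ∈ F j, (1 - 2 * α) / 2 * ((α * β) ^ ((j + 1) * L) * r) < |(x : ℝ) - y|) →
        x ∈ S) :
    SchmidtWinning S α β := by
  have hρ : 0 < α * β := by positivity
  have hρ1 : α * β < 1 := by nlinarith
  have hsmall : ∀ r ε : ℝ, 0 < r → 0 < ε → ∃ k : ℕ, (α * β) ^ k * r ≤ ε := by
    intro r ε hr hε
    obtain ⟨k, hk⟩ := exists_pow_lt_of_lt_one (div_pos hε hr) hρ1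
    exact ⟨k, by rw [lt_div_iff₀ hr] at hk; exact hk.le⟩
  apply SchmidtWinning.of_positional
  intro r hr
  have hR : ∀ k, 0 < (α * β) ^ k * r := fun k => by positivity
  have hanti : ∀ {m n : ℕ}, m ≤ n → (α * β) ^ n * r ≤ (α * β) ^ m * r := fun hmn =>
    mul_le_mul_of_nonneg_right (pow_le_pow_of_le_one hρ.le hρ1.le hmn) hr.le
  obtain ⟨k₀, hk₀⟩ := hsmall r (1 / 4) hr (by norm_num)
  obtain ⟨k', hk'⟩ := hsmall r ((1 - 2 * α) * ((α * β) ^ k₀ * r)) hr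
    (mul_pos (by linarith) (hR _))
  set k₁ := max k' (k₀ + 1) with hk₁
  have hk₁r : (α * β) ^ k₁ * r ≤ (1 - 2 * α) * ((α * β) ^ k₀ * r) :=
    (hanti (le_max_left _ _)).trans hk'
  obtain ⟨F, hF, hFS⟩ := h _ (hR k₁)
  set γ : ℕ → ℝ := fun j => (1 - 2 * α) / 2 * ((α * β) ^ ((j + 1) * L) * ((α * β) ^ k₁ * r))
    with hγ
  have hstep : ∀ k (z : Set.Icc (0 : ℝ) 1), ∃ z' : Set.Icc (0 : ℝ) 1,
      closedBall z' (α * ((α * β) ^ k * r)) ⊆ closedBall z ((α * β) ^ k * r) ∧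
      (k = k₀ → ∀ x ∈ closedBall z' (α * ((α * β) ^ k * r)),
        (1 - 2 * α) * ((α * β) ^ k * r) ≤ x ∧ x + (1 - 2 * α) * ((α * β) ^ k * r) ≤ 1) ∧
      (∀ j i, i < L → k = k₁ + j * L + i → (α * β) ^ k * r ≤ z → z + (α * β) ^ k * r ≤ 1 →
        (nearPoints (F j) (γ j) (closedBall z ((α * β) ^ k * r))).Finite →
        (nearPoints (F j) (γ j) (closedBall z' (α * ((α * β) ^ k * r)))).ncard ≤
          (nearPoints (F j) (γ j) (closedBall z ((α * β) ^ k * r))).ncard / 2) := by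
    intro k z
    rcases lt_trichotomy k k₀ with hk | hk | hk
    · refine ⟨z, closedBall_subset_closedBall (by nlinarith [hR k]), fun h => by omega, ?_⟩
      intro j i _ hki
      omega
    · obtain ⟨z', h1, h2⟩ :=
        exists_closedBall_away_from_boundary hα hα1 (hR k) (by rwa [hk]) z
      exact ⟨z', h1, fun _ => h2, fun j i _ hki => by omega⟩
    · by_cases hc : k₁ ≤ k ∧ (α * β) ^ k * r ≤ z ∧ z + (α * β) ^ k * r ≤ 1 ∧
        (nearPoints (F ((k - k₁) / L)) (γ ((k - k₁) / L))
          (closedBall z ((α * β) ^ k * r))).Finite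
      · obtain ⟨hkk, hz0, hz1, hfin⟩ := hc
        have hγk : γ ((k - k₁) / L) < (1 - 2 * α) * ((α * β) ^ k * r) := by
          have h1 : k ≤ ((k - k₁) / L + 1) * L + k₁ := by
            have := Nat.div_add_mod (k - k₁) L
            have := Nat.mod_lt (k - k₁) hL
            nlinarith [Nat.sub_add_cancel hkk]
          have h2 := hanti h1
          rw [pow_add, mul_assoc] at h2
          have h3 := hR k
          simp only [hγ]
          nlinarith
        obtain ⟨z', h1, h2⟩ := exists_closedBall_ncard_nearPoints_le hα1 (hR k)
          (F ((k - k₁) / L)) hγk z hz0 hz1 hα hfin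
        refine ⟨z', h1, fun h => by omega, ?_⟩
        intro j i hi hki _ _ _
        have hj : (k - k₁) / L = j := by
          rw [show k - k₁ = i + L * j by rw [hki, mul_comm]; omega, Nat.add_mul_div_left _ _ hL,
            Nat.div_eq_of_lt hi, zero_add]
        rwa [hj] at h2
      · refine ⟨z, closedBall_subset_closedBall (by nlinarith [hR k]), fun h => by omega, ?_⟩
        intro j i hi hki hz0 hz1 hfin
        have hj : (k - k₁) / L = j := by
          rw [show k - k₁ = i + L * j by rw [hki, mul_comm]; omega, Nat.add_mul_div_left _ _ hL,
            Nat.div_eq_of_lt hi, zero_add]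
        exact absurd ⟨by omega, hz0, hz1, by rwa [hj]⟩ hc
  choose g hg hpush hhalf using hstep
  refine ⟨g, hg, fun z hz => ?_⟩
  have hnest : ∀ k, closedBall (z (k + 1)) ((α * β) ^ (k + 1) * r) ⊆
      closedBall (z k) ((α * β) ^ k * r) := fun k => (hz k).trans (hg k (z k))
  have hant : Antitone fun k => closedBall (z k) ((α * β) ^ k * r) := antitone_nat_of_succ_le hnest
  obtain ⟨x, hx⟩ := IsCompact.nonempty_iInter_of_sequence_nonempty_isCompact_isClosed
    (fun k => closedBall (z k) ((α * β) ^ k * r)) hnest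
    (fun k => nonempty_closedBall.2 (hR k).le) isClosed_closedBall.isCompact
    (fun k => isClosed_closedBall)
  refine ⟨x, hx, hFS x fun j y hy => ?_⟩
  have hinside : ∀ k, k₁ ≤ k → (α * β) ^ k * r ≤ z k ∧ z k + (α * β) ^ k * r ≤ 1 := by
    intro k hk
    have h1 : z k ∈ closedBall (z (k₀ + 1)) ((α * β) ^ (k₀ + 1) * r) :=
      hant ((le_max_right _ _).trans hk) (mem_closedBall_self (hR k).le)
    have h2 := hpush k₀ (z k₀) rfl (z k) (hz k₀ h1)
    have h3 := hanti hk
    constructor <;> linarith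
  have hcount : ∀ i, i ≤ L →
      (nearPoints (F j) (γ j)
        (closedBall (z (k₁ + j * L + i)) ((α * β) ^ (k₁ + j * L + i) * r))).Finite ∧
      (nearPoints (F j) (γ j)
        (closedBall (z (k₁ + j * L + i)) ((α * β) ^ (k₁ + j * L + i) * r))).ncard <
        2 ^ (L - i) := by
    intro i
    induction i with
    | zero =>
      intro _
      have hsub : nearPoints (F j) (γ j)
          (closedBall (z (k₁ + j * L)) ((α * β) ^ (k₁ + j * L) * r)) ⊆
          {y ∈ F j | |y - z (k₁ + j * L)| ≤ 2 * ((α * β) ^ (j * L) * ((α * β) ^ k₁ * r))} := by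
        rintro y ⟨hy, x, hx, hxy⟩
        refine ⟨hy, ?_⟩
        have h1 := abs_sub_le_of_mem_closedBall hx
        have h2 : γ j ≤ (α * β) ^ (k₁ + j * L) * r := by
          have h3 := hanti (show k₁ + j * L ≤ (j + 1) * L + k₁ by nlinarith)
          rw [pow_add _ ((j + 1) * L), mul_assoc] at h3
          have h4 : 0 < (α * β) ^ ((j + 1) * L) * ((α * β) ^ k₁ * r) := by positivity
          simp only [hγ]
          nlinarith
        rw [← mul_assoc ((α * β) ^ (j * L)), ← pow_add, add_comm (j * L)]
        have h3 := abs_sub_le y x (z (k₁ + j * L))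
        rw [abs_sub_comm y x] at h3
        linarith
      obtain ⟨h1, h2⟩ := hF j (z (k₁ + j * L))
      exact ⟨h1.subset hsub, (Set.ncard_le_ncard hsub h1).trans_lt h2⟩
    | succ i ih =>
      intro hi
      obtain ⟨h1, h2⟩ := ih (by omega)
      obtain ⟨h3, h4⟩ := hinside (k₁ + j * L + i) (by omega)
      have h5 := hhalf _ (z (k₁ + j * L + i)) j i (by omega) rfl h3 h4 h1
      have hsub := nearPoints_mono (F j) (γ j) (hz (k₁ + j * L + i))
      have hfin := h1.subset (nearPoints_mono (F j) (γ j) (hg _ (z (k₁ + j * L + i))))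
      refine ⟨hfin.subset hsub, ?_⟩
      have h6 := Set.ncard_le_ncard hsub hfin
      rw [show L - i = (L - (i + 1)) + 1 by omega, pow_succ] at h2
      refine h6.trans_lt (h5.trans_lt ?_)
      omega
  by_contra! hle
  obtain ⟨h1, h2⟩ := hcount L le_rfl
  rw [Nat.sub_self, pow_zero, Nat.lt_one_iff, Set.ncard_eq_zero h1] at h2
  exact (Set.eq_empty_iff_forall_notMem.1 h2 y) ⟨hy, x, Set.mem_iInter.1 hx _, hle⟩

/-- The words whose branch passes through a given irrational number and whose denominators lie in a
given range. -/
theorem exists_finset_words_through {u X R : ℝ} (hu : Irrational u) (hR : 0 < R)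
    {D : ℕ} (hD : 1 ≤ 4 ^ D * (X * R)) :
    ∃ s : Finset (List ℕ), s.card ≤ 2 * D ∧ ∀ w : List ℕ, u ∈ gaussBranch w '' Set.Icc 0 1 →
      X ≤ gaussDen w 0 ^ 2 → gaussDen w 0 ^ 2 * R < 1 → w ∈ s := by
  classical
  by_cases hne : ∃ n : ℕ, ∃ w : List ℕ, w.length = n ∧ u ∈ gaussBranch w '' Set.Icc 0 1 ∧
      X ≤ gaussDen w 0 ^ 2
  · obtain ⟨w₀, hw₀, ⟨t₀, ht₀, hut₀⟩, hX₀⟩ := Nat.find_spec hne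
    set n := Nat.find hne with hn
    refine ⟨(Finset.range (2 * D)).image fun d => gaussDigits (n + d) u,
      Finset.card_image_le.trans (by simp), ?_⟩
    intro w hw hXw hRw
    have hlen : n ≤ w.length := Nat.find_min' hne ⟨w, rfl, hw, hXw⟩
    obtain ⟨d, hd⟩ := Nat.exists_eq_add_of_le hlen
    obtain ⟨t, ht, hut⟩ := hw
    have hwd := eq_gaussDigits_of_gaussBranch_eq w hu ht.1 ht.2 hut
    have hwd₀ := eq_gaussDigits_of_gaussBranch_eq w₀ hu ht₀.1 ht₀.2 hut₀
    rw [hd] at hwd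
    rw [hw₀] at hwd₀
    refine Finset.mem_image.2 ⟨d, Finset.mem_range.2 ?_, hwd.symm⟩
    by_contra! hdD
    obtain ⟨v, hv, hv'⟩ := gaussDigits_add n d u
    rw [← hwd, ← hwd₀] at hv'
    have h1 := gaussDen_mul_le_append w₀ v
    rw [← hv'] at h1
    have h2 := two_pow_le_gaussDen v
    have h3 : (2 : ℝ) ^ D ≤ 2 ^ (v.length / 2) :=
      pow_le_pow_right₀ (by norm_num) (by omega)
    have h4 := one_le_gaussDen w₀ le_rfl
    have h5 : gaussDen w₀ 0 * 2 ^ D ≤ gaussDen w 0 :=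
      (mul_le_mul_of_nonneg_left (h3.trans h2) (by linarith)).trans h1
    have h6 : (gaussDen w₀ 0 * 2 ^ D) ^ 2 ≤ gaussDen w 0 ^ 2 :=
      pow_le_pow_left₀ (by positivity) h5 2
    have h7 : (gaussDen w₀ 0 * 2 ^ D) ^ 2 = gaussDen w₀ 0 ^ 2 * 4 ^ D := by
      rw [mul_pow, ← pow_mul, mul_comm D, pow_mul]
      norm_num
    have h8 : X * 4 ^ D ≤ gaussDen w₀ 0 ^ 2 * 4 ^ D := by gcongr
    have h9 : X * 4 ^ D * R ≤ gaussDen w 0 ^ 2 * R :=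
      mul_le_mul_of_nonneg_right (h8.trans (h7 ▸ h6)) hR.le
    linarith
  · push Not at hne
    exact ⟨∅, by simp, fun w hw hXw _ => absurd hXw (not_le.2 (hne _ w rfl hw))⟩

theorem continuousOn_gaussBranch (w : List ℕ) :
    ContinuousOn (gaussBranch w) (Set.Icc 0 1) := by
  refine (LipschitzOnWith.of_dist_le_mul (K := 1) fun s hs t ht => ?_).continuousOn
  rw [Real.dist_eq, Real.dist_eq, NNReal.coe_one, one_mul]
  refine (abs_gaussBranch_sub_le w hs.1 ht.1).trans (div_le_self (abs_nonneg _) ?_)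
  exact one_le_pow₀ (one_le_gaussDen w le_rfl)

/-- Around each of its points, the range of a branch contains an interval of length comparable to
the inverse square of the denominator. -/
theorem exists_Icc_subset_image_gaussBranch (w : List ℕ) {y R : ℝ}
    (hy : y ∈ gaussBranch w '' Set.Icc 0 1) (hR : 0 < R) (hw : gaussDen w 0 ^ 2 * R < 1) :
    ∃ c, y - R / 4 ≤ c ∧ c ≤ y ∧ Set.Icc c (c + R / 4) ⊆ gaussBranch w '' Set.Icc 0 1 := by
  have hord : (gaussBranch w '' Set.Icc 0 1).OrdConnected :=
    (isPreconnected_Icc.image _ (continuousOn_gaussBranch w)).ordConnected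
  have h0 : gaussBranch w 0 ∈ gaussBranch w '' Set.Icc 0 1 :=
    Set.mem_image_of_mem _ (by simp)
  have h1 : gaussBranch w 1 ∈ gaussBranch w '' Set.Icc 0 1 :=
    Set.mem_image_of_mem _ (by simp)
  have hq := one_le_gaussDen w le_rfl
  have hq1 := one_le_gaussDen w zero_le_one
  have hlen : R / 2 ≤ |gaussBranch w 0 - gaussBranch w 1| := by
    rw [abs_gaussBranch_sub w le_rfl zero_le_one, zero_sub, abs_neg, abs_one,
      le_div_iff₀ (by positivity)]
    have h2 := gaussDen_le_two_mul w zero_le_one le_rfl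
    have h3 : gaussDen w 0 * gaussDen w 1 ≤ gaussDen w 0 * (2 * gaussDen w 0) := by gcongr
    nlinarith
  have hfar : ∃ e ∈ gaussBranch w '' Set.Icc 0 1, R / 4 ≤ |e - y| := by
    by_contra! hcon
    have h2 := hcon _ h0
    have h3 := hcon _ h1
    have h4 := abs_sub_le (gaussBranch w 0) y (gaussBranch w 1)
    rw [abs_sub_comm y] at h4
    linarith
  obtain ⟨e, he, hey⟩ := hfar
  rcases le_abs.1 hey with h | h
  · refine ⟨y, by linarith, le_rfl, fun x hx => hord.out hy he ⟨hx.1, by linarith [hx.2]⟩⟩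
  · refine ⟨y - R / 4, le_rfl, by linarith, fun x hx => hord.out he hy ⟨?_, ?_⟩⟩
    · linarith [hx.1]
    · linarith [hx.2]

/-- A ball of radius comparable to `R` contains few points of the form `y w`, where `y w` belongs to
the range of the branch of `w` and the denominator of `w` is between `√X` and `√(1 / R)`. -/
theorem exists_finset_words_near {X R : ℝ} (hR : 0 < R) {D : ℕ}
    (hD : 1 ≤ 4 ^ D * (X * R)) {y : List ℕ → ℝ}
    (hy : ∀ w, y w ∈ gaussBranch w '' Set.Icc 0 1) (z : ℝ) :
    ∃ s : Finset (List ℕ), s.card ≤ 96 * D ∧ ∀ w : List ℕ, |y w - z| ≤ 2 * R →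
      X ≤ gaussDen w 0 ^ 2 → gaussDen w 0 ^ 2 * R < 1 → w ∈ s := by
  classical
  have hu : ∀ i : ℕ, ∃ u, Irrational u ∧ z - 3 * R + i * (R / 8) < u ∧
      u < z - 3 * R + i * (R / 8) + R / 8 := fun i => exists_irrational_btwn (by linarith)
  choose u hu hlo hhi using hu
  choose s hs hmem using fun i => exists_finset_words_through (hu i) hR hD
  refine ⟨(Finset.range 48).biUnion s, ?_, fun w hw hXw hRw => ?_⟩
  · refine (Finset.card_biUnion_le_card_mul _ _ (2 * D) fun i _ => hs i).trans ?_
    rw [Finset.card_range]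
    omega
  · obtain ⟨c, hc1, hc2, hsub⟩ := exists_Icc_subset_image_gaussBranch w (hy w) hR hRw
    have hw' := abs_le.1 hw
    have hnn : 0 ≤ (c - (z - 3 * R)) / (R / 8) := by
      apply div_nonneg <;> linarith
    have h1 := Nat.le_ceil ((c - (z - 3 * R)) / (R / 8))
    have h2 := Nat.ceil_lt_add_one hnn
    set i := ⌈(c - (z - 3 * R)) / (R / 8)⌉₊
    rw [div_le_iff₀ (by positivity)] at h1
    rw [← sub_lt_iff_lt_add, lt_div_iff₀ (by positivity)] at h2
    refine Finset.mem_biUnion.2 ⟨i, Finset.mem_range.2 ?_, hmem i w (hsub ⟨?_, ?_⟩) hXw hRw⟩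
    · have h3 : (i : ℝ) < 48 := by
        by_contra! h
        nlinarith
      exact_mod_cast h3
    · linarith [hlo i]
    · linarith [hhi i]

theorem exists_mul_add_one_lt_two_pow (C : ℕ) : ∃ L : ℕ, 0 < L ∧ C * L + 1 < 2 ^ L := by
  refine ⟨2 * (2 * C + 1), by omega, ?_⟩
  have h : 2 * C + 1 + 1 ≤ 2 ^ (2 * C + 1) := Nat.lt_two_pow_self
  rw [mul_comm 2 (2 * C + 1), pow_mul]
  nlinarith

theorem exists_nat_le_lt_geometric {ρ a Q : ℝ} (hρ : 0 < ρ) (hρ1 : ρ < 1) (hQ : a ≤ Q)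
    (ha : 0 < a) : ∃ j : ℕ, a ≤ ρ ^ j * Q ∧ ρ ^ (j + 1) * Q < a := by
  have hne : ∃ j : ℕ, ρ ^ (j + 1) * Q < a := by
    obtain ⟨n, hn⟩ := exists_pow_lt_of_lt_one (div_pos ha (ha.trans_le hQ)) hρ1
    rw [lt_div_iff₀ (ha.trans_le hQ)] at hn
    refine ⟨n, lt_of_le_of_lt ?_ hn⟩
    exact mul_le_mul_of_nonneg_right (pow_le_pow_of_le_one hρ.le hρ1.le n.le_succ)
      (ha.le.trans hQ)
  classical
  refine ⟨Nat.find hne, ?_, Nat.find_spec hne⟩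
  cases h : Nat.find hne with
  | zero => simpa using hQ
  | succ n => exact not_lt.1 (Nat.find_min hne (show n < Nat.find hne by omega))

theorem exists_forall_le_gaussDen_sq (M : ℝ) :
    ∃ N : ℕ, ∀ w : List ℕ, N ≤ w.length → M ≤ gaussDen w 0 ^ 2 := by
  obtain ⟨m, hm⟩ := pow_unbounded_of_one_lt M one_lt_two
  refine ⟨2 * m, fun w hw => ?_⟩
  have h1 : (2 : ℝ) ^ m ≤ 2 ^ (w.length / 2) := pow_le_pow_right₀ (by norm_num) (by omega)
  have h2 := two_pow_le_gaussDen w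
  have h3 := one_le_gaussDen w le_rfl
  nlinarith

theorem coe_iterate_eq_iterate_fract {T : Set.Icc (0 : ℝ) 1 → Set.Icc (0 : ℝ) 1}
    (hT : ∀ x : Set.Icc (0 : ℝ) 1,
      (T x : ℝ) = if (x : ℝ) = 0 then 0 else Int.fract (1 / (x : ℝ)))
    (n : ℕ) (x : Set.Icc (0 : ℝ) 1) :
    (T^[n] x : ℝ) = (fun y : ℝ => Int.fract (1 / y))^[n] x := by
  have h : Function.Semiconj (Subtype.val : Set.Icc (0 : ℝ) 1 → ℝ) T
      (fun y : ℝ => Int.fract (1 / y)) := by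
    intro x
    rw [hT]
    split_ifs with hx <;> simp [hx]
  exact (h.iterate_right n).eq x

/-- For the Gauss map `T` on `[0,1]` (`T 0 = 0`, `T x = 1/x mod 1`
for `x ≠ 0`) and any equicontinuous sequence `(f n)` of self-maps of `[0,1]`, the set
`BA((f n)) = {x : liminf_n |T^n x - f n x| > 0}` is `α`-winning for Schmidt's game
on `[0,1]` (i.e. `(α, β)`-winning for every `β ∈ (0,1)`), for every `α ∈ (0, 1/2)`. -/
theorem gaussMap_twisted_badly_approximable_schmidt_winning
    (T : Set.Icc (0:ℝ) 1 → Set.Icc (0:ℝ) 1)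
    (hT : ∀ x : Set.Icc (0:ℝ) 1,
      ((T x : ℝ)) = if (x : ℝ) = 0 then 0 else Int.fract (1 / (x : ℝ)))
    (f : ℕ → Set.Icc (0:ℝ) 1 → Set.Icc (0:ℝ) 1)
    (hf : ∀ ε : ℝ, 0 < ε → ∃ δ : ℝ, 0 < δ ∧ ∀ (n : ℕ) (x y : Set.Icc (0:ℝ) 1),
      |(x : ℝ) - (y : ℝ)| < δ → |((f n x : ℝ)) - ((f n y : ℝ))| < ε)
    (α : ℝ) (hα : α ∈ Set.Ioo (0:ℝ) (1/2)) :
    ∀ β ∈ Set.Ioo (0:ℝ) 1,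
      SchmidtWinning
        {x : Set.Icc (0:ℝ) 1 |
          0 < Filter.liminf (fun n => |((T^[n] x : ℝ)) - ((f n x : ℝ))|) Filter.atTop}
        α β := by
  rintro β ⟨hβ, hβ1⟩
  obtain ⟨hα0, hα1⟩ := hα
  have hρ : 0 < α * β := by positivity
  have hρ1 : α * β < 1 := by nlinarith
  obtain ⟨e, he⟩ := exists_pow_lt_of_lt_one hρ (show (1 / 4 : ℝ) < 1 by norm_num)
  obtain ⟨L, hL, hL2⟩ := exists_mul_add_one_lt_two_pow (96 * e)
  have hD : 1 ≤ (4 : ℝ) ^ (e * L) * (α * β) ^ L := by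
    rw [pow_mul, ← mul_pow]
    refine one_le_pow₀ ?_
    have h4 : (4 : ℝ) ^ e * (1 / 4) ^ e = 1 := by rw [← mul_pow]; norm_num
    have h5 : (0 : ℝ) < 4 ^ e := by positivity
    nlinarith
  refine SchmidtWinning.of_few_points hα0 hα1 hβ hβ1 hL fun r hr => ?_
  let p : List ℕ → Set.Icc (0 : ℝ) 1 := fun w =>
    ⟨gaussBranch w 0, gaussBranch_nonneg w le_rfl, gaussBranch_le_one w le_rfl zero_le_one⟩
  let y : List ℕ → ℝ := fun w => gaussBranch w (f w.length (p w))
  have hy : ∀ w, y w ∈ gaussBranch w '' Set.Icc 0 1 := fun w =>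
    Set.mem_image_of_mem _ (f w.length (p w)).2
  obtain ⟨rat, hrat⟩ := exists_surjective_nat ℚ
  set W : ℕ → Set (List ℕ) := fun j =>
    {w | (α * β) ^ L ≤ (α * β) ^ (j * L) * r * gaussDen w 0 ^ 2 ∧
      gaussDen w 0 ^ 2 * ((α * β) ^ (j * L) * r) < 1} with hW
  refine ⟨fun j => insert (rat j : ℝ) (y '' W j), fun j z => ?_, fun x hx => ?_⟩
  · have hRj : 0 < (α * β) ^ (j * L) * r := by positivity
    obtain ⟨s, hs, hmem⟩ := exists_finset_words_near
      (X := (α * β) ^ L / ((α * β) ^ (j * L) * r)) hRj (D := e * L)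
      (by rwa [div_mul_cancel₀ _ hRj.ne']) hy z
    classical
    have hsub : {v ∈ insert (rat j : ℝ) (y '' W j) | |v - z| ≤ 2 * ((α * β) ^ (j * L) * r)} ⊆
        ↑(insert (rat j : ℝ) (s.image y)) := by
      rintro v ⟨rfl | ⟨w, ⟨hw1, hw2⟩, rfl⟩, hv⟩
      · simp
      · refine Finset.mem_coe.2 (Finset.mem_insert_of_mem (Finset.mem_image_of_mem _ ?_))
        exact hmem w hv (by rw [div_le_iff₀ hRj]; linarith) hw2
    refine ⟨(Finset.finite_toSet _).subset hsub, ?_⟩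
    refine (Set.ncard_le_ncard hsub (Finset.finite_toSet _)).trans_lt ?_
    rw [Set.ncard_coe_finset]
    refine lt_of_le_of_lt ?_ hL2
    refine (Finset.card_insert_le _ _).trans (Nat.succ_le_succ ?_)
    rw [mul_assoc]
    exact Finset.card_image_le.trans hs
  · have hirr : Irrational x := by
      rintro ⟨q, hq⟩
      obtain ⟨j, rfl⟩ := hrat q
      have h1 := hx j _ (Set.mem_insert _ _)
      rw [← hq, sub_self, abs_zero] at h1
      have h2 : 0 < (1 - 2 * α) / 2 * ((α * β) ^ ((j + 1) * L) * r) :=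
        mul_pos (by linarith) (by positivity)
      linarith
    set c : ℝ := (1 - 2 * α) / 4 * (α * β) ^ (2 * L) with hc
    have hc0 : 0 < c := mul_pos (by linarith) (by positivity)
    obtain ⟨δ, hδ, hfδ⟩ := hf c hc0
    obtain ⟨N, hN⟩ := exists_forall_le_gaussDen_sq (max (1 / r) (2 / δ))
    have hev : ∀ n, N ≤ n → c ≤ |(T^[n] x : ℝ) - f n x| := by
      intro n hn
      set w := gaussDigits n (x : ℝ) with hw
      have hwn : w.length = n := length_gaussDigits n _
      have hxw : gaussBranch w (T^[n] x : ℝ) = x := by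
        rw [coe_iterate_eq_iterate_fract hT]
        exact gaussBranch_gaussDigits n hirr x.2.1 x.2.2
      have hM := hN w (by omega)
      have hq : 0 < gaussDen w 0 ^ 2 := by
        have := one_le_gaussDen w le_rfl
        positivity
      have hqr : 1 ≤ r * gaussDen w 0 ^ 2 := by
        have := (le_max_left _ _).trans hM
        rwa [div_le_iff₀' hr] at this
      have hρL : 0 < (α * β) ^ L := by positivity
      obtain ⟨j, hj1, hj2⟩ := exists_nat_le_lt_geometric hρL
        (pow_lt_one₀ hρ.le hρ1 hL.ne') hqr zero_lt_one
      rw [← pow_mul, mul_comm L] at hj1 hj2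
      have hwW : w ∈ W (j + 1) := by
        refine ⟨?_, by linarith⟩
        rw [add_mul, one_mul, pow_add]
        nlinarith
      have h1 := hx (j + 1) _ (Set.mem_insert_of_mem _ (Set.mem_image_of_mem y hwW))
      have h2 : |(x : ℝ) - y w| ≤ |(T^[n] x : ℝ) - f n (p w)| / gaussDen w 0 ^ 2 := by
        have := abs_gaussBranch_sub_le w (T^[n] x).2.1 (f n (p w)).2.1
        rwa [hxw, show gaussBranch w (f n (p w)) = y w by simp only [y, hwn]] at this
      have h3 : 2 * c < |(T^[n] x : ℝ) - f n (p w)| := by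
        have h4 := h1.trans_le h2
        rw [lt_div_iff₀ hq] at h4
        refine lt_of_le_of_lt ?_ h4
        have h5 : (α * β) ^ ((j + 1 + 1) * L) = (α * β) ^ (2 * L) * (α * β) ^ (j * L) := by
          rw [← pow_add]
          congr 1
          ring
        rw [h5, hc]
        have h6 : 0 ≤ (1 - 2 * α) / 2 * (α * β) ^ (2 * L) :=
          mul_nonneg (by linarith) (by positivity)
        nlinarith
      have h4 : |(x : ℝ) - p w| < δ := by
        have h5 := abs_gaussBranch_sub_le w (T^[n] x).2.1 le_rfl
        rw [hxw, sub_zero, abs_of_nonneg (T^[n] x).2.1] at h5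
        refine h5.trans_lt ?_
        have h6 := (le_max_right _ _).trans hM
        rw [div_le_iff₀ hδ] at h6
        rw [div_lt_iff₀ hq]
        linarith [(T^[n] x).2.2]
      have h5 := hfδ n x (p w) h4
      have h6 := abs_sub_le (T^[n] x : ℝ) (f n x) (f n (p w))
      linarith
    refine hc0.trans_le (Filter.le_liminf_of_le ?_ (Filter.eventually_atTop.2 ⟨N, hev⟩))
    refine (Filter.isBoundedUnder_of ⟨1, fun n => ?_⟩).isCoboundedUnder_ge
    have h1 := (T^[n] x).2
    have h2 := (f n x).2
    rw [abs_le]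
    constructor <;> linarith [h1.1, h1.2, h2.1, h2.2]
end

section
/- Let γ > 1 be an integer, let T : [0,1] → [0,1] be the map T x = γx mod 1, and let (f_n : [0,1] → [0,1])_{n≥1} be an equicontinuous sequence of functions. Then for every nonempty open subset U of [0,1], the Hausdorff dimension of {x ∈ U : liminf_{n→∞} |T^n x − f_n(x)| > 0} equals 1; in particular the set BA((f_n)_n) = {x ∈ [0,1] : liminf_{n→∞} |T^n x − f_n(x)| > 0} has local Hausdorff dimension 1. -/
open Filter Topology Set

/-- If sequences sharing their first `k` digits but not the next one have images
under `P` at distance at least a constant times `M ^ (-k / s)`, then `range P` has Hausdorff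
dimension at least `s`. -/
theorem le_dimH_range_of_digits_separated {X : Type*} [MetricSpace X] {M : ℕ} (hM : 1 < M)
    (P : (ℕ → Fin M) → X) (C s : NNReal) (hs : 0 < s)
    (hP : ∀ c d k, (∀ i < k, c i = d i) → c k ≠ d k →
      ((M : ℝ) ^ k)⁻¹ ≤ C * dist (P c) (P d) ^ (s : ℝ)) :
    (s : ENNReal) ≤ dimH (range P) := by
  have key : ∀ c d, dist (Real.ofDigits c) (Real.ofDigits d) ≤ C * dist (P c) (P d) ^ (s : ℝ) := by
    intro c d
    by_cases hcd : c = d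
    · subst hcd
      simp only [dist_self]
      positivity
    · have hex : ∃ k, c k ≠ d k := Function.ne_iff.mp hcd
      classical
      have hlt : ∀ i < Nat.find hex, c i = d i := fun i hi => not_not.mp (Nat.find_min hex hi)
      exact (Real.abs_ofDigits_sub_ofDigits_le hlt).trans (hP c d _ hlt (Nat.find_spec hex))
  have hM0 : Nonempty (Fin M) := ⟨⟨0, by omega⟩⟩
  let Q : X → (ℕ → Fin M) := Function.invFun P
  have hQ : ∀ x ∈ range P, P (Q x) = x := fun x hx => Function.invFun_eq hx
  have hold : HolderOnWith C s (fun x => Real.ofDigits (Q x)) (range P) := by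
    intro x hx y hy
    have h := key (Q x) (Q y)
    rw [hQ x hx, hQ y hy] at h
    rw [edist_nndist, edist_nndist, ← ENNReal.coe_rpow_of_nonneg _ s.coe_nonneg,
      ← ENNReal.coe_mul, ENNReal.coe_le_coe, ← NNReal.coe_le_coe]
    simpa using h
  have himage : Icc (0 : ℝ) 1 ⊆ (fun x => Real.ofDigits (Q x)) '' range P := by
    intro t ht
    obtain ⟨c, -, hc⟩ := Real.ofDigits_SurjOn hM ht
    refine ⟨P c, mem_range_self c, ?_⟩
    have h := key (Q (P c)) c
    rw [hQ _ (mem_range_self c), dist_self, Real.zero_rpow (by exact_mod_cast hs.ne'), mul_zero] at h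
    exact (dist_le_zero.mp h).trans hc
  have hone : dimH (Icc (0 : ℝ) 1) = 1 := by
    rw [Real.dimH_of_nonempty_interior (by simp)]
    simp
  have h := (dimH_mono himage).trans (hold.dimH_image_le hs)
  rw [hone, ENNReal.le_div_iff_mul_le (Or.inl (by exact_mod_cast hs.ne')) (Or.inl (by simp)),
    one_mul] at h
  exact h

section CantorScheme

variable {M : ℕ} (N i₀ m₀ : ℕ) (e : ℕ → ℕ → Fin M → ℕ)

/-- The index of the `N`-adic interval of generation `m₀ + k` selected by `c`: the initial interval
has index `i₀`, and `e k i` lists the children retained in the interval of index `i`. -/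
def cantorNode (c : ℕ → Fin M) : ℕ → ℕ
  | 0 => i₀
  | k + 1 => N * cantorNode c k + e k (cantorNode c k) (c k)

/-- The point selected by `c` in the Cantor scheme described by `e`. -/
noncomputable def cantorPoint (c : ℕ → Fin M) : ℝ :=
  ⨆ k, (cantorNode N i₀ e c k : ℝ) / (N : ℝ) ^ (m₀ + k)

theorem cantorNode_congr {c d : ℕ → Fin M} {k : ℕ} (h : ∀ i < k, c i = d i) :
    cantorNode N i₀ e c k = cantorNode N i₀ e d k := by
  induction k with
  | zero => rfl
  | succ k ih =>
    simp only [cantorNode, ih fun i hi => h i (by omega), h k (by omega)]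

variable {N e}

theorem cantorPoint_mem_Icc (he : ∀ k i a, 1 ≤ e k i a ∧ e k i a + 2 ≤ N) (c : ℕ → Fin M) (k : ℕ) :
    cantorPoint N i₀ m₀ e c * (N : ℝ) ^ (m₀ + k) ∈
      Icc (cantorNode N i₀ e c k : ℝ) (cantorNode N i₀ e c k + 1) := by
  have hN : (0 : ℝ) < N := by
    have := he 0 0 (c 0)
    exact_mod_cast (by omega : 0 < N)
  have hanti : Antitone fun n => Icc ((cantorNode N i₀ e c n : ℝ) / (N : ℝ) ^ (m₀ + n))
      ((cantorNode N i₀ e c n + 1 : ℝ) / (N : ℝ) ^ (m₀ + n)) := by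
    refine antitone_nat_of_succ_le fun n => ?_
    have h2 := (he n (cantorNode N i₀ e c n) (c n)).2
    have h2' : (e n (cantorNode N i₀ e c n) (c n) : ℝ) + 2 ≤ N := by exact_mod_cast h2
    refine Icc_subset_Icc ?_ ?_
    · rw [div_le_div_iff₀ (by positivity) (by positivity), ← add_assoc, pow_succ]
      simp only [cantorNode, Nat.cast_add, Nat.cast_mul]
      have : (0 : ℝ) ≤ e n (cantorNode N i₀ e c n) (c n) * (N : ℝ) ^ (m₀ + n) := by positivity
      linarith
    · rw [div_le_div_iff₀ (by positivity) (by positivity), ← add_assoc, pow_succ]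
      simp only [cantorNode, Nat.cast_add, Nat.cast_mul]
      have : (0 : ℝ) ≤ (N - 1 - e n (cantorNode N i₀ e c n) (c n)) * (N : ℝ) ^ (m₀ + n) :=
        mul_nonneg (by linarith) (by positivity)
      linarith
  have h := mem_iInter.mp (ciSup_mem_iInter_Icc_of_antitone_Icc hanti
    (fun n => by gcongr; linarith)) k
  rw [mem_Icc, div_le_iff₀ (by positivity), le_div_iff₀ (by positivity)] at h
  exact h

theorem cantorPoint_mem_Icc_add_one (he : ∀ k i a, 1 ≤ e k i a ∧ e k i a + 2 ≤ N)
    (c : ℕ → Fin M) (k : ℕ) :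
    cantorPoint N i₀ m₀ e c * (N : ℝ) ^ (m₀ + k + 1) ∈
      Icc (N * cantorNode N i₀ e c k + 1 : ℝ) (N * cantorNode N i₀ e c k + N - 1) := by
  have h := cantorPoint_mem_Icc i₀ m₀ he c (k + 1)
  have h1 := he k (cantorNode N i₀ e c k) (c k)
  have h2 : (1 : ℝ) ≤ e k (cantorNode N i₀ e c k) (c k) := by exact_mod_cast h1.1
  have h3 : (e k (cantorNode N i₀ e c k) (c k) : ℝ) + 2 ≤ N := by exact_mod_cast h1.2
  simp only [cantorNode, Nat.cast_add, Nat.cast_mul, ← add_assoc] at h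
  exact ⟨by linarith [h.1], by linarith [h.2]⟩

theorem cantorPoint_mem_Ioo (he : ∀ k i a, 1 ≤ e k i a ∧ e k i a + 2 ≤ N) (c : ℕ → Fin M) (k : ℕ) :
    cantorPoint N i₀ m₀ e c * (N : ℝ) ^ (m₀ + k) ∈
      Ioo (cantorNode N i₀ e c k : ℝ) (cantorNode N i₀ e c k + 1) := by
  have hN : (0 : ℝ) < N := by
    have := he 0 0 (c 0)
    exact_mod_cast (by omega : 0 < N)
  obtain ⟨h1, h2⟩ := cantorPoint_mem_Icc_add_one i₀ m₀ he c k
  rw [pow_succ] at h1 h2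
  constructor <;> nlinarith

theorem inv_pow_le_dist_cantorPoint (he : ∀ k i a, 1 ≤ e k i a ∧ e k i a + 2 ≤ N)
    (hinj : ∀ k i, Function.Injective (e k i)) {c d : ℕ → Fin M} {k : ℕ}
    (h : ∀ i < k, c i = d i) (hk : c k ≠ d k) :
    ((N : ℝ) ^ (m₀ + k + 2))⁻¹ ≤ dist (cantorPoint N i₀ m₀ e c) (cantorPoint N i₀ m₀ e d) := by
  have hN : 0 < N := by
    have := he 0 0 (c 0)
    omega
  have hN' : (0 : ℝ) < N := by exact_mod_cast hN
  have hne : cantorNode N i₀ e c (k + 1) ≠ cantorNode N i₀ e d (k + 1) := by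
    simp only [cantorNode, cantorNode_congr N i₀ e h]
    intro h'
    exact hk (hinj _ _ (Nat.add_left_cancel h'))
  have key : ∀ c d : ℕ → Fin M, cantorNode N i₀ e c (k + 1) < cantorNode N i₀ e d (k + 1) →
      ((N : ℝ) ^ (m₀ + k + 2))⁻¹ ≤ dist (cantorPoint N i₀ m₀ e c) (cantorPoint N i₀ m₀ e d) := by
    intro c d hlt
    have h1 := (cantorPoint_mem_Icc_add_one i₀ m₀ he c (k + 1)).2
    have h2 := (cantorPoint_mem_Icc_add_one i₀ m₀ he d (k + 1)).1
    have h3 : (cantorNode N i₀ e c (k + 1) : ℝ) + 1 ≤ cantorNode N i₀ e d (k + 1) := by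
      exact_mod_cast hlt
    have h4 : (N : ℝ) * (cantorNode N i₀ e c (k + 1) + 1) ≤ N * cantorNode N i₀ e d (k + 1) :=
      mul_le_mul_of_nonneg_left h3 hN'.le
    rw [← add_assoc, add_assoc (m₀ + k)] at h1 h2
    rw [dist_comm, inv_le_iff_one_le_mul₀ (by positivity), Real.dist_eq]
    have h5 := le_abs_self (cantorPoint N i₀ m₀ e d - cantorPoint N i₀ m₀ e c)
    have h6 := mul_le_mul_of_nonneg_right h5 (pow_nonneg hN'.le (m₀ + k + 2))
    linarith
  rcases lt_or_gt_of_ne hne with hlt | hlt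
  · exact key c d hlt
  · rw [dist_comm]
    exact key d c hlt

end CantorScheme

theorem exists_pow_rpow_add_le_pow {b : ℕ} (hb : 1 < b) {s : ℝ} (hs1 : s < 1) :
    ∃ L : ℕ, 1 ≤ L ∧ ((b : ℝ) ^ L) ^ s + 2 * L + 2 ≤ (b : ℝ) ^ L := by
  have hb' : (1 : ℝ) < b := by exact_mod_cast hb
  have hb0 : (0 : ℝ) < b := by linarith
  have h1 : Tendsto (fun L : ℕ => ((b : ℝ) ^ (s - 1)) ^ L) atTop (𝓝 0) :=
    tendsto_pow_atTop_nhds_zero_of_lt_one (by positivity)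
      (Real.rpow_lt_one_of_one_lt_of_neg hb' (by linarith))
  have h2 := tendsto_pow_const_div_const_pow_of_one_lt 1 hb'
  have h3 := tendsto_pow_const_div_const_pow_of_one_lt 0 hb'
  have h4 := (h1.add (h2.const_mul 2)).add (h3.const_mul 2)
  simp only [mul_zero, add_zero] at h4
  obtain ⟨L, hL, hL1⟩ := ((h4.eventually (gt_mem_nhds one_pos)).and (eventually_ge_atTop 1)).exists
  refine ⟨L, hL1, ?_⟩
  have hp : (0 : ℝ) < (b : ℝ) ^ L := by positivity
  have h5 : ((b : ℝ) ^ (s - 1)) ^ L * (b : ℝ) ^ L = ((b : ℝ) ^ L) ^ s := by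
    rw [Real.rpow_sub_one hb0.ne', div_pow, div_mul_cancel₀ _ hp.ne', ← Real.rpow_natCast,
      ← Real.rpow_mul hb0.le, mul_comm, Real.rpow_mul hb0.le, Real.rpow_natCast]
  have h6 := mul_le_mul_of_nonneg_right hL.le hp.le
  rw [add_mul, add_mul, h5, mul_assoc, mul_assoc, div_mul_cancel₀ _ hp.ne',
    div_mul_cancel₀ _ hp.ne'] at h6
  simpa using h6

theorem card_le_two_of_forall_le_add_one {S : Finset ℕ} (h : ∀ u ∈ S, ∀ v ∈ S, u ≤ v + 1) :
    S.card ≤ 2 := by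
  rcases S.eq_empty_or_nonempty with rfl | hne
  · simp
  · have hsub : S ⊆ {S.min' hne, S.min' hne + 1} := by
      intro u hu
      have h1 := S.min'_le u hu
      have h2 := h u hu _ (S.min'_mem hne)
      simp only [Finset.mem_insert, Finset.mem_singleton]
      omega
    exact (Finset.card_le_card hsub).trans Finset.card_le_two

theorem iterate_eq_fract {b : ℕ} {T : Icc (0 : ℝ) 1 → Icc (0 : ℝ) 1}
    (hT : ∀ x : Icc (0 : ℝ) 1, (T x : ℝ) = Int.fract ((b : ℝ) * x)) (n : ℕ) (x : Icc (0 : ℝ) 1) :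
    (T^[n + 1] x : ℝ) = Int.fract ((b : ℝ) ^ (n + 1) * x) := by
  induction n with
  | zero => simp [hT]
  | succ n ih =>
    rw [Function.iterate_succ_apply', hT, ih, Int.fract_eq_fract]
    refine ⟨-(b * ⌊(b : ℝ) ^ (n + 1) * x⌋), ?_⟩
    push_cast [Int.fract]
    ring

/-- Within the `b ^ L`-adic interval of generation `m` and index `i`, at most two children contain
points whose orbit at a time of the preceding block is close to a slowly varying target `g`. -/
theorem card_close_children_le_two {b L m n i : ℕ} (hb : 1 < b) (hn : m * L ≤ n + L)
    (hnm : n ≤ m * L) {ε δ : ℝ} (hε : 3 * ε * ((b ^ L : ℕ) : ℝ) ^ 2 ≤ 1)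
    (hδ : 1 ≤ δ * ((b ^ L : ℕ) : ℝ) ^ m) {g : Icc (0 : ℝ) 1 → ℝ}
    (hg : ∀ x y : Icc (0 : ℝ) 1, |(x : ℝ) - y| < δ → |g x - g y| < ε) {S : Finset ℕ}
    (hS : ∀ u ∈ S, u < b ^ L ∧ ∃ x : Icc (0 : ℝ) 1,
      ((b ^ L * i + u : ℕ) : ℝ) ≤ x * ((b ^ L : ℕ) : ℝ) ^ (m + 1) ∧
      (x : ℝ) * ((b ^ L : ℕ) : ℝ) ^ (m + 1) < ((b ^ L * i + u : ℕ) : ℝ) + 1 ∧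
      |Int.fract ((b : ℝ) ^ n * x) - g x| < ε) :
    S.card ≤ 2 := by
  have hb0 : (0 : ℝ) < b := by exact_mod_cast (by omega : 0 < b)
  set N : ℕ := b ^ L with hNdef
  have hN0 : (0 : ℝ) < N := by
    rw [hNdef]
    push_cast
    positivity
  have hfloor : ∀ (u : ℕ) (x : Icc (0 : ℝ) 1), u < N →
      ((N * i + u : ℕ) : ℝ) ≤ x * (N : ℝ) ^ (m + 1) →
      (x : ℝ) * (N : ℝ) ^ (m + 1) < ((N * i + u : ℕ) : ℝ) + 1 →
      (i : ℝ) ≤ x * (N : ℝ) ^ m ∧ (x : ℝ) * (N : ℝ) ^ m < i + 1 ∧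
      Int.fract ((b : ℝ) ^ n * x) = (b : ℝ) ^ n * x - ((i / b ^ (m * L - n) : ℕ) : ℝ) := by
    intro u x hu h1 h2
    have hu' : (u : ℝ) + 1 ≤ N := by exact_mod_cast hu
    rw [pow_succ] at h1 h2
    push_cast at h1 h2
    have hu0 : (0 : ℝ) ≤ u := by positivity
    have h3 : (i : ℝ) ≤ x * (N : ℝ) ^ m := by
      refine le_of_mul_le_mul_right ?_ hN0
      linarith
    have h4 : (x : ℝ) * (N : ℝ) ^ m < i + 1 := by
      refine lt_of_mul_lt_mul_right ?_ hN0.le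
      linarith
    refine ⟨h3, h4, ?_⟩
    have h5 : ⌊(x : ℝ) * (N : ℝ) ^ m⌋₊ = i := by
      rw [Nat.floor_eq_iff (by linarith [(Nat.cast_nonneg i : (0 : ℝ) ≤ i)])]
      exact ⟨h3, h4⟩
    have h6 : (b : ℝ) ^ n * x = (x : ℝ) * (N : ℝ) ^ m / ((b ^ (m * L - n) : ℕ) : ℝ) := by
      rw [hNdef]
      push_cast
      rw [eq_div_iff (by positivity), ← pow_mul, mul_comm L m, mul_right_comm, ← pow_add,
        Nat.add_sub_of_le hnm, mul_comm]
    have h7 : ⌊(b : ℝ) ^ n * x⌋₊ = i / b ^ (m * L - n) := by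
      rw [h6, Nat.floor_div_natCast, h5]
    have h8 : (0 : ℝ) ≤ (b : ℝ) ^ n * x := mul_nonneg (by positivity) x.2.1
    rw [← h7, natCast_floor_eq_intCast_floor h8]
    rfl
  refine card_le_two_of_forall_le_add_one fun u hu v hv => ?_
  obtain ⟨hu1, x, hx1, hx2, hx3⟩ := hS u hu
  obtain ⟨hv1, y, hy1, hy2, hy3⟩ := hS v hv
  obtain ⟨hx4, hx5, hx6⟩ := hfloor u x hu1 hx1 hx2
  obtain ⟨hy4, hy5, hy6⟩ := hfloor v y hv1 hy1 hy2
  have hxy : |(x : ℝ) - y| < δ := by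
    have hp : (0 : ℝ) < (N : ℝ) ^ m := by positivity
    refine lt_of_mul_lt_mul_right (lt_of_lt_of_le ?_ hδ) hp.le
    rw [← abs_of_pos hp, ← abs_mul, abs_lt]
    constructor <;> linarith
  have hgxy := abs_lt.mp (hg x y hxy)
  rw [hx6] at hx3
  rw [hy6] at hy3
  have hx3 := abs_lt.mp hx3
  have hy3 := abs_lt.mp hy3
  have h3 : (b : ℝ) ^ n * (x - y) < 3 * ε := by linarith
  have hε0 : 0 < ε := by linarith
  have h4 : ((x : ℝ) - y) * (N : ℝ) ^ (m + 1) < 1 := by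
    have h5 : (N : ℝ) ^ (m + 1) ≤ (b : ℝ) ^ n * (N : ℝ) ^ 2 := by
      rw [hNdef]
      push_cast
      rw [← pow_mul, ← pow_mul, ← pow_add]
      refine pow_le_pow_right₀ (by exact_mod_cast hb.le) ?_
      linarith
    rcases le_or_gt ((x : ℝ) - y) 0 with h | h
    · exact (mul_nonpos_of_nonpos_of_nonneg h (by positivity)).trans_lt one_pos
    · calc ((x : ℝ) - y) * (N : ℝ) ^ (m + 1)
          ≤ ((x : ℝ) - y) * ((b : ℝ) ^ n * (N : ℝ) ^ 2) := by gcongr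
        _ = (b : ℝ) ^ n * (x - y) * (N : ℝ) ^ 2 := by ring
        _ < 3 * ε * (N : ℝ) ^ 2 := by gcongr
        _ ≤ 1 := hε
  have h6 : (u : ℝ) < v + 2 := by
    push_cast at hx1 hy2
    linarith
  have h7 : u < v + 2 := by exact_mod_cast h6
  omega

theorem exists_adic_interval_mem {N m : ℕ} (hN : 0 < N) (x : Icc (0 : ℝ) 1) :
    ∃ i : ℕ, i + 1 ≤ N ^ m ∧ (x : ℝ) * (N : ℝ) ^ m ∈ Icc (i : ℝ) (i + 1) := by
  have hp : (0 : ℝ) < (N : ℝ) ^ m := by positivity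
  have hx0 := mul_nonneg x.2.1 hp.le
  have hx1 : (x : ℝ) * (N : ℝ) ^ m ≤ (N : ℝ) ^ m := mul_le_of_le_one_left hp.le x.2.2
  rcases hx0.eq_or_lt with h | h
  · exact ⟨0, Nat.one_le_pow _ _ hN, by rw [← h]; simp⟩
  · have hc : 0 < ⌈(x : ℝ) * (N : ℝ) ^ m⌉₊ := Nat.ceil_pos.mpr h
    obtain ⟨i, hi⟩ := Nat.exists_eq_add_one.mpr hc
    refine ⟨i, ?_, ?_, ?_⟩
    · rw [← hi, Nat.ceil_le]
      exact_mod_cast hx1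
    · exact (Nat.lt_ceil.mp (by omega)).le
    · have := Nat.le_ceil ((x : ℝ) * (N : ℝ) ^ m)
      rw [hi] at this
      exact_mod_cast this

/-- In every generation and every interval one may retain all but `2 * L + 2` of the `b ^ L`
children so that orbits of points in the retained children stay away from the targets. -/
theorem exists_children_avoiding {b L m₁ : ℕ} (hb : 1 < b) {ε δ : ℝ}
    (hε : 3 * ε * ((b ^ L : ℕ) : ℝ) ^ 2 ≤ 1) (hδ0 : 0 < δ)
    (hδ : 1 ≤ δ * ((b ^ L : ℕ) : ℝ) ^ (m₁ + 1)) {f : ℕ → Icc (0 : ℝ) 1 → ℝ}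
    (hf : ∀ n, ∀ x y : Icc (0 : ℝ) 1, |(x : ℝ) - y| < δ → |f n x - f n y| < ε) (k i : ℕ) :
    ∃ e : Fin (b ^ L - 2 * L - 2) → ℕ, Function.Injective e ∧ ∀ a, 1 ≤ e a ∧ e a + 2 ≤ b ^ L ∧
      ∀ j < L, ∀ x : Icc (0 : ℝ) 1,
        ((b ^ L * i + e a : ℕ) : ℝ) ≤ x * ((b ^ L : ℕ) : ℝ) ^ (m₁ + 1 + k + 1) →
        (x : ℝ) * ((b ^ L : ℕ) : ℝ) ^ (m₁ + 1 + k + 1) < ((b ^ L * i + e a : ℕ) : ℝ) + 1 →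
        ε ≤ |Int.fract ((b : ℝ) ^ ((m₁ + k) * L + j) * x) - f ((m₁ + k) * L + j) x| := by
  classical
  have hN1 : 1 ≤ b ^ L := Nat.one_le_pow _ _ (by omega)
  let S : ℕ → Finset ℕ := fun j => (Finset.range (b ^ L)).filter fun u => ∃ x : Icc (0 : ℝ) 1,
      ((b ^ L * i + u : ℕ) : ℝ) ≤ x * ((b ^ L : ℕ) : ℝ) ^ (m₁ + 1 + k + 1) ∧
      (x : ℝ) * ((b ^ L : ℕ) : ℝ) ^ (m₁ + 1 + k + 1) < ((b ^ L * i + u : ℕ) : ℝ) + 1 ∧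
      |Int.fract ((b : ℝ) ^ ((m₁ + k) * L + j) * x) - f ((m₁ + k) * L + j) x| < ε
  have hS : ∀ j ∈ Finset.range L, (S j).card ≤ 2 := by
    intro j hj
    rw [Finset.mem_range] at hj
    refine card_close_children_le_two (m := m₁ + 1 + k) (n := (m₁ + k) * L + j) (i := i) hb ?_ ?_
      hε (hδ.trans ?_) (hf ((m₁ + k) * L + j)) fun u hu => ?_
    · nlinarith
    · nlinarith
    · exact mul_le_mul_of_nonneg_left
        (pow_le_pow_right₀ (by exact_mod_cast hN1) (by omega)) hδ0.le
    · simpa only [S, Finset.mem_filter, Finset.mem_range] using hu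
  let G : Finset ℕ := Finset.Ico 1 (b ^ L - 1) \ (Finset.range L).biUnion S
  have hG : b ^ L - 2 * L - 2 ≤ G.card := by
    have h1 := Finset.card_biUnion_le_card_mul (Finset.range L) S 2 hS
    have h2 := Finset.le_card_sdiff ((Finset.range L).biUnion S) (Finset.Ico 1 (b ^ L - 1))
    rw [Nat.card_Ico] at h2
    rw [Finset.card_range] at h1
    change _ ≤ (Finset.Ico 1 (b ^ L - 1) \ (Finset.range L).biUnion S).card
    omega
  refine ⟨G.orderEmbOfCardLe hG, (G.orderEmbOfCardLe hG).injective, fun a => ?_⟩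
  have ha := G.orderEmbOfCardLe_mem hG a
  generalize G.orderEmbOfCardLe hG a = u at ha
  simp only [G, Finset.mem_sdiff, Finset.mem_Ico, Finset.mem_biUnion, Finset.mem_range,
    not_exists, not_and] at ha
  refine ⟨ha.1.1, by omega, fun j hj x h1 h2 => not_lt.mp fun h3 => ha.2 j hj ?_⟩
  simp only [S, Finset.mem_filter, Finset.mem_range]
  exact ⟨by omega, x, h1, h2, h3⟩


/-- For the `γ`-adic map `T x = γ x mod 1` on `[0,1]` with integer
`γ > 1` and any equicontinuous sequence `(f n)` of self-maps of `[0,1]`, for every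
nonempty open subset `U` of `[0,1]` the set of points `x ∈ U` with
`liminf_n |T^n x - f n x| > 0` has Hausdorff dimension `1`; in particular the set
`BA((f n))` has local Hausdorff dimension `1` everywhere. -/
theorem betaMap_twisted_badly_approximable_full_local_dimH
    (γ : ℤ) (hγ : 1 < γ)
    (T : Set.Icc (0:ℝ) 1 → Set.Icc (0:ℝ) 1)
    (hT : ∀ x : Set.Icc (0:ℝ) 1, ((T x : ℝ)) = Int.fract ((γ : ℝ) * (x : ℝ)))
    (f : ℕ → Set.Icc (0:ℝ) 1 → Set.Icc (0:ℝ) 1)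
    (hf : ∀ ε : ℝ, 0 < ε → ∃ δ : ℝ, 0 < δ ∧ ∀ (n : ℕ) (x y : Set.Icc (0:ℝ) 1),
      |(x : ℝ) - (y : ℝ)| < δ → |((f n x : ℝ)) - ((f n y : ℝ))| < ε)
    (U : Set (Set.Icc (0:ℝ) 1)) (hU : IsOpen U) (hUne : U.Nonempty) :
    dimH {x : Set.Icc (0:ℝ) 1 | x ∈ U ∧
      0 < Filter.liminf (fun n => |((T^[n] x : ℝ)) - ((f n x : ℝ))|) Filter.atTop} = 1 := by
  lift γ to ℕ using by omega with b
  have hb : 1 < b := by exact_mod_cast hγ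
  simp only [Int.cast_natCast] at hT
  refine le_antisymm ?_ (ENNReal.le_of_forall_nnreal_lt fun s hs1 => ?_)
  · rw [← (isometry_subtype_coe (s := Icc (0 : ℝ) 1)).dimH_image, ← Real.dimH_univ]
    exact dimH_mono (subset_univ _)
  rcases eq_zero_or_pos s with rfl | hs0
  · simp
  have hs1 : (s : ℝ) < 1 := by exact_mod_cast hs1
  obtain ⟨L, hL1, hL⟩ := exists_pow_rpow_add_le_pow hb hs1
  set N : ℕ := b ^ L with hNdef
  have hN1 : 1 < N := Nat.one_lt_pow (by omega) hb
  have hN1' : (1 : ℝ) < N := by exact_mod_cast hN1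
  have hN0 : (0 : ℝ) < N := by linarith
  have hcast : (b : ℝ) ^ L = N := by rw [hNdef]; push_cast; rfl
  rw [hcast] at hL
  have hNs : 1 < (N : ℝ) ^ (s : ℝ) := Real.one_lt_rpow hN1' (by exact_mod_cast hs0)
  have hMle : 2 * L + 2 ≤ N := by
    have h : ((2 * L + 2 : ℕ) : ℝ) ≤ N := by push_cast; linarith
    exact_mod_cast h
  have hM : (N : ℝ) ^ (s : ℝ) ≤ ((N - 2 * L - 2 : ℕ) : ℝ) := by
    rw [Nat.sub_sub, Nat.cast_sub hMle]
    push_cast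
    linarith
  have hM1 : 1 < N - 2 * L - 2 := by exact_mod_cast hNs.trans_le hM
  obtain ⟨ε, hε0, hε⟩ : ∃ ε : ℝ, 0 < ε ∧ 3 * ε * (N : ℝ) ^ 2 ≤ 1 :=
    ⟨(3 * (N : ℝ) ^ 2)⁻¹, by positivity, by field_simp; exact le_rfl⟩
  obtain ⟨δ, hδ0, hδ⟩ := hf ε hε0
  obtain ⟨x₀, hx₀⟩ := hUne
  obtain ⟨r, hr0, hr⟩ := Metric.isOpen_iff.mp hU x₀ hx₀
  obtain ⟨m₁, hm₁, hm1⟩ := (((tendsto_pow_atTop_atTop_of_one_lt hN1').eventually_gt_atTop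
    (max δ⁻¹ r⁻¹)).and (eventually_ge_atTop 1)).exists
  have hmN : (N : ℝ) ^ m₁ ≤ (N : ℝ) ^ (m₁ + 1) := pow_le_pow_right₀ hN1'.le (by omega)
  have hδN : 1 ≤ δ * (N : ℝ) ^ (m₁ + 1) := by
    have h := ((le_max_left _ _).trans_lt hm₁).le.trans hmN
    rwa [inv_le_iff_one_le_mul₀' hδ0] at h
  have hrN : 1 < r * (N : ℝ) ^ (m₁ + 1) := by
    have h := ((le_max_right _ _).trans_lt hm₁).trans_le hmN
    rwa [inv_lt_iff_one_lt_mul₀' hr0] at h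
  obtain ⟨i₀, hi₀, hxi₀⟩ := exists_adic_interval_mem (m := m₁ + 1) (by omega : 0 < N) x₀
  choose e hinj he using exists_children_avoiding (m₁ := m₁) hb hε hδ0 hδN
    (f := fun n x => (f n x : ℝ)) hδ
  have he' : ∀ k i a, 1 ≤ e k i a ∧ e k i a + 2 ≤ N := fun k i a =>
    ⟨(he k i a).1, (he k i a).2.1⟩
  have hpt := cantorPoint_mem_Ioo i₀ (m₁ + 1) he'
  have hi₀' : (i₀ : ℝ) + 1 ≤ (N : ℝ) ^ (m₁ + 1) := by exact_mod_cast hi₀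
  have hpow : (0 : ℝ) < (N : ℝ) ^ (m₁ + 1) := by positivity
  have hmem : ∀ c, cantorPoint N i₀ (m₁ + 1) e c ∈ Icc (0 : ℝ) 1 := by
    intro c
    obtain ⟨h1, h2⟩ := hpt c 0
    simp only [cantorNode, add_zero] at h1 h2
    have h3 : (0 : ℝ) ≤ i₀ := Nat.cast_nonneg _
    exact ⟨le_of_mul_le_mul_right (by linarith) hpow, le_of_mul_le_mul_right (by linarith) hpow⟩
  let P : (ℕ → Fin (N - 2 * L - 2)) → Icc (0 : ℝ) 1 := fun c => ⟨_, hmem c⟩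
  have hdim := le_dimH_range_of_digits_separated hM1 P (((N : NNReal) ^ (m₁ + 1 + 2)) ^ (s : ℝ))
    s hs0 fun c d k hcd hk => by
      have h := inv_pow_le_dist_cantorPoint i₀ (m₁ + 1) he' hinj hcd hk
      have hdist : dist (P c) (P d) = dist (cantorPoint N i₀ (m₁ + 1) e c)
        (cantorPoint N i₀ (m₁ + 1) e d) := rfl
      rw [← hdist] at h
      push_cast
      rw [← Real.mul_rpow (by positivity) dist_nonneg]
      calc (((N - 2 * L - 2 : ℕ) : ℝ) ^ k)⁻¹ ≤ (((N : ℝ) ^ (s : ℝ)) ^ k)⁻¹ := by gcongr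
        _ = (((N : ℝ) ^ k)⁻¹) ^ (s : ℝ) := by
          rw [Real.inv_rpow (by positivity), ← Real.rpow_natCast, ← Real.rpow_natCast,
            ← Real.rpow_mul hN0.le, ← Real.rpow_mul hN0.le, mul_comm]
        _ = ((N : ℝ) ^ (m₁ + 1 + 2) * ((N : ℝ) ^ (m₁ + 1 + k + 2))⁻¹) ^ (s : ℝ) := by
          congr 1
          rw [add_right_comm (m₁ + 1) k 2, pow_add _ _ k]
          field_simp
        _ ≤ ((N : ℝ) ^ (m₁ + 1 + 2) * dist (P c) (P d)) ^ (s : ℝ) := by gcongr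
  refine hdim.trans (dimH_mono ?_)
  rintro _ ⟨c, rfl⟩
  refine ⟨hr ?_, hε0.trans_le (le_liminf_of_le ?_ ?_)⟩
  · obtain ⟨h1, h2⟩ := hpt c 0
    simp only [cantorNode, add_zero] at h1 h2
    rw [Metric.mem_ball, Subtype.dist_eq, Real.dist_eq]
    refine lt_of_mul_lt_mul_right (lt_of_le_of_lt ?_ hrN) hpow.le
    rw [← abs_of_pos hpow, ← abs_mul, abs_le]
    constructor <;> linarith [hxi₀.1, hxi₀.2]
  · refine IsBoundedUnder.isCoboundedUnder_ge (isBoundedUnder_of ⟨1, fun n => ?_⟩)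
    have h1 := (T^[n] (P c)).2
    have h2 := (f n (P c)).2
    exact abs_le.mpr ⟨by linarith [h1.1, h2.2], by linarith [h1.2, h2.1]⟩
  · filter_upwards [eventually_ge_atTop (m₁ * L)] with n hn
    obtain ⟨k, hk⟩ : ∃ k, n / L = m₁ + k :=
      Nat.exists_eq_add_of_le ((Nat.le_div_iff_mul_le hL1).mpr hn)
    have hn' : (m₁ + k) * L + n % L = n := by rw [← hk, mul_comm]; exact Nat.div_add_mod n L
    have h := (he k (cantorNode N i₀ e c k) (c k)).2.2 (n % L) (Nat.mod_lt _ hL1) (P c)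
      (hpt c (k + 1)).1.le (hpt c (k + 1)).2
    rw [hn'] at h
    obtain ⟨n', rfl⟩ : ∃ n', n = n' + 1 :=
      Nat.exists_eq_add_one.mpr ((Nat.mul_pos hm1 hL1).trans_le hn)
    rwa [iterate_eq_fract hT]
end

section
/- Let T : [0,1] → [0,1] be the Gauss map, T(0) = 0 and T(x) = 1/x mod 1 for x ≠ 0, and let (f_n : [0,1] → [0,1])_{n≥1} be an equicontinuous sequence of functions. Then for every nonempty open subset U of [0,1], the Hausdorff dimension of {x ∈ U : liminf_{n→∞} |T^n x − f_n(x)| > 0} equals 1; in particular the set BA((f_n)_n) = {x ∈ [0,1] : liminf_{n→∞} |T^n x − f_n(x)| > 0} has local Hausdorff dimension 1. -/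
namespace GaussTwisted

open MeasureTheory Filter Topology Set
open scoped ENNReal NNReal

/-- **Mass distribution principle** for a coded set: if each level of the coding has weights whose
`s`-th powers sum to at least one, and codes that first differ at level `m` are separated by at
least the product of the first `m` weights, then the coded set has dimension at least `s`. -/
theorem le_dimH_range_of_sep {ι : ℕ → Type*} [∀ i, Fintype (ι i)] [∀ i, MeasurableSpace (ι i)]
    [∀ i, MeasurableSingletonClass (ι i)] {Y : Type*} [MetricSpace Y] [MeasurableSpace Y]
    [BorelSpace Y] {π : (∀ i, ι i) → Y} (hπ : Measurable π) {s : ℝ≥0} (hs : 0 < s)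
    {r : ∀ i, ι i → ℝ} (hr0 : ∀ i w, 0 < r i w) (hr1 : ∀ i w, r i w ≤ 1 / 2)
    (hsum : ∀ i, 1 ≤ ∑ w, r i w ^ (s : ℝ)) {c : ℝ} (hc : 0 < c)
    (hsep : ∀ ω ω' m, (∀ i < m, ω i = ω' i) → ω m ≠ ω' m →
      c * ∏ i ∈ Finset.range m, r i (ω i) ≤ dist (π ω) (π ω')) :
    (s : ℝ≥0∞) ≤ dimH (range π) := by
  classical
  set Z : ℕ → ℝ := fun i => ∑ w, r i w ^ (s : ℝ)
  have hZ0 : ∀ i, 0 < Z i := fun i => one_pos.trans_le (hsum i)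
  set p : ∀ i, ι i → ℝ := fun i w => r i w ^ (s : ℝ) / Z i
  have hp0 : ∀ i w, 0 ≤ p i w := fun i w => by
    have := hr0 i w
    have := hZ0 i
    positivity
  have hple : ∀ i w, p i w ≤ r i w ^ (s : ℝ) := fun i w =>
    div_le_self (Real.rpow_nonneg (hr0 i w).le _) (hsum i)
  let ν : ∀ i, Measure (ι i) := fun i => ∑ w, ENNReal.ofReal (p i w) • Measure.dirac w
  have hν1 : ∀ i, IsProbabilityMeasure (ν i) := fun i => ⟨by
    simp only [ν, Measure.coe_finsetSum, Finset.sum_apply, Measure.smul_apply, measure_univ,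
      smul_eq_mul, mul_one]
    rw [← ENNReal.ofReal_sum_of_nonneg (fun w _ => hp0 i w), ← Finset.sum_div,
      div_self (hZ0 i).ne', ENNReal.ofReal_one]⟩
  have hνs : ∀ i w, ν i {w} ≤ ENNReal.ofReal (r i w ^ (s : ℝ)) := fun i w => by
    have : ν i {w} = ENNReal.ofReal (p i w) := by
      simp only [ν, Measure.coe_finsetSum, Finset.sum_apply, Measure.smul_apply, smul_eq_mul]
      rw [Finset.sum_eq_single w] <;> simp +contextual [Set.indicator]
    rw [this]
    exact ENNReal.ofReal_le_ofReal (hple i w)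
  let P := Measure.infinitePi ν
  have hcyl : ∀ (ω : ∀ i, ι i) m (A : Set (∀ i, ι i)), (∀ ω' ∈ A, ∀ i < m, ω i = ω' i) →
      P A ≤ ENNReal.ofReal ((∏ i ∈ Finset.range m, r i (ω i)) ^ (s : ℝ)) := by
    intro ω m A hA
    calc P A ≤ P (Set.pi (Finset.range m) fun i => {ω i}) := by
          refine measure_mono fun ω' h' i hi => ?_
          exact (hA ω' h' i (by simpa using hi)).symm
      _ = ∏ i ∈ Finset.range m, ν i {ω i} :=
          Measure.infinitePi_pi _ (fun i _ => measurableSet_singleton _)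
      _ ≤ ∏ i ∈ Finset.range m, ENNReal.ofReal (r i (ω i) ^ (s : ℝ)) :=
          Finset.prod_le_prod' fun i _ => hνs i _
      _ = _ := by
          rw [← ENNReal.ofReal_prod_of_nonneg fun i _ => Real.rpow_nonneg (hr0 i _).le _,
            Real.finsetProd_rpow _ _ fun i _ => (hr0 i _).le]
  let μ := P.map π
  have key : ENNReal.ofReal (c ^ (s : ℝ)) • μ ≤ μH[(s : ℝ)] := by
    refine Measure.le_hausdorffMeasure _ _ 1 one_pos fun S _ => ?_
    have hAm : MeasurableSet (closure S) := isClosed_closure.measurableSet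
    rw [← Metric.ediam_closure S]
    refine (measure_mono subset_closure).trans ?_
    rw [Measure.smul_apply, Measure.map_apply hπ hAm, smul_eq_mul]
    by_cases h : ∃ m, ∃ ω ∈ π ⁻¹' closure S, ∃ ω' ∈ π ⁻¹' closure S, ω m ≠ ω' m
    · obtain ⟨ω, hω, ω', hω', hne⟩ := Nat.find_spec h
      have hmin := fun i (hi : i < Nat.find h) => Nat.find_min h hi
      set m := Nat.find h
      push Not at hmin
      have hprod : 0 ≤ ∏ i ∈ Finset.range m, r i (ω i) :=
        Finset.prod_nonneg fun i _ => (hr0 i _).le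
      calc _ ≤ ENNReal.ofReal (c ^ (s : ℝ)) *
            ENNReal.ofReal ((∏ i ∈ Finset.range m, r i (ω i)) ^ (s : ℝ)) := by
            gcongr
            exact hcyl ω m _ fun ω'' h'' i hi => hmin i hi ω hω ω'' h''
        _ = ENNReal.ofReal (c * ∏ i ∈ Finset.range m, r i (ω i)) ^ (s : ℝ) := by
            rw [← ENNReal.ofReal_mul (by positivity), ← Real.mul_rpow hc.le hprod,
              ENNReal.ofReal_rpow_of_nonneg (by positivity) s.coe_nonneg]
        _ ≤ ENNReal.ofReal (dist (π ω) (π ω')) ^ (s : ℝ) := by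
            gcongr
            exact hsep ω ω' m (fun i hi => hmin i hi ω hω ω' hω') hne
        _ ≤ _ := by
            gcongr
            rw [← edist_dist]
            exact Metric.edist_le_ediam_of_mem hω hω'
    · push Not at h
      suffices hz : P (π ⁻¹' closure S) = 0 by
        change _ * P _ ≤ _
        rw [hz, mul_zero]; exact zero_le
      rcases (π ⁻¹' closure S).eq_empty_or_nonempty with he | ⟨ω, hω⟩
      · rw [he, measure_empty]
      · have hle : ∀ m : ℕ, P (π ⁻¹' closure S) ≤ ENNReal.ofReal (((1 / 2 : ℝ) ^ (s : ℝ)) ^ m) := by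
          intro m
          refine (hcyl ω m _ fun ω' h' i _ => h i ω hω ω' h').trans ?_
          refine ENNReal.ofReal_le_ofReal ?_
          rw [← Real.rpow_natCast, ← Real.rpow_mul (by norm_num), mul_comm,
            Real.rpow_mul (by norm_num), Real.rpow_natCast]
          refine Real.rpow_le_rpow (Finset.prod_nonneg fun i _ => (hr0 i _).le) ?_ s.2
          calc _ ≤ ∏ i ∈ Finset.range m, (1 / 2 : ℝ) :=
                Finset.prod_le_prod (fun i _ => (hr0 i _).le) fun i _ => hr1 i _
            _ = _ := by simp
        have hlt : (1 / 2 : ℝ) ^ (s : ℝ) < 1 :=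
          Real.rpow_lt_one (by norm_num) (by norm_num) (by exact_mod_cast hs)
        have hlim := ENNReal.tendsto_ofReal
          (tendsto_pow_atTop_nhds_zero_of_lt_one (by positivity) hlt)
        rw [ENNReal.ofReal_zero] at hlim
        exact le_antisymm (ge_of_tendsto' hlim hle) zero_le
  refine le_dimH_of_hausdorffMeasure_ne_zero (ne_of_gt (lt_of_lt_of_le ?_ (key (range π))))
  rw [Measure.smul_apply, smul_eq_mul]
  refine ENNReal.mul_pos (by simpa using Real.rpow_pos_of_pos hc _) (ne_of_gt ?_)
  refine lt_of_lt_of_le ?_ (Measure.le_map_apply hπ.aemeasurable _)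
  simp [P]

/-- The finite continued fraction `[0; a₁, …, aₘ + x]`, as a function of the tail `x`. -/
noncomputable def contFracTail : List ℕ → ℝ → ℝ
  | [], x => x
  | a :: w, x => 1 / (a + contFracTail w x)

theorem contFracTail_append (u w : List ℕ) (x : ℝ) :
    contFracTail (u ++ w) x = contFracTail u (contFracTail w x) := by
  induction u with
  | nil => rfl
  | cons a u ih => simp [contFracTail, ih]

theorem contFracTail_eq_mobius {w : List ℕ} (hw : ∀ a ∈ w, 1 ≤ a) :
    ∃ p p' q q' : ℝ, 0 ≤ p ∧ 0 ≤ p' ∧ 0 ≤ q' ∧ 1 ≤ q ∧ (w.length : ℝ) ≤ q ∧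
      (w.length : ℝ) + 1 ≤ p + q ∧ q' ≤ q ∧ p' + q' ≤ p + q ∧ |p * q' - p' * q| = 1 ∧
      ∀ x, 0 ≤ x → contFracTail w x = (p + p' * x) / (q + q' * x) := by
  induction w with
  | nil => exact ⟨0, 1, 1, 0, by simp [contFracTail]⟩
  | cons a w ih =>
    obtain ⟨p, p', q, q', hp, hp', hq', hq, hlq, hlpq, hqq, hpq, hdet, hx⟩ :=
      ih fun b hb => hw b (List.mem_cons_of_mem _ hb)
    have ha : (1 : ℝ) ≤ a := by exact_mod_cast hw a (by simp)
    have h1 : q ≤ a * q := by nlinarith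
    have h2 : (a - 1) * q' ≤ (a - 1) * q := mul_le_mul_of_nonneg_left hqq (by linarith)
    have h3 : 0 ≤ a * q' := by positivity
    refine ⟨q, q', a * q + p, a * q' + p', by linarith, hq', by linarith, by linarith, ?_, ?_,
      by linarith, by linarith, ?_, ?_⟩
    · push_cast [List.length_cons]; linarith
    · push_cast [List.length_cons]; linarith
    · rw [← hdet, ← abs_neg]; congr 1; ring
    · intro x hx0
      have h4 : 0 < q + q' * x := by positivity
      rw [contFracTail, hx x hx0]
      have h5 : 0 < a * q + p + (a * q' + p') * x := by positivity
      have h6 : (a : ℝ) + (p + p' * x) / (q + q' * x) =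
          (a * q + p + (a * q' + p') * x) / (q + q' * x) := by
        field_simp; ring
      rw [h6, one_div_div]

/-- The length of the cylinder of all `[0; a₁, …, aₘ + x]` with `x ∈ [0, 1]`. -/
noncomputable def cylLength (w : List ℕ) : ℝ := |contFracTail w 1 - contFracTail w 0|

theorem contFracTail_distortion {w : List ℕ} (hw : ∀ a ∈ w, 1 ≤ a) :
    0 < cylLength w ∧ cylLength w * (w.length : ℝ) ^ 2 ≤ 1 ∧ ∀ x ∈ Icc (0 : ℝ) 1,
      ∀ y ∈ Icc (0 : ℝ) 1,
        cylLength w / 2 * |x - y| ≤ |contFracTail w x - contFracTail w y| ∧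
        |contFracTail w x - contFracTail w y| ≤ 2 * cylLength w * |x - y| := by
  obtain ⟨p, p', q, q', hp, hp', hq', hq, hlq, -, hqq, -, hdet, hx⟩ := contFracTail_eq_mobius hw
  have hdiff : ∀ x y : ℝ, 0 ≤ x → 0 ≤ y → |contFracTail w x - contFracTail w y| =
      |x - y| / ((q + q' * x) * (q + q' * y)) := by
    intro x y h0 h1
    have h2 : 0 < q + q' * x := by positivity
    have h3 : 0 < q + q' * y := by positivity
    rw [hx x h0, hx y h1, div_sub_div _ _ h2.ne' h3.ne', abs_div, abs_of_pos (mul_pos h2 h3)]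
    congr 1
    rw [show (p + p' * x) * (q + q' * y) - (q + q' * x) * (p + p' * y) =
      (p * q' - p' * q) * (y - x) by ring, abs_mul, hdet, one_mul, abs_sub_comm]
  have hlen : cylLength w = 1 / ((q + q') * q) := by
    rw [cylLength, hdiff 1 0 (by norm_num) le_rfl]; simp
  refine ⟨by rw [hlen]; positivity, ?_, ?_⟩
  · rw [hlen, one_div, inv_mul_le_one₀ (by positivity)]
    have : (0 : ℝ) ≤ w.length := by positivity
    nlinarith
  · rintro x ⟨hx0, hx1⟩ y ⟨hy0, hy1⟩
    rw [hdiff x y hx0 hy0, hlen]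
    have hX : q' * x ≤ q' := mul_le_of_le_one_right hq' hx1
    have hY : q' * y ≤ q' := mul_le_of_le_one_right hq' hy1
    have hX0 : 0 ≤ q' * x := by positivity
    have hY0 : 0 ≤ q' * y := by positivity
    have hxy := abs_nonneg (x - y)
    constructor
    · rw [div_div, div_mul_eq_mul_div, one_mul]
      refine div_le_div_of_nonneg_left hxy (by positivity) ?_
      calc (q + q' * x) * (q + q' * y) ≤ (q + q') * (q + q') := by gcongr
        _ ≤ (q + q') * (2 * q) := by gcongr; linarith
        _ = _ := by ring
    · rw [mul_one_div, div_mul_eq_mul_div, div_le_div_iff₀ (by positivity) (by positivity)]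
      have : (q + q') * q ≤ 2 * ((q + q' * x) * (q + q' * y)) := by
        calc (q + q') * q ≤ (2 * q) * q := by gcongr; linarith
          _ = 2 * (q * q) := by ring
          _ ≤ _ := by gcongr <;> linarith
      nlinarith [mul_le_mul_of_nonneg_left this hxy]

theorem contFracTail_mem_Icc {w : List ℕ} (hw : ∀ a ∈ w, 1 ≤ a) {x : ℝ} (hx : x ∈ Icc (0 : ℝ) 1) :
    contFracTail w x ∈ Icc (0 : ℝ) 1 := by
  induction w with
  | nil => exact hx
  | cons a w ih =>
    obtain ⟨h0, -⟩ := ih fun b hb => hw b (List.mem_cons_of_mem _ hb)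
    have ha : (1 : ℝ) ≤ a := by exact_mod_cast hw a (by simp)
    rw [contFracTail]
    exact ⟨by positivity, by rw [div_le_one (by positivity)]; linarith⟩

/-- The list of partial quotients coded by `v`: the letter `k` stands for the quotient `k + 1`. -/
def wordOf {n N : ℕ} (v : Fin n → Fin N) : List ℕ := List.ofFn fun i => (v i : ℕ) + 1

theorem one_le_of_mem_wordOf {n N : ℕ} (v : Fin n → Fin N) : ∀ a ∈ wordOf v, 1 ≤ a := by
  simp [wordOf, List.mem_ofFn]

theorem length_wordOf {n N : ℕ} (v : Fin n → Fin N) : (wordOf v).length = n := by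
  simp [wordOf]

theorem sum_cylLength_snoc_ge {w : List ℕ} (hw : ∀ a ∈ w, 1 ≤ a) (N : ℕ) :
    (1 - 2 / ((N : ℝ) + 1)) * cylLength w ≤ ∑ k : Fin N, cylLength (w ++ [(k : ℕ) + 1]) := by
  obtain ⟨-, -, h⟩ := contFracTail_distortion hw
  have hmem : 1 / ((N : ℝ) + 1) ∈ Icc (0 : ℝ) 1 :=
    ⟨by positivity, by rw [div_le_one (by positivity)]; linarith [(N.cast_nonneg : (0 : ℝ) ≤ N)]⟩
  have h1 := (h (1 / ((N : ℝ) + 1)) hmem 0 ⟨le_rfl, zero_le_one⟩).2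
  rw [sub_zero, abs_of_nonneg hmem.1] at h1
  have h2 := dist_le_range_sum_dist (fun k : ℕ => contFracTail w (1 / ((k : ℝ) + 1))) N
  have h3 : ∑ k : Fin N, cylLength (w ++ [(k : ℕ) + 1]) = ∑ k ∈ Finset.range N,
      dist (contFracTail w (1 / ((k : ℝ) + 1))) (contFracTail w (1 / (((k + 1 : ℕ) : ℝ) + 1))) := by
    rw [Finset.sum_range]
    refine Finset.sum_congr rfl fun k _ => ?_
    rw [cylLength, contFracTail_append, contFracTail_append, Real.dist_eq, abs_sub_comm]
    simp [contFracTail]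
  rw [h3]
  refine le_trans ?_ h2
  have h4 : cylLength w ≤ |contFracTail w 1 - contFracTail w (1 / ((N : ℝ) + 1))| +
      |contFracTail w (1 / ((N : ℝ) + 1)) - contFracTail w 0| := abs_sub_le _ _ _
  simp only [Nat.cast_zero, zero_add, div_one, Real.dist_eq]
  have : (1 - 2 / ((N : ℝ) + 1)) * cylLength w =
    cylLength w - 2 * cylLength w * (1 / ((N : ℝ) + 1)) := by ring
  linarith

theorem sum_cylLength_ge (N n : ℕ) (hN : 1 ≤ N) :
    (1 - 2 / ((N : ℝ) + 1)) ^ n ≤ ∑ v : Fin n → Fin N, cylLength (wordOf v) := by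
  induction n with
  | zero => simp [wordOf, cylLength, contFracTail]
  | succ n ih =>
    have h0 : 0 ≤ 1 - 2 / ((N : ℝ) + 1) := by
      have : (1 : ℝ) ≤ N := by exact_mod_cast hN
      rw [sub_nonneg, div_le_one (by positivity)]; linarith
    rw [← (Fin.snocEquiv fun _ : Fin (n + 1) => Fin N).sum_comp, Fintype.sum_prod_type_right,
      pow_succ']
    calc _ ≤ (1 - 2 / ((N : ℝ) + 1)) * ∑ v : Fin n → Fin N, cylLength (wordOf v) := by gcongr
      _ ≤ _ := by
        rw [Finset.mul_sum]
        refine Finset.sum_le_sum fun v _ => ?_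
        refine (sum_cylLength_snoc_ge (one_le_of_mem_wordOf v) N).trans_eq ?_
        refine Finset.sum_congr rfl fun k _ => ?_
        rw [wordOf, wordOf, List.ofFn_succ']
        simp [Fin.snocEquiv, List.concat_eq_append]

theorem exists_sum_cylLength_ge (n : ℕ) :
    ∃ N : ℕ, 3 / 4 ≤ ∑ v : Fin n → Fin (N + 1), cylLength (wordOf v) := by
  have h : Tendsto (fun N : ℕ => (1 - 2 * (1 / ((N : ℝ) + 1))) ^ n) atTop (𝓝 ((1 - 2 * 0) ^ n)) :=
    ((tendsto_one_div_add_atTop_nhds_zero_nat.const_mul 2).const_sub 1).pow n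
  obtain ⟨N, hN⟩ := ((tendsto_add_atTop_iff_nat 1).2 h).eventually
    (lt_mem_nhds (show (3 / 4 : ℝ) < (1 - 2 * 0) ^ n by norm_num)) |>.exists
  refine ⟨N, le_trans ?_ (sum_cylLength_ge (N + 1) n (by lia))⟩
  simpa [div_eq_mul_inv] using hN.le

/-- After discarding at most `n` words, the cylinders of a suitable length `n` still carry full
`s`-dimensional mass, with room for the distortion factor `2`. -/
theorem exists_cylLength_rpow_sum_ge {s : ℝ} (hs1 : s < 1) :
    ∃ n N : ℕ, 0 < n ∧ ∀ F : Finset (Fin n → Fin (N + 1)), F.card ≤ n →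
      1 ≤ ∑ v ∈ Fᶜ, (cylLength (wordOf v) / 2) ^ s := by
  have h : Tendsto (fun n : ℕ => (n : ℝ) ^ (2 * (1 - s))) atTop atTop :=
    (tendsto_rpow_atTop (by linarith)).comp tendsto_natCast_atTop_atTop
  obtain ⟨n, hn, hn4⟩ := ((h.eventually_ge_atTop 4).and (eventually_ge_atTop 4)).exists
  obtain ⟨N, hN⟩ := exists_sum_cylLength_ge n
  refine ⟨n, N, by lia, fun F hF => ?_⟩
  have hn0 : (4 : ℝ) ≤ n := by exact_mod_cast hn4
  have hlen : ∀ v : Fin n → Fin (N + 1), 0 < cylLength (wordOf v) ∧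
      cylLength (wordOf v) ≤ 1 / (n : ℝ) ^ 2 := fun v => by
    obtain ⟨h1, h2, -⟩ := contFracTail_distortion (one_le_of_mem_wordOf v)
    rw [length_wordOf] at h2
    exact ⟨h1, by rwa [le_div_iff₀ (by positivity)]⟩
  have hFsum : ∑ v ∈ F, cylLength (wordOf v) ≤ 1 / 4 := by
    calc _ ≤ F.card • (1 / (n : ℝ) ^ 2) := Finset.sum_le_card_nsmul _ _ _ fun v _ => (hlen v).2
      _ ≤ n * (1 / (n : ℝ) ^ 2) := by rw [nsmul_eq_mul]; gcongr
      _ = 1 / n := by field_simp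
      _ ≤ 1 / 4 := by gcongr
  have hsplit := Finset.sum_add_sum_compl F fun v => cylLength (wordOf v)
  calc (1 : ℝ) ≤ ∑ v ∈ Fᶜ, 2 * cylLength (wordOf v) := by rw [← Finset.mul_sum]; linarith
    _ ≤ _ := Finset.sum_le_sum fun v _ => ?_
  obtain ⟨h1, h2⟩ := hlen v
  set l := cylLength (wordOf v)
  have hpow : (4 : ℝ) ≤ (l / 2) ^ (s - 1) := by
    calc (4 : ℝ) ≤ (n : ℝ) ^ (2 * (1 - s)) := hn
      _ = (1 / (n : ℝ) ^ 2) ^ (s - 1) := by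
        rw [one_div, Real.inv_rpow (by positivity), ← Real.rpow_neg (by positivity), neg_sub,
          ← Real.rpow_natCast, ← Real.rpow_mul (by positivity)]
        norm_num
      _ ≤ _ := Real.rpow_le_rpow_of_nonpos (by positivity) (by linarith) (by linarith)
  calc 2 * l = (l / 2) * 4 := by ring
    _ ≤ (l / 2) * (l / 2) ^ (s - 1) := by gcongr
    _ = (l / 2) ^ s := by
      rw [Real.rpow_sub_one (by positivity)]; field_simp

/-- `X d` is the value of the continued fraction whose partial quotients are `d n + 1`. -/
structure IsContFracValue {N : ℕ} (X : (ℕ → Fin (N + 1)) → ℝ) : Prop where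
  continuous : Continuous X
  mem_Icc : ∀ d, X d ∈ Icc (1 / ((N : ℝ) + 2)) 1
  eq_one_div : ∀ d, X d = 1 / (((d 0 : ℕ) : ℝ) + 1 + X fun n => d (n + 1))

theorem abs_one_div_sub_one_div {a b : ℝ} (ha : 0 < a) (hb : 0 < b) :
    |1 / a - 1 / b| = |a - b| / (a * b) := by
  rw [div_sub_div _ _ ha.ne' hb.ne', abs_div, abs_of_pos (mul_pos ha hb), abs_sub_comm]
  simp

theorem exists_isContFracValue (N : ℕ) :
    ∃ X : (ℕ → Fin (N + 1)) → ℝ, IsContFracValue X := by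
  set α : ℝ := 1 / ((N : ℝ) + 2) with hα
  have hN0 : (0 : ℝ) ≤ N := N.cast_nonneg
  have hα0 : 0 < α := by positivity
  have hα1 : α ≤ 1 := by rw [hα, div_le_one (by positivity)]; linarith
  have : Nonempty C(ℕ → Fin (N + 1), Icc α 1) :=
    ⟨ContinuousMap.const _ ⟨1, hα1, le_rfl⟩⟩
  have : CompleteSpace (Icc α 1) := isClosed_Icc.completeSpace_coe
  let step (g : C(ℕ → Fin (N + 1), Icc α 1)) : C(ℕ → Fin (N + 1), Icc α 1) :=
    { toFun := fun d => ⟨1 / (((d 0 : ℕ) : ℝ) + 1 + g fun n => d (n + 1)), by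
        obtain ⟨h0, h1⟩ := (g fun n => d (n + 1)).2
        have ht0 := hα0.trans_le h0
        have hd : ((d 0 : ℕ) : ℝ) ≤ N := by exact_mod_cast Nat.lt_succ_iff.1 (d 0).2
        have hd0 : (0 : ℝ) ≤ (d 0 : ℕ) := Nat.cast_nonneg _
        constructor
        · exact one_div_le_one_div_of_le (by linarith) (by linarith)
        · rw [div_le_one (by linarith)]; linarith⟩
      continuous_toFun := by
        refine Continuous.subtype_mk ?_ _
        refine continuous_const.div ?_ fun d => ?_
        · refine Continuous.add (Continuous.add ?_ continuous_const) ?_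
          · exact (continuous_of_discreteTopology (f := fun k : Fin (N + 1) => ((k : ℕ) : ℝ))).comp
              (continuous_apply 0)
          · exact continuous_subtype_val.comp (g.continuous.comp
              (continuous_pi fun n => continuous_apply (n + 1)))
        · have := hα0.trans_le (g fun n => d (n + 1)).2.1
          positivity }
  have hstep : ∀ g d, (step g d : ℝ) = 1 / (((d 0 : ℕ) : ℝ) + 1 + g fun n => d (n + 1)) :=
    fun g d => rfl
  have hK : 1 / (1 + α) ^ 2 < 1 := by
    rw [div_lt_one (by positivity)]; nlinarith
  have hcontr : ContractingWith (1 / (1 + α) ^ 2).toNNReal step := by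
    refine ⟨Real.toNNReal_lt_one.2 hK, LipschitzWith.of_dist_le_mul fun g g' => ?_⟩
    rw [Real.coe_toNNReal _ (by positivity), ContinuousMap.dist_le (by positivity)]
    intro d
    have hg := g.dist_apply_le_dist (g := g') fun n => d (n + 1)
    rw [Subtype.dist_eq, Real.dist_eq] at hg
    rw [Subtype.dist_eq, Real.dist_eq, hstep, hstep]
    have h0 := (g fun n => d (n + 1)).2.1
    have h1 := (g' fun n => d (n + 1)).2.1
    set t : ℝ := ((g fun n => d (n + 1) : Icc α 1) : ℝ)
    set t' : ℝ := ((g' fun n => d (n + 1) : Icc α 1) : ℝ)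
    have hd0 : (0 : ℝ) ≤ (d 0 : ℕ) := Nat.cast_nonneg _
    rw [abs_one_div_sub_one_div (by linarith) (by linarith), add_sub_add_left_eq_sub]
    rw [one_div_mul_eq_div, sq]
    gcongr <;> linarith
  refine ⟨fun d => hcontr.fixedPoint step d,
    continuous_subtype_val.comp (hcontr.fixedPoint step).continuous,
    fun d => (hcontr.fixedPoint step d).2, fun d => ?_⟩
  have hfix := hcontr.fixedPoint_isFixedPt (f := step)
  conv_lhs => rw [← hfix.eq]
  exact hstep _ _

namespace IsContFracValue

variable {N : ℕ} {X : (ℕ → Fin (N + 1)) → ℝ}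

theorem pos (hX : IsContFracValue X) (d : ℕ → Fin (N + 1)) : 0 < X d :=
  lt_of_lt_of_le (by positivity) (hX.mem_Icc d).1

theorem lt_one (hX : IsContFracValue X) (d : ℕ → Fin (N + 1)) : X d < 1 := by
  have := hX.pos fun n => d (n + 1)
  rw [hX.eq_one_div, div_lt_one (by positivity)]
  have : (0 : ℝ) ≤ (d 0 : ℕ) := Nat.cast_nonneg _
  linarith

theorem mem_unitInterval (hX : IsContFracValue X) (d : ℕ → Fin (N + 1)) :
    X d ∈ Icc (0 : ℝ) 1 :=
  ⟨(hX.pos d).le, (hX.lt_one d).le⟩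

theorem eq_contFracTail (hX : IsContFracValue X) (d : ℕ → Fin (N + 1)) (m n : ℕ) :
    X (fun i => d (m + i)) =
      contFracTail (wordOf fun i : Fin n => d (m + i)) (X fun i => d (m + n + i)) := by
  induction n generalizing m with
  | zero => simp [wordOf, contFracTail]
  | succ n ih =>
    rw [hX.eq_one_div]
    have h := ih (m + 1)
    simp only [wordOf, List.ofFn_succ, contFracTail] at h ⊢
    simp only [Fin.val_succ, Fin.val_zero, add_assoc, add_comm 1] at h ⊢
    rw [h]
    push_cast
    rw [add_assoc]

theorem exists_agree (hX : IsContFracValue X) (n : ℕ) :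
    ∃ η > 0, ∀ d d', |X d - X d'| < η → ∀ i < n, d i = d' i := by
  induction n with
  | zero => exact ⟨1, one_pos, by simp⟩
  | succ n ih =>
    obtain ⟨η, hη, h⟩ := ih
    refine ⟨min (1 / ((N : ℝ) + 2)) η / ((N : ℝ) + 2) ^ 2, by positivity, fun d d' hd => ?_⟩
    set t := X fun n => d (n + 1) with ht
    set t' := X fun n => d' (n + 1) with ht'
    obtain ⟨ht0, ht1⟩ : t ∈ Icc _ _ := hX.mem_Icc _
    obtain ⟨ht0', ht1'⟩ : t' ∈ Icc _ _ := hX.mem_Icc _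
    have hα : 0 < 1 / ((N : ℝ) + 2) := by positivity
    have hk : ((d 0 : ℕ) : ℝ) ≤ N := by exact_mod_cast Nat.lt_succ_iff.1 (d 0).2
    have hk' : ((d' 0 : ℕ) : ℝ) ≤ N := by exact_mod_cast Nat.lt_succ_iff.1 (d' 0).2
    have hk0 : (0 : ℝ) ≤ (d 0 : ℕ) := Nat.cast_nonneg _
    have hk0' : (0 : ℝ) ≤ (d' 0 : ℕ) := Nat.cast_nonneg _
    rw [hX.eq_one_div d, hX.eq_one_div d', ← ht, ← ht',
      abs_one_div_sub_one_div (by linarith) (by linarith)] at hd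
    have hlt : |((d 0 : ℕ) : ℝ) + 1 + t - (((d' 0 : ℕ) : ℝ) + 1 + t')| <
        min (1 / ((N : ℝ) + 2)) η := by
      by_contra! hge
      refine hd.not_ge ?_
      have : 0 ≤ min (1 / ((N : ℝ) + 2)) η := by positivity
      rw [sq]
      refine div_le_div₀ (abs_nonneg _) hge (mul_pos (by linarith) (by linarith)) ?_
      exact mul_le_mul (by linarith) (by linarith) (by linarith) (by positivity)
    obtain ⟨hlt1, hlt2⟩ := lt_min_iff.1 hlt
    have h0 : d 0 = d' 0 := by
      by_contra hne
      have hz : (1 : ℝ) ≤ |((d 0 : ℕ) : ℝ) - ((d' 0 : ℕ) : ℝ)| := by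
        have : ((d 0 : ℕ) : ℤ) - ((d' 0 : ℕ) : ℤ) ≠ 0 := by
          have := Fin.val_ne_of_ne hne
          lia
        exact_mod_cast Int.one_le_abs this
      obtain ⟨h1, h2⟩ := abs_lt.1 hlt1
      rcases le_abs.1 hz with h | h <;> linarith
    rw [h0, add_sub_add_left_eq_sub] at hlt2
    have := h _ _ hlt2
    rintro (_ | i) hi
    · exact h0
    · exact this i (by lia)

theorem prod_cylLength_mul_le (hX : IsContFracValue X) (n m : ℕ) (d d' : ℕ → Fin (N + 1))
    (h : ∀ i < m * n, d i = d' i) :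
    (∏ i ∈ Finset.range m, cylLength (wordOf fun j : Fin n => d (i * n + j)) / 2) *
      |X (fun i => d (m * n + i)) - X fun i => d' (m * n + i)| ≤ |X d - X d'| := by
  induction m with
  | zero => simp
  | succ m ih =>
    refine le_trans ?_ (ih fun i hi => h i (hi.trans_le (by gcongr; lia)))
    rw [Finset.prod_range_succ, mul_assoc]
    have hpos : ∀ i, 0 < cylLength (wordOf fun j : Fin n => d (i * n + j)) / 2 := fun i =>
      half_pos (contFracTail_distortion (one_le_of_mem_wordOf _)).1
    refine mul_le_mul_of_nonneg_left ?_ (Finset.prod_nonneg fun i _ => (hpos i).le)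
    have hw : (wordOf fun j : Fin n => d' (m * n + j)) = wordOf fun j : Fin n => d (m * n + j) := by
      congr 1
      funext j
      exact (h _ (by rw [Nat.succ_mul]; lia)).symm
    rw [hX.eq_contFracTail d (m * n) n, hX.eq_contFracTail d' (m * n) n, hw, ← Nat.succ_mul]
    exact ((contFracTail_distortion (one_le_of_mem_wordOf _)).2.2 _ (hX.mem_unitInterval _) _
      (hX.mem_unitInterval _)).1

end IsContFracValue

theorem exists_eq_contFracTail {z : ℝ} (hz : Irrational z) (hz0 : 0 < z) (hz1 : z < 1) (m : ℕ) :
    ∃ u : List ℕ, u.length = m ∧ (∀ a ∈ u, 1 ≤ a) ∧ ∃ t ∈ Icc (0 : ℝ) 1,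
      z = contFracTail u t := by
  induction m generalizing z with
  | zero => exact ⟨[], rfl, by simp, z, ⟨hz0.le, hz1.le⟩, rfl⟩
  | succ m ih =>
    have hirr : Irrational (Int.fract z⁻¹) := by
      rw [Int.fract]; exact hz.inv.sub_intCast _
    obtain ⟨u, hlen, hu, t, ht, h⟩ := ih hirr
      (lt_of_le_of_ne (Int.fract_nonneg _) hirr.ne_zero.symm) (Int.fract_lt_one _)
    refine ⟨⌊z⁻¹⌋₊ :: u, by simp [hlen], ?_, t, ht, ?_⟩
    · simp only [List.mem_cons, forall_eq_or_imp]
      exact ⟨Nat.le_floor (by simpa using (one_le_inv₀ hz0).2 hz1.le), hu⟩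
    · rw [contFracTail, ← h, natCast_floor_eq_intCast_floor (inv_nonneg.2 hz0.le),
        Int.floor_add_fract, one_div, inv_inv]

section GaussMap

variable {T : Icc (0 : ℝ) 1 → Icc (0 : ℝ) 1}

theorem iterate_gaussMap_contFracTail
    (hT : ∀ x : Icc (0 : ℝ) 1, (T x : ℝ) = if (x : ℝ) = 0 then 0 else Int.fract (1 / (x : ℝ)))
    {u : List ℕ} (hu : ∀ a ∈ u, 1 ≤ a) {t : ℝ} (ht0 : 0 < t) (ht1 : t < 1)
    {x : Icc (0 : ℝ) 1} (hx : (x : ℝ) = contFracTail u t) : (T^[u.length] x : ℝ) = t := by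
  have hmem : ∀ w : List ℕ, (∀ a ∈ w, 1 ≤ a) → 0 < contFracTail w t ∧ contFracTail w t < 1 := by
    intro w hw
    induction w with
    | nil => exact ⟨ht0, ht1⟩
    | cons a w ih =>
      have h := (ih fun b hb => hw b (List.mem_cons_of_mem _ hb)).1
      have ha : (1 : ℝ) ≤ a := by exact_mod_cast hw a (by simp)
      rw [contFracTail]
      exact ⟨by positivity, by rw [div_lt_one (by positivity)]; linarith⟩
  induction u generalizing x with
  | nil => exact hx
  | cons a u ih =>
    have hu' : ∀ b ∈ u, 1 ≤ b := fun b hb => hu b (List.mem_cons_of_mem _ hb)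
    obtain ⟨h0, h1⟩ := hmem u hu'
    rw [List.length_cons, Function.iterate_succ_apply]
    refine ih hu' ?_
    have hx0 : (x : ℝ) ≠ 0 := hx ▸ (hmem _ hu).1.ne'
    rw [hT, if_neg hx0, hx, contFracTail, one_div_one_div, Int.fract_natCast_add,
      Int.fract_eq_self.2 ⟨h0.le, h1⟩]

theorem IsContFracValue.iterate_gaussMap
    (hT : ∀ x : Icc (0 : ℝ) 1, (T x : ℝ) = if (x : ℝ) = 0 then 0 else Int.fract (1 / (x : ℝ)))
    {N : ℕ} {X : (ℕ → Fin (N + 1)) → ℝ} (hX : IsContFracValue X) {x : Icc (0 : ℝ) 1}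
    {d : ℕ → Fin (N + 1)} (hx : (x : ℝ) = X d) (n : ℕ) :
    (T^[n] x : ℝ) = X fun i => d (n + i) := by
  have h := hX.eq_contFracTail d 0 n
  simp only [zero_add] at h
  have := iterate_gaussMap_contFracTail hT (one_le_of_mem_wordOf _) (hX.pos _) (hX.lt_one _)
    (hx.trans h)
  rwa [length_wordOf] at this

end GaussMap

theorem exists_cylinder_subset {U : Set (Icc (0 : ℝ) 1)} (hU : IsOpen U) (hUne : U.Nonempty)
    {δ : ℝ} (hδ : 0 < δ) :
    ∃ (u : List ℕ) (z : Icc (0 : ℝ) 1), (∀ a ∈ u, 1 ≤ a) ∧ ∀ x : Icc (0 : ℝ) 1, ∀ t ∈ Icc (0 : ℝ) 1,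
      (x : ℝ) = contFracTail u t → x ∈ U ∧ |(x : ℝ) - z| < δ := by
  obtain ⟨x₀, hx₀⟩ := hUne
  obtain ⟨ρ, hρ, hball⟩ := Metric.isOpen_iff.1 hU x₀ hx₀
  obtain ⟨h0, h1⟩ := x₀.2
  obtain ⟨z, hz, hlo, hhi⟩ := exists_irrational_btwn
    (show max 0 ((x₀ : ℝ) - ρ) < min 1 ((x₀ : ℝ) + ρ) by
      simp only [max_lt_iff, lt_min_iff]
      refine ⟨⟨?_, ?_⟩, ?_, ?_⟩ <;> linarith)
  obtain ⟨hz0, hzρ⟩ := max_lt_iff.1 hlo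
  obtain ⟨hz1, hzρ'⟩ := lt_min_iff.1 hhi
  have hzdist : |z - x₀| < ρ := abs_lt.2 ⟨by linarith, by linarith⟩
  have hκ : 0 < min δ (ρ - |z - x₀|) := lt_min hδ (by linarith)
  obtain ⟨k, hk⟩ := exists_nat_one_div_lt (half_pos hκ)
  obtain ⟨u, hlen, hu, t₀, ht₀, hzt⟩ := exists_eq_contFracTail hz hz0 hz1 (k + 1)
  obtain ⟨hc0, hc, hdist⟩ := contFracTail_distortion hu
  refine ⟨u, ⟨z, hz0.le, hz1.le⟩, hu, fun x t ht hx => ?_⟩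
  have hlt : |(x : ℝ) - z| < min δ (ρ - |z - x₀|) := by
    rw [hx, hzt]
    refine (hdist t ht t₀ ht₀).2.trans_lt ?_
    have hc' : cylLength u ≤ 1 / ((k : ℝ) + 1) := by
      rw [le_div_iff₀ (by positivity)]
      refine le_trans ?_ hc
      rw [hlen]
      push_cast
      gcongr
      exact le_self_pow₀ (by linarith [(k.cast_nonneg : (0 : ℝ) ≤ k)]) two_ne_zero
    have ht1 : |t - t₀| ≤ 1 := abs_le.2 ⟨by linarith [ht.1, ht₀.2], by linarith [ht.2, ht₀.1]⟩
    calc 2 * cylLength u * |t - t₀| ≤ 2 * cylLength u * 1 := by gcongr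
      _ < _ := by rw [hzt] at hk; linarith
  obtain ⟨hl1, hl2⟩ := lt_min_iff.1 hlt
  refine ⟨hball ?_, hl1⟩
  rw [Metric.mem_ball, Subtype.dist_eq, Real.dist_eq]
  linarith [abs_sub_le (x : ℝ) z x₀]

/-- Every sequence of targets is avoided by the orbits of a product set of digit sequences, in
which at most `n` words are removed from each block of length `n`. -/
theorem IsContFracValue.exists_forbidden_blocks {N : ℕ} {X : (ℕ → Fin (N + 1)) → ℝ}
    (hX : IsContFracValue X) {n : ℕ} (hn : 0 < n) :
    ∃ ε > 0, ∀ y : ℕ → ℝ, ∃ F : ℕ → Finset (Fin n → Fin (N + 1)), (∀ i, (F i).card ≤ n) ∧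
      ∀ d : ℕ → Fin (N + 1), (∀ i, (fun l : Fin n => d (i * n + l)) ∉ F i) →
        ∀ k, ε ≤ |X (fun i => d (k + i)) - y k| := by
  classical
  obtain ⟨η, hη, hagree⟩ := hX.exists_agree (2 * n)
  refine ⟨η / 2, half_pos hη, fun y => ?_⟩
  have hex : ∀ k, ∃ e, (∃ d, |X d - y k| < η / 2) → |X e - y k| < η / 2 := fun k => by
    by_cases h : ∃ d, |X d - y k| < η / 2
    · exact ⟨h.choose, fun _ => h.choose_spec⟩
    · exact ⟨fun _ => 0, fun h' => absurd h' h⟩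
  choose e he using hex
  refine ⟨fun i => Finset.univ.image fun (j : Fin n) (l : Fin n) => e (i * n - j) (j + l),
    fun i => Finset.card_image_le.trans (by simp), fun d hd k => ?_⟩
  by_contra! hlt
  have hk := he k ⟨_, hlt⟩
  have heq := hagree (fun i => d (k + i)) (e k) (by
    have := abs_sub_le (X fun i => d (k + i)) (y k) (X (e k))
    rw [abs_sub_comm (y k)] at this
    linarith)
  obtain ⟨i, hi, hi'⟩ : ∃ i, k ≤ i * n ∧ i * n < k + n := by
    refine ⟨(k + n - 1) / n, ?_⟩
    have h1 := Nat.div_add_mod' (k + n - 1) n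
    have h2 := Nat.mod_lt (k + n - 1) hn
    lia
  refine hd i (Finset.mem_image.2 ⟨⟨i * n - k, by lia⟩, Finset.mem_univ _, ?_⟩)
  funext l
  have h := heq (i * n - k + l) (by lia)
  simp only [← add_assoc, Nat.add_sub_cancel' hi] at h
  simp only [Nat.sub_sub_self hi]
  exact h.symm

theorem le_dimH_gaussMap_twisted
    {T : Icc (0 : ℝ) 1 → Icc (0 : ℝ) 1}
    (hT : ∀ x : Icc (0 : ℝ) 1, (T x : ℝ) = if (x : ℝ) = 0 then 0 else Int.fract (1 / (x : ℝ)))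
    {f : ℕ → Icc (0 : ℝ) 1 → Icc (0 : ℝ) 1}
    (hf : ∀ ε : ℝ, 0 < ε → ∃ δ : ℝ, 0 < δ ∧ ∀ (n : ℕ) (x y : Icc (0 : ℝ) 1),
      |(x : ℝ) - (y : ℝ)| < δ → |(f n x : ℝ) - (f n y : ℝ)| < ε)
    {U : Set (Icc (0 : ℝ) 1)} (hU : IsOpen U) (hUne : U.Nonempty)
    {s : ℝ≥0} (hs0 : 0 < s) (hs1 : s < 1) :
    (s : ℝ≥0∞) ≤ dimH {x : Icc (0 : ℝ) 1 | x ∈ U ∧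
      0 < liminf (fun n => |(T^[n] x : ℝ) - (f n x : ℝ)|) atTop} := by
  obtain ⟨n, N, hn, hsum⟩ := exists_cylLength_rpow_sum_ge (s := s) (by exact_mod_cast hs1)
  obtain ⟨X, hX⟩ := exists_isContFracValue N
  obtain ⟨ε, hε, hforb⟩ := hX.exists_forbidden_blocks hn
  obtain ⟨δ, hδ, hfδ⟩ := hf (ε / 2) (half_pos hε)
  obtain ⟨u, z, hu, hcyl⟩ := exists_cylinder_subset hU hUne hδ
  obtain ⟨F, hF, havoid⟩ := hforb fun k => f (k + u.length) z
  obtain ⟨η, hη, hagree⟩ := hX.exists_agree n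
  obtain ⟨hc0, -, hdist⟩ := contFracTail_distortion hu
  let D (ω : ∀ i, {v // v ∈ (F i)ᶜ}) (k : ℕ) : Fin (N + 1) :=
    (ω (k / n)).1 ⟨k % n, Nat.mod_lt _ hn⟩
  have hD : ∀ ω i, (fun l : Fin n => D ω (i * n + l)) = (ω i).1 := by
    intro ω i
    funext l
    have h1 : (i * n + l) / n = i := by
      rw [mul_comm, Nat.mul_add_div hn, Nat.div_eq_of_lt l.2, add_zero]
    have h2 : (i * n + l) % n = l := by
      rw [mul_comm, Nat.mul_add_mod, Nat.mod_eq_of_lt l.2]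
    have h3 : ∀ q, q = i → (ω q).1 l = (ω i).1 l := by rintro _ rfl; rfl
    simp only [D, h2]
    exact h3 _ h1
  have hDavoid : ∀ ω k, ε ≤ |X (fun i => D ω (k + i)) - f (k + u.length) z| := fun ω =>
    havoid (D ω) fun i => by
      rw [hD]; exact Finset.mem_compl.1 (ω i).2
  have hDm : Measurable D := measurable_pi_iff.2 fun k =>
    (measurable_pi_apply _).comp (measurable_subtype_coe.comp (measurable_pi_apply (k / n)))
  let π (ω : ∀ i, {v // v ∈ (F i)ᶜ}) : Icc (0 : ℝ) 1 :=
    ⟨contFracTail u (X (D ω)), contFracTail_mem_Icc hu (hX.mem_unitInterval _)⟩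
  have hπ : Measurable π := by
    refine Measurable.subtype_mk ?_
    have hlip : ContinuousOn (contFracTail u) (Icc 0 1) := by
      refine (LipschitzOnWith.of_dist_le_mul (K := ⟨2 * cylLength u, by positivity⟩)
        fun x hx y hy => ?_).continuousOn
      rw [Real.dist_eq, Real.dist_eq]
      exact (hdist x hx y hy).2
    exact (hlip.comp_continuous hX.continuous hX.mem_unitInterval).measurable.comp hDm
  have hword : ∀ v : Fin n → Fin (N + 1), 0 < cylLength (wordOf v) / 2 ∧
      cylLength (wordOf v) / 2 ≤ 1 / 2 := fun v => by
    obtain ⟨h1, h2, -⟩ := contFracTail_distortion (one_le_of_mem_wordOf v)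
    rw [length_wordOf] at h2
    have h3 : (1 : ℝ) ≤ (n : ℝ) ^ 2 := one_le_pow₀ (by exact_mod_cast hn)
    exact ⟨half_pos h1, by nlinarith⟩
  refine (le_dimH_range_of_sep hπ hs0 (r := fun i w => cylLength (wordOf w.1) / 2)
    (fun i w => (hword w.1).1) (fun i w => (hword w.1).2) (fun i => ?_)
    (c := cylLength u / 2 * η) (by positivity) ?_).trans (dimH_mono ?_)
  · rw [Finset.sum_coe_sort (F i)ᶜ fun v => (cylLength (wordOf v) / 2) ^ (s : ℝ)]
    exact hsum (F i) (hF i)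
  · intro ω ω' m hagr hne
    rw [Subtype.dist_eq, Real.dist_eq]
    refine le_trans ?_ (hdist _ (hX.mem_unitInterval (D ω)) _ (hX.mem_unitInterval (D ω'))).1
    rw [mul_assoc, mul_comm η]
    refine mul_le_mul_of_nonneg_left ?_ (by positivity)
    refine le_trans ?_ (hX.prod_cylLength_mul_le n m (D ω) (D ω') fun k hk => ?_)
    · simp only [hD]
      refine mul_le_mul_of_nonneg_left ?_ (Finset.prod_nonneg fun i _ => (hword _).1.le)
      by_contra! hlt
      refine hne (Subtype.ext ?_)
      rw [← hD, ← hD]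
      funext l
      exact hagree _ _ hlt l l.2
    · have : k / n < m := Nat.div_lt_of_lt_mul (by rwa [mul_comm])
      simp only [D, hagr _ this]
  · rintro _ ⟨ω, rfl⟩
    obtain ⟨hmem, hclose⟩ := hcyl (π ω) _ (hX.mem_unitInterval (D ω)) rfl
    refine ⟨hmem, (half_pos hε).trans_le (le_liminf_of_le ?_ ?_)⟩
    · refine (isBoundedUnder_of ⟨1, fun k => ?_⟩).isCoboundedUnder_ge
      obtain ⟨h0, h1⟩ := (T^[k] (π ω)).2
      obtain ⟨h0', h1'⟩ := (f k (π ω)).2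
      exact abs_le.2 ⟨by linarith, by linarith⟩
    · filter_upwards [eventually_ge_atTop u.length] with k hk
      obtain ⟨j, rfl⟩ := Nat.exists_eq_add_of_le' hk
      have hTu : (T^[u.length] (π ω) : ℝ) = X (D ω) :=
        iterate_gaussMap_contFracTail hT hu (hX.pos _) (hX.lt_one _) rfl
      rw [Function.iterate_add_apply, hX.iterate_gaussMap hT hTu j]
      have h1 := hDavoid ω j
      have h2 := hfδ (j + u.length) _ _ hclose
      have h3 := abs_sub_le (X fun i => D ω (j + i)) (f (j + u.length) (π ω) : ℝ)
        (f (j + u.length) z)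
      linarith

end GaussTwisted

/-- For the Gauss map `T` on `[0,1]` (`T 0 = 0`, `T x = 1/x mod 1`
for `x ≠ 0`) and any equicontinuous sequence `(f n)` of self-maps of `[0,1]`, for
every nonempty open subset `U` of `[0,1]` the set of points `x ∈ U` with
`liminf_n |T^n x - f n x| > 0` has Hausdorff dimension `1`; in particular the set
`BA((f n))` has local Hausdorff dimension `1` everywhere. -/
theorem gaussMap_twisted_badly_approximable_full_local_dimH
    (T : Set.Icc (0:ℝ) 1 → Set.Icc (0:ℝ) 1)
    (hT : ∀ x : Set.Icc (0:ℝ) 1,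
      ((T x : ℝ)) = if (x : ℝ) = 0 then 0 else Int.fract (1 / (x : ℝ)))
    (f : ℕ → Set.Icc (0:ℝ) 1 → Set.Icc (0:ℝ) 1)
    (hf : ∀ ε : ℝ, 0 < ε → ∃ δ : ℝ, 0 < δ ∧ ∀ (n : ℕ) (x y : Set.Icc (0:ℝ) 1),
      |(x : ℝ) - (y : ℝ)| < δ → |((f n x : ℝ)) - ((f n y : ℝ))| < ε)
    (U : Set (Set.Icc (0:ℝ) 1)) (hU : IsOpen U) (hUne : U.Nonempty) :
    dimH {x : Set.Icc (0:ℝ) 1 | x ∈ U ∧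
      0 < Filter.liminf (fun n => |((T^[n] x : ℝ)) - ((f n x : ℝ))|) Filter.atTop} = 1 := by
  refine le_antisymm ?_ (le_of_forall_lt fun c hc => ?_)
  · rw [← isometry_subtype_coe.dimH_image, ← Real.dimH_univ]
    exact dimH_mono (Set.subset_univ _)
  · obtain ⟨s, hcs, hs1⟩ := ENNReal.lt_iff_exists_nnreal_btwn.1 hc
    exact hcs.trans_le (GaussTwisted.le_dimH_gaussMap_twisted hT hf hU hUne
      (by exact_mod_cast (zero_le.trans_lt hcs)) (by exact_mod_cast hs1))
end

section
/- Let (X,d) be a complete metric space, let α ∈ (0,1), and let (S_i)_{i∈ℕ} be a countable family of subsets of X each of which is α-winning for Schmidt's game. Then the intersection ⋂_{i∈ℕ} S_i is α-winning. -/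
/-- A strategy whose moves are legal along every infinite legal play of Bob is already legal after
every finite legal play of Bob, since Bob can continue by copying Alice's centers. -/
theorem strategy_legal_of_finite_play {X : Type*} [MetricSpace X] {α β : ℝ}
    (hα : 0 < α) (hβ : β ∈ Set.Ioo (0:ℝ) 1) {strat : List (X × ℝ) → X}
    (hs : ∀ (z : ℕ → X) (r : ℕ → ℝ),
      (∀ k, r (k + 1) = β * (α * r k)) → 0 < r 0 →
      (∀ k, Metric.closedBall (z (k + 1)) (r (k + 1)) ⊆
        Metric.closedBall (strat ((List.range (k + 1)).map fun i => (z i, r i))) (α * r k)) →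
      ∀ k, Metric.closedBall (strat ((List.range (k + 1)).map fun i => (z i, r i)))
          (α * r k) ⊆ Metric.closedBall (z k) (r k))
    {z : ℕ → X} {r : ℕ → ℝ} (hr : ∀ k, r (k + 1) = β * (α * r k)) (hr0 : ∀ k, 0 < r k) {n : ℕ}
    (hz : ∀ k < n, Metric.closedBall (z (k + 1)) (r (k + 1)) ⊆
        Metric.closedBall (strat ((List.range (k + 1)).map fun i => (z i, r i))) (α * r k)) :
    Metric.closedBall (strat ((List.range (n + 1)).map fun i => (z i, r i))) (α * r n) ⊆
      Metric.closedBall (z n) (r n) := by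
  let H : ℕ → List (X × ℝ) := fun m => Nat.rec ((List.range (n + 1)).map fun i => (z i, r i))
    (fun m L => L ++ [(strat L, r (n + 1 + m))]) m
  let z' : ℕ → X := fun k => if k ≤ n then z k else strat (H (k - (n + 1)))
  have hz'_le : ∀ k ≤ n, z' k = z k := fun k hk => if_pos hk
  have hz'_gt : ∀ m, z' (n + 1 + m) = strat (H m) := fun m => by
    have h : ¬ n + 1 + m ≤ n := by omega
    simp only [z', if_neg h, Nat.add_sub_cancel_left]
  have hist_le : ∀ k ≤ n, ((List.range (k + 1)).map fun i => (z' i, r i)) =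
      (List.range (k + 1)).map fun i => (z i, r i) := fun k hk => by
    refine List.map_congr_left fun i hi => ?_
    rw [hz'_le i (by have := List.mem_range.1 hi; omega)]
  have hist_gt : ∀ m, ((List.range (n + 1 + m)).map fun i => (z' i, r i)) = H m := by
    intro m
    induction m with
    | zero => exact hist_le n le_rfl
    | succ m ih =>
      rw [← add_assoc, List.range_succ, List.map_append, ih, List.map_singleton, hz'_gt]
  have key := hs z' r hr (hr0 0) (fun k => ?_) n
  · rwa [hist_le n le_rfl, hz'_le n le_rfl] at key
  · rcases lt_or_ge k n with hk | hk
    · rw [hist_le k hk.le, hz'_le (k + 1) hk]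
      exact hz k hk
    · obtain ⟨m, rfl⟩ := Nat.exists_eq_add_of_le hk
      rw [show n + m + 1 = n + 1 + m by ring, hist_gt, hz'_gt,
        show n + 1 + m = n + m + 1 by ring, hr]
      refine Metric.closedBall_subset_closedBall ?_
      have := mul_pos hα (hr0 (n + m))
      nlinarith [hβ.2]

/-- If Alice's balls `A k ⊆ B k` are legal before time `b` and Bob's balls are legal, then Bob's
ball at time `b` lies in each of Alice's earlier balls. -/
theorem bob_subset_alice_of_lt {X : Type*} {A B : ℕ → Set X} (hB : ∀ k, B (k + 1) ⊆ A k)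
    {a b : ℕ} (hab : a < b) (hA : ∀ k < b, A k ⊆ B k) : B b ⊆ A a := by
  induction b, hab using Nat.le_induction with
  | base => exact hB a
  | succ b hb ih =>
    exact (hB b).trans ((hA b b.lt_succ_self).trans (ih fun k hk => hA k (hk.trans b.lt_succ_self)))

/-- The strategy that at the time `2 ^ i * (2 * j + 1)` (counted from `1`) follows the `i`-th given
strategy, applied to the history of the game restricted to the times `2 ^ i * (2 * m + 1)`,
`m ≤ j`. -/
def interleave {X : Type*} (strat : ℕ → List (X × ℝ) → X) (L : List (X × ℝ)) : X :=
  strat (padicValNat 2 L.length)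
    ((List.range (L.length / 2 ^ (padicValNat 2 L.length + 1) + 1)).filterMap fun m =>
      L[2 ^ padicValNat 2 L.length * (2 * m + 1) - 1]?)

theorem interleave_map_range {X : Type*} (strat : ℕ → List (X × ℝ) → X) (p : ℕ → X × ℝ)
    (i j : ℕ) :
    interleave strat ((List.range (2 ^ i * (2 * j + 1))).map p) =
      strat i ((List.range (j + 1)).map fun m => p (2 ^ i * (2 * m + 1) - 1)) := by
  have hval : padicValNat 2 (2 ^ i * (2 * j + 1)) = i := by
    rw [padicValNat.mul (by positivity) (by positivity), padicValNat.prime_pow,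
      padicValNat.eq_zero_of_not_dvd (by omega), add_zero]
  have hdiv : 2 ^ i * (2 * j + 1) / 2 ^ (i + 1) = j := by
    rw [pow_succ, Nat.mul_div_mul_left _ _ (by positivity)]
    omega
  unfold interleave
  simp only [List.length_map, List.length_range, hval, hdiv]
  congr 1
  rw [← List.filterMap_eq_map (f := fun m => p (2 ^ i * (2 * m + 1) - 1))]
  refine List.filterMap_congr fun m hm => ?_
  have hmj : m ≤ j := Nat.lt_succ_iff.1 (List.mem_range.1 hm)
  have hlt : 2 ^ i * (2 * m + 1) - 1 < 2 ^ i * (2 * j + 1) := by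
    have h1 : 2 ^ i * (2 * m + 1) ≤ 2 ^ i * (2 * j + 1) := by gcongr
    have h2 : 0 < 2 ^ i * (2 * m + 1) := by positivity
    omega
  simp [hlt]

/-- In a complete metric space, a countable intersection of
`α`-winning sets for Schmidt's game is `α`-winning. -/
theorem schmidt_winning_iInter {X : Type*} [MetricSpace X] [CompleteSpace X]
    (α : ℝ) (hα : α ∈ Set.Ioo (0:ℝ) 1) (S : ℕ → Set X)
    (hwin : ∀ i : ℕ, ∀ β ∈ Set.Ioo (0:ℝ) 1, SchmidtWinning (S i) α β) :
    ∀ β ∈ Set.Ioo (0:ℝ) 1, SchmidtWinning (⋂ i, S i) α β := by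
  intro β hβ
  have hc0 : 0 < β * α := mul_pos hβ.1 hα.1
  have hc1 : β * α < 1 := mul_lt_one_of_nonneg_of_lt_one_left hβ.1.le hβ.2 hα.2.le
  let b : ℕ → ℝ := fun i => β * (β * α) ^ (2 ^ (i + 1) - 1)
  have hb : ∀ i, b i ∈ Set.Ioo (0:ℝ) 1 := fun i =>
    ⟨mul_pos hβ.1 (pow_pos hc0 _),
      mul_lt_one_of_nonneg_of_lt_one_left hβ.1.le hβ.2 (pow_le_one₀ hc0.le hc1.le)⟩
  choose strat hs using fun i => hwin i (b i) (hb i)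
  refine ⟨interleave strat, fun z r hr0 hr hz => ?_⟩
  have hrpow : ∀ k m, r (k + m) = (β * α) ^ m * r k := by
    intro k m
    induction m with
    | zero => simp
    | succ m ih => rw [← add_assoc, hr, ih]; ring
  have hrk : ∀ k, r k = (β * α) ^ k * r 0 := fun k => by simpa using hrpow 0 k
  have hrpos : ∀ k, 0 < r k := fun k => hrk k ▸ mul_pos (pow_pos hc0 k) hr0
  let pos : ℕ → ℕ → ℕ := fun i j => 2 ^ i * (2 * j + 1) - 1
  have hpos : ∀ i j, pos i j + 1 = 2 ^ i * (2 * j + 1) := fun i j =>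
    Nat.sub_add_cancel (Nat.mul_pos (by positivity) (by positivity))
  have hstep : ∀ i j, pos i (j + 1) = pos i j + 2 ^ (i + 1) := fun i j => by
    have h1 := hpos i j
    have h2 := hpos i (j + 1)
    have h3 : 2 ^ i * (2 * (j + 1) + 1) = 2 ^ i * (2 * j + 1) + 2 ^ (i + 1) := by ring
    omega
  have hrsub : ∀ i j, r (pos i (j + 1)) = b i * (α * r (pos i j)) := fun i j => by
    have h : (β * α) ^ (2 ^ (i + 1)) = (β * α) ^ (2 ^ (i + 1) - 1) * (β * α) := by
      rw [← pow_succ, Nat.sub_add_cancel Nat.one_le_two_pow]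
    rw [hstep, hrpow, h]
    ring
  let A : ℕ → Set X := fun k => Metric.closedBall
    (interleave strat ((List.range (k + 1)).map fun i => (z i, r i))) (α * r k)
  let B : ℕ → Set X := fun k => Metric.closedBall (z k) (r k)
  have hBA : ∀ k, B (k + 1) ⊆ A k := hz
  have hA_eq : ∀ i j, A (pos i j) = Metric.closedBall
      (strat i ((List.range (j + 1)).map fun m => (z (pos i m), r (pos i m))))
      (α * r (pos i j)) := fun i j => by
    simp only [A]
    rw [hpos, interleave_map_range strat (fun i => (z i, r i))]
  have hlt : ∀ i j, pos i j < pos i (j + 1) := fun i j => by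
    rw [hstep]
    exact Nat.lt_add_of_pos_right (by positivity)
  have hmono : ∀ i, StrictMono (pos i) := fun i => strictMono_nat_of_lt_succ (hlt i)
  have hAB : ∀ k, A k ⊆ B k := by
    intro k
    induction k using Nat.strong_induction_on with
    | _ k ih =>
      obtain ⟨i, j, rfl⟩ : ∃ i j, k = pos i j := by
        obtain ⟨i, m, ⟨j, rfl⟩, h⟩ := Nat.exists_eq_two_pow_mul_odd k.succ_ne_zero
        exact ⟨i, j, Nat.succ_injective (h.trans (hpos i j).symm)⟩
      rw [hA_eq]
      refine strategy_legal_of_finite_play (z := fun m => z (pos i m)) (r := fun m => r (pos i m))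
        hα.1 (hb i) (fun z r hr hr0 hz => (hs i z r hr0 hr hz).1) (hrsub i)
        (fun m => hrpos _) fun m hm => ?_
      rw [← hA_eq]
      exact bob_subset_alice_of_lt hBA (hlt i m) fun k hk =>
        ih k (hk.trans_le ((hmono i).monotone hm))
  refine ⟨hAB, ?_⟩
  have hanti : Antitone B := antitone_nat_of_succ_le fun k => (hBA k).trans (hAB k)
  have hpt : ∀ i, ∃ x, (∀ k, x ∈ B k) ∧ x ∈ S i := fun i => by
    obtain ⟨x, hx, hxS⟩ := (hs i (fun m => z (pos i m)) (fun m => r (pos i m)) (hrpos _) (hrsub i)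
      fun m => by
        rw [← hA_eq]
        exact bob_subset_alice_of_lt hBA (hlt i m) fun k _ => hAB k).2
    exact ⟨x, fun k => hanti ((hmono i).le_apply) (Set.mem_iInter.1 hx k), hxS⟩
  choose x hx hxS using hpt
  have hlim : Filter.Tendsto (fun k => r k + r k) Filter.atTop (nhds 0) := by
    have h : Filter.Tendsto r Filter.atTop (nhds 0) := by
      rw [funext hrk]
      simpa using (tendsto_pow_atTop_nhds_zero_of_lt_one hc0.le hc1).mul_const (r 0)
    simpa using h.add h
  have huniq : ∀ i, x i = x 0 := fun i => dist_le_zero.1 <|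
    ge_of_tendsto' hlim fun k => (dist_triangle_right _ _ (z k)).trans
      (add_le_add (hx i k) (hx 0 k))
  exact ⟨x 0, Set.mem_iInter.2 (hx 0), Set.mem_iInter.2 fun i => huniq i ▸ hxS i⟩
end

section
/- Let s > 0 and let (X,d) be a complete metric space that is Ahlfors s-regular. If S ⊆ X is winning for Schmidt's game, then the Hausdorff dimension of S equals s. -/
/-- A Borel probability measure `μ` on a metric space is Ahlfors `s`-regular if
there are constants `ρmax, K > 0` with `K⁻¹ ρ^s ≤ μ (closedBall z ρ) ≤ K ρ^s`
for every center `z` and every radius `ρ ∈ (0, ρmax)`. -/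
def AhlforsRegularMeasure {X : Type*} [MetricSpace X] [MeasurableSpace X]
    (μ : MeasureTheory.Measure X) (s : ℝ) : Prop :=
  ∃ ρmax K : ℝ, 0 < ρmax ∧ 0 < K ∧
    ∀ (z : X) (ρ : ℝ), 0 < ρ → ρ < ρmax →
      ENNReal.ofReal (K⁻¹ * ρ ^ s) ≤ μ (Metric.closedBall z ρ) ∧
        μ (Metric.closedBall z ρ) ≤ ENNReal.ofReal (K * ρ ^ s)

open MeasureTheory Metric Set Filter Topology
open scoped NNReal ENNReal

/-- A greedy construction of separated finite sets. -/
theorem exists_finset_card_eq_separated {X : Type*} [MetricSpace X] (A : Set X) (ε : ℝ)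
    (hε : 0 ≤ ε) (n : ℕ)
    (h : ∀ F : Finset X, F.card < n → ∃ p ∈ A, ∀ q ∈ F, ε < dist p q) :
    ∃ F : Finset X, ↑F ⊆ A ∧ F.card = n ∧ ∀ p ∈ F, ∀ q ∈ F, p ≠ q → ε < dist p q := by
  classical
  suffices H : ∀ m ≤ n, ∃ F : Finset X, ↑F ⊆ A ∧ F.card = m ∧
      ∀ p ∈ F, ∀ q ∈ F, p ≠ q → ε < dist p q from H n le_rfl
  intro m
  induction m with
  | zero => exact fun _ => ⟨∅, by simp⟩
  | succ m ih =>
    intro hm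
    obtain ⟨F, hFA, hFc, hF⟩ := ih (by omega)
    obtain ⟨p, hpA, hp⟩ := h F (by omega)
    have hpF : p ∉ F := fun hpF => by
      have := hp p hpF
      rw [dist_self] at this
      exact this.not_ge hε
    refine ⟨insert p F, ?_, by rw [Finset.card_insert_of_notMem hpF, hFc], ?_⟩
    · rw [Finset.coe_insert]
      exact insert_subset hpA hFA
    · intro x hx y hy hxy
      rcases Finset.mem_insert.1 hx with rfl | hxF <;> rcases Finset.mem_insert.1 hy with rfl | hyF
      · exact absurd rfl hxy
      · exact hp y hyF
      · exact dist_comm x y ▸ hp x hxF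
      · exact hF x hxF y hyF hxy

/-- A set of large measure contains many separated points, provided balls have small measure. -/
theorem exists_separated_of_measure_lt {X : Type*} [MetricSpace X] [MeasurableSpace X]
    (μ : Measure X) (A : Set X) (ε : ℝ) (hε : 0 ≤ ε) (v : ℝ≥0∞)
    (hv : ∀ p, μ (closedBall p ε) ≤ v) (n : ℕ) (hn : ∀ m < n, m * v < μ A) :
    ∃ c : Fin n → X, (∀ i, c i ∈ A) ∧ ∀ i j, i ≠ j → ε < dist (c i) (c j) := by
  obtain ⟨F, hFA, hFc, hF⟩ := exists_finset_card_eq_separated A ε hε n fun F hF => by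
    by_contra! hcon
    have hsub : A ⊆ ⋃ q ∈ F, closedBall q ε := fun p hp => by
      obtain ⟨q, hq, hpq⟩ := hcon p hp
      exact mem_biUnion hq hpq
    have h₁ : μ A ≤ F.card * v := calc
      μ A ≤ ∑ q ∈ F, μ (closedBall q ε) := (measure_mono hsub).trans (measure_biUnion_finset_le _ _)
      _ ≤ ∑ _q ∈ F, v := Finset.sum_le_sum fun q _ => hv q
      _ = F.card * v := by simp
    exact (hn _ hF).not_ge h₁
  let e := F.equivFinOfCardEq hFc
  refine ⟨fun i => e.symm i, fun i => hFA (e.symm i).2, fun i j hij => ?_⟩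
  exact hF _ (e.symm i).2 _ (e.symm j).2 fun h => hij (e.symm.injective (Subtype.ext h))

/-- A bound on the size of covers by balls in a space whose balls have large measure. -/
theorem exists_finset_cover_closedBall {X : Type*} [MetricSpace X] [MeasurableSpace X]
    [BorelSpace X] (μ : Measure X) [IsProbabilityMeasure μ] (ε v : ℝ) (hε : 0 ≤ ε) (hv : 0 < v)
    (hμ : ∀ p, ENNReal.ofReal v ≤ μ (closedBall p (ε / 2))) :
    ∃ F : Finset X, (F.card : ℝ) ≤ v⁻¹ ∧ univ ⊆ ⋃ p : F, closedBall (p : X) ε := by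
  by_contra! hcon
  obtain ⟨F, -, hFc, hF⟩ := exists_finset_card_eq_separated (univ : Set X) ε hε (⌊v⁻¹⌋₊ + 1)
    fun F hF => by
      have h₁ : (F.card : ℝ) ≤ v⁻¹ :=
        (Nat.le_floor_iff (by positivity)).1 (Nat.lt_succ_iff.1 hF)
      obtain ⟨p, hp, hpF⟩ := not_subset.1 (hcon F h₁)
      refine ⟨p, hp, fun q hq => ?_⟩
      by_contra! hle
      exact hpF (mem_iUnion.2 ⟨⟨q, hq⟩, hle⟩)
  have hdisj : (F : Set X).PairwiseDisjoint fun p => closedBall p (ε / 2) :=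
    fun p hp q hq hpq => closedBall_disjoint_closedBall (by linarith [hF p hp q hq hpq])
  have h₁ : (F.card : ℝ≥0∞) * ENNReal.ofReal v ≤ 1 := calc
    (F.card : ℝ≥0∞) * ENNReal.ofReal v = ∑ _p ∈ F, ENNReal.ofReal v := by simp
    _ ≤ ∑ p ∈ F, μ (closedBall p (ε / 2)) := Finset.sum_le_sum fun p _ => hμ p
    _ = μ (⋃ p ∈ F, closedBall p (ε / 2)) :=
      (measure_biUnion_finset hdisj fun _ _ => isClosed_closedBall.measurableSet).symm
    _ ≤ 1 := prob_le_one
  rw [← ENNReal.ofReal_natCast, ← ENNReal.ofReal_mul (by positivity), ENNReal.ofReal_le_one] at h₁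
  have h₂ : v⁻¹ < F.card := by
    rw [hFc]
    exact_mod_cast Nat.lt_floor_add_one v⁻¹
  have h₃ : v⁻¹ * v < F.card * v := by gcongr
  rw [inv_mul_cancel₀ hv.ne'] at h₃
  linarith

/-- An Ahlfors `s`-regular space has Hausdorff dimension at most `s`. -/
theorem AhlforsRegularMeasure.dimH_univ_le {X : Type*} [MetricSpace X] [MeasurableSpace X]
    [BorelSpace X] {μ : Measure X} [IsProbabilityMeasure μ] {s : ℝ} (hs : 0 < s)
    (h : AhlforsRegularMeasure μ s) : dimH (univ : Set X) ≤ ENNReal.ofReal s := by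
  obtain ⟨R, K, hR, hK, h⟩ := h
  let ε : ℕ → ℝ := fun n => R * (1 / ((n : ℝ) + 1))
  have hε : ∀ n, 0 < ε n := fun n => by positivity
  have hεR : ∀ n, ε n ≤ R := fun n => by
    refine mul_le_of_le_one_right hR.le ?_
    rw [div_le_one (by positivity)]
    linarith [n.cast_nonneg (α := ℝ)]
  have hε0 : Tendsto ε atTop (𝓝 0) := by
    simpa [ε] using tendsto_one_div_add_atTop_nhds_zero_nat.const_mul R
  choose F hFc hF using fun n => exists_finset_cover_closedBall μ (ε n) (K⁻¹ * (ε n / 2) ^ s)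
    (hε n).le (by have := hε n; positivity)
    fun p => (h p (ε n / 2) (by linarith [hε n]) (by linarith [hε n, hεR n])).1
  have hdiam : ∀ n (p : X), ediam (closedBall p (ε n)) ≤ ENNReal.ofReal (2 * ε n) := fun n p => by
    rw [ENNReal.ofReal_mul zero_le_two, ENNReal.ofReal_ofNat, ← closedEBall_ofReal (hε n).le]
    exact ediam_closedEBall_le
  have hmeas := Measure.hausdorffMeasure_le_liminf_sum s (univ : Set X) (l := atTop)
    (ι := fun n => F n) (fun n => ENNReal.ofReal (2 * ε n))
    (by simpa using ENNReal.tendsto_ofReal (hε0.const_mul 2))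
    (fun n p => closedBall (p : X) (ε n)) (.of_forall fun n p => hdiam n p) (.of_forall hF)
  have hsum : ∀ n, ∑ p : F n, ediam (closedBall (p : X) (ε n)) ^ s ≤
      ENNReal.ofReal (K * 4 ^ s) := fun n => by
    have hεn := hε n
    calc
      ∑ p : F n, ediam (closedBall (p : X) (ε n)) ^ s
        ≤ ∑ _p : F n, ENNReal.ofReal ((2 * ε n) ^ s) := by
          refine Finset.sum_le_sum fun p _ => ?_
          rw [← ENNReal.ofReal_rpow_of_pos (by positivity)]
          exact ENNReal.rpow_le_rpow (hdiam n p) hs.le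
      _ = ENNReal.ofReal ((F n).card * (2 * ε n) ^ s) := by
          rw [ENNReal.ofReal_mul (by positivity)]
          simp
      _ ≤ ENNReal.ofReal (K * 4 ^ s) := by
          refine ENNReal.ofReal_le_ofReal ?_
          calc ((F n).card : ℝ) * (2 * ε n) ^ s
              ≤ (K⁻¹ * (ε n / 2) ^ s)⁻¹ * (2 * ε n) ^ s := by
                gcongr
                exact hFc n
            _ = K * 4 ^ s := by
                have : 2 * ε n = 4 * (ε n / 2) := by ring
                rw [this, Real.mul_rpow (by norm_num) (by positivity)]
                have : (ε n / 2) ^ s ≠ 0 := by positivity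
                field_simp
  have hfin : μH[s] (univ : Set X) ≠ ∞ := by
    refine ne_top_of_le_ne_top (ENNReal.ofReal_ne_top (r := K * 4 ^ s)) (hmeas.trans ?_)
    exact (liminf_le_liminf (.of_forall hsum)).trans_eq (liminf_const _)
  refine dimH_le_of_hausdorffMeasure_ne_top ?_
  rwa [Real.coe_toNNReal s hs.le]

/-- A set coded by digit sequences with separated cylinders has large Hausdorff dimension. -/
theorem le_dimH_range_of_separated {X : Type*} [MetricSpace X] {N : ℕ} (hN : 1 < N)
    (x : (ℕ → Fin N) → X) (t : ℝ≥0) (ht : 0 < t) (C : ℝ≥0)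
    (h : ∀ a b n, (∀ i < n, a i = b i) → a n ≠ b n →
      ((N : ℝ) ^ n)⁻¹ ≤ C * dist (x a) (x b) ^ (t : ℝ)) :
    (t : ℝ≥0∞) ≤ dimH (range x) := by
  have : NeZero N := ⟨by omega⟩
  have hdist : ∀ a b, dist (Real.ofDigits a) (Real.ofDigits b) ≤
      C * dist (x a) (x b) ^ (t : ℝ) := fun a b => by
    rcases eq_or_ne a b with rfl | hab
    · rw [dist_self]
      positivity
    · have heq : ∀ i < PiNat.firstDiff a b, a i = b i :=
        fun i hi => PiNat.apply_eq_of_lt_firstDiff hi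
      exact (Real.abs_ofDigits_sub_ofDigits_le heq).trans
        (h a b _ heq (PiNat.apply_firstDiff_ne hab))
  have hinv : ∀ a, x (Function.invFun x (x a)) = x a :=
    fun a => Function.invFun_eq ⟨a, rfl⟩
  let f : X → ℝ := fun p => Real.ofDigits (Function.invFun x p)
  have hf : ∀ a, f (x a) = Real.ofDigits a := fun a => by
    refine dist_le_zero.1 ((hdist _ _).trans_eq ?_)
    rw [hinv, dist_self, Real.zero_rpow (by exact_mod_cast ht.ne'), mul_zero]
  have hold : HolderOnWith C t f (range x) := by
    rintro _ ⟨a, rfl⟩ _ ⟨b, rfl⟩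
    rw [hf, hf, edist_dist, edist_dist, ENNReal.ofReal_rpow_of_nonneg dist_nonneg t.coe_nonneg,
      ← ENNReal.ofReal_coe_nnreal, ← ENNReal.ofReal_mul C.coe_nonneg]
    exact ENNReal.ofReal_le_ofReal (hdist a b)
  have hsub : Icc (0 : ℝ) 1 ⊆ f '' range x := fun y hy => by
    obtain ⟨a, -, rfl⟩ := Real.ofDigits_SurjOn hN hy
    exact ⟨x a, mem_range_self a, hf a⟩
  have hdim : dimH (Icc (0 : ℝ) 1) = 1 := by
    rw [Real.dimH_of_nonempty_interior (by simp), Module.finrank_self, Nat.cast_one]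
  have h₁ : 1 ≤ dimH (range x) / t := calc
    1 = dimH (Icc (0 : ℝ) 1) := hdim.symm
    _ ≤ dimH (f '' range x) := dimH_mono hsub
    _ ≤ dimH (range x) / t := hold.dimH_image_le ht
  rwa [ENNReal.le_div_iff_mul_le (.inl (by exact_mod_cast ht.ne')) (.inl ENNReal.coe_ne_top),
    one_mul] at h₁

/-- The history of Bob's moves when he starts at `x₀` with radius `r 0` and, in turn `k + 1`,
answers Alice's move `ζ` by the center `c k ζ (a k)`. -/
def schmidtHistory {X ι : Type*} (strat : List (X × ℝ) → X) (x₀ : X) (r : ℕ → ℝ)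
    (c : ℕ → X → ι → X) (a : ℕ → ι) : ℕ → List (X × ℝ)
  | 0 => [(x₀, r 0)]
  | k + 1 => schmidtHistory strat x₀ r c a k ++
      [(c k (strat (schmidtHistory strat x₀ r c a k)) (a k), r (k + 1))]

/-- The centers played by Bob in `schmidtHistory`. -/
def schmidtCenter {X ι : Type*} (strat : List (X × ℝ) → X) (x₀ : X) (r : ℕ → ℝ)
    (c : ℕ → X → ι → X) (a : ℕ → ι) : ℕ → X
  | 0 => x₀
  | k + 1 => c k (strat (schmidtHistory strat x₀ r c a k)) (a k)

theorem map_range_schmidtCenter {X ι : Type*} (strat : List (X × ℝ) → X) (x₀ : X) (r : ℕ → ℝ)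
    (c : ℕ → X → ι → X) (a : ℕ → ι) (k : ℕ) :
    ((List.range (k + 1)).map fun i => (schmidtCenter strat x₀ r c a i, r i)) =
      schmidtHistory strat x₀ r c a k := by
  induction k with
  | zero => rfl
  | succ k ih =>
    rw [List.range_succ, List.map_append, ih]
    rfl

theorem schmidtHistory_congr {X ι : Type*} (strat : List (X × ℝ) → X) (x₀ : X) (r : ℕ → ℝ)
    (c : ℕ → X → ι → X) {a b : ℕ → ι} {n : ℕ} (h : ∀ i < n, a i = b i) :
    schmidtHistory strat x₀ r c a n = schmidtHistory strat x₀ r c b n := by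
  induction n with
  | zero => rfl
  | succ n ih =>
    simp only [schmidtHistory, ih fun i hi => h i (hi.trans n.lt_succ_self), h n n.lt_succ_self]

/-- If Bob can always choose among `N` well-separated balls, then Alice is forced to produce points
of `S` for all sequences of choices, and these are separated. -/
theorem SchmidtWinning.exists_separated_coding {X : Type*} [MetricSpace X] {S : Set X} {α β r₀ : ℝ}
    (h : SchmidtWinning S α β) (hα : 0 < α) (hβ : 0 < β) (hβ' : β ≤ 1 / 2) (hr₀ : 0 < r₀)
    (x₀ : X) {N : ℕ}
    (hsep : ∀ (ζ : X) (k : ℕ), ∃ c : Fin N → X,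
      (∀ i, c i ∈ closedBall ζ (α * (r₀ * (β * α) ^ k) / 2)) ∧
      ∀ i j, i ≠ j → 3 * (r₀ * (β * α) ^ (k + 1)) < dist (c i) (c j)) :
    ∃ x : (ℕ → Fin N) → X, range x ⊆ S ∧ ∀ a b n, (∀ i < n, a i = b i) → a n ≠ b n →
      r₀ * (β * α) ^ (n + 1) ≤ dist (x a) (x b) := by
  obtain ⟨strat, hstrat⟩ := h
  let r : ℕ → ℝ := fun k => r₀ * (β * α) ^ k
  have hr : ∀ k, 0 < r k := fun k => by positivity
  have hrs : ∀ k, r (k + 1) = β * (α * r k) := fun k => by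
    simp only [r, pow_succ]
    ring
  choose c hc hcsep using fun k ζ => hsep ζ k
  have key : ∀ a : ℕ → Fin N, ∃ x ∈ S,
      ∀ k, dist x (schmidtCenter strat x₀ r c a k) ≤ r k := fun a => by
    obtain ⟨x, hx, hxS⟩ := (hstrat (schmidtCenter strat x₀ r c a) r (hr 0) hrs fun k => by
      rw [map_range_schmidtCenter]
      refine closedBall_subset_closedBall' ?_
      have h₁ : dist (schmidtCenter strat x₀ r c a (k + 1))
          (strat (schmidtHistory strat x₀ r c a k)) ≤ α * r k / 2 := hc k _ (a k)
      have h₂ : β * (α * r k) ≤ 1 / 2 * (α * r k) := by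
        have := hr k
        gcongr
      rw [hrs]
      linarith).2
    exact ⟨x, hxS, fun k => mem_iInter.1 hx k⟩
  choose x hxS hx using key
  refine ⟨x, range_subset_iff.2 hxS, fun a b n hab hne => ?_⟩
  have h₁ : 3 * r (n + 1) < dist (schmidtCenter strat x₀ r c a (n + 1))
      (schmidtCenter strat x₀ r c b (n + 1)) := by
    simp only [schmidtCenter, schmidtHistory_congr strat x₀ r c hab]
    exact hcsep n _ _ _ hne
  have h₂ := dist_triangle4 (schmidtCenter strat x₀ r c a (n + 1)) (x a) (x b)
    (schmidtCenter strat x₀ r c b (n + 1))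
  rw [dist_comm _ (x a)] at h₂
  change r (n + 1) ≤ _
  linarith [hx a (n + 1), hx b (n + 1)]

theorem exists_rpow_neg_le {α D s t : ℝ} (hα : 0 < α) (hD : 0 < D) (hts : t < s) :
    ∃ β ∈ Ioc (0 : ℝ) (1 / 2), (β * α) ^ (-t) ≤ D * β ^ (-s) := by
  have hlim : Tendsto (fun β : ℝ => β ^ (s - t)) (𝓝[>] 0) (𝓝 0) := by
    have := (Real.continuousAt_rpow_const 0 (s - t) (.inr (by linarith))).tendsto
    rw [Real.zero_rpow (by linarith)] at this
    exact this.mono_left nhdsWithin_le_nhds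
  have hpos : 0 < D * α ^ t := by positivity
  obtain ⟨β, hβ₁, hβ₂⟩ := ((hlim.eventually_lt_const hpos).and
    (Ioc_mem_nhdsGT (by norm_num : (0 : ℝ) < 1 / 2))).exists
  refine ⟨β, hβ₂, ?_⟩
  have hβ := hβ₂.1
  calc (β * α) ^ (-t) = β ^ (s - t) * (β ^ (-s) * α ^ (-t)) := by
        rw [Real.mul_rpow hβ.le hα.le, ← mul_assoc, ← Real.rpow_add hβ]
        ring_nf
    _ ≤ D * α ^ t * (β ^ (-s) * α ^ (-t)) := by gcongr
    _ = D * β ^ (-s) * (α ^ t * α ^ (-t)) := by ring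
    _ = D * β ^ (-s) := by rw [← Real.rpow_add hα, add_neg_cancel, Real.rpow_zero, mul_one]

/-- In an Ahlfors regular space, every small ball contains many separated points. -/
theorem AhlforsRegularMeasure.exists_separated {X : Type*} [MetricSpace X] [MeasurableSpace X]
    {μ : Measure X} {s : ℝ} (h : AhlforsRegularMeasure μ s) :
    ∃ R D : ℝ, 0 < R ∧ 0 < D ∧ ∀ (ζ : X) (ρ β : ℝ) (N : ℕ), 0 < ρ → ρ ≤ R → 0 < β → β ≤ 1 / 2 →
      (∀ m < N, (m : ℝ) < D * β ^ (-s)) → ∃ c : Fin N → X,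
        (∀ i, c i ∈ closedBall ζ (ρ / 2)) ∧ ∀ i j, i ≠ j → 3 * (β * ρ) < dist (c i) (c j) := by
  obtain ⟨R, K, hR, hK, h⟩ := h
  refine ⟨R / 2, K⁻¹ * K⁻¹ * 6 ^ (-s), by positivity, by positivity, ?_⟩
  intro ζ ρ β N hρ hρR hβ hβ' hN
  have hβρ : 0 < β * ρ := by positivity
  have hβρ' : β * ρ ≤ 1 / 2 * ρ := by gcongr
  refine exists_separated_of_measure_lt μ _ _ (by positivity)
    (ENNReal.ofReal (K * (3 * (β * ρ)) ^ s))
    (fun p => (h p _ (by positivity) (by linarith)).2) N fun m hm => ?_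
  refine lt_of_lt_of_le ?_ (h ζ (ρ / 2) (by positivity) (by linarith)).1
  rw [← ENNReal.ofReal_natCast, ← ENNReal.ofReal_mul (by positivity),
    ENNReal.ofReal_lt_ofReal_iff (by positivity)]
  calc (m : ℝ) * (K * (3 * (β * ρ)) ^ s)
      < K⁻¹ * K⁻¹ * 6 ^ (-s) * β ^ (-s) * (K * (3 * (β * ρ)) ^ s) := by
        gcongr
        exact hN m hm
    _ = K⁻¹ * (ρ / 2) ^ s := by
        have : 3 * (β * ρ) = 6 * β * (ρ / 2) := by ring
        rw [this, Real.mul_rpow (by positivity) (by positivity),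
          Real.mul_rpow (by positivity) (by positivity), Real.rpow_neg (by positivity),
          Real.rpow_neg (by positivity)]
        have h₁ : (6 : ℝ) ^ s ≠ 0 := by positivity
        have h₂ : β ^ s ≠ 0 := by positivity
        field_simp

/-- A winning set in an Ahlfors `s`-regular space has Hausdorff dimension at least `s`. -/
theorem AhlforsRegularMeasure.le_dimH_of_schmidtWinning {X : Type*} [MetricSpace X]
    [MeasurableSpace X] [Nonempty X] {μ : Measure X} {s : ℝ} (h : AhlforsRegularMeasure μ s)
    {S : Set X} {α : ℝ} (hα : α ∈ Ioo (0 : ℝ) 1)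
    (hwin : ∀ β ∈ Ioo (0 : ℝ) 1, SchmidtWinning S α β) : ENNReal.ofReal s ≤ dimH S := by
  obtain ⟨R, D, hR, hD, hsep⟩ := h.exists_separated
  obtain ⟨hα₀, hα₁⟩ := hα
  refine ENNReal.le_of_forall_nnreal_lt fun t hts => ?_
  rcases eq_zero_or_pos t with rfl | ht
  · simp
  have ht' : (0 : ℝ) < t := ht
  have hts' : (t : ℝ) < s := by
    rw [← ENNReal.ofReal_coe_nnreal] at hts
    exact (ENNReal.ofReal_lt_ofReal_iff'.1 hts).1
  obtain ⟨β, ⟨hβ₀, hβ⟩, hβD⟩ := exists_rpow_neg_le hα₀ hD hts'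
  have hβα : 0 < β * α := by positivity
  have hβα₁ : β * α < 1 := by nlinarith
  let N := ⌈(β * α) ^ (-(t : ℝ))⌉₊
  have hN : 1 < N := by
    rw [Nat.lt_ceil, Nat.cast_one]
    exact Real.one_lt_rpow_of_pos_of_lt_one_of_neg hβα hβα₁ (by linarith)
  have hN' : (N : ℝ)⁻¹ ≤ (β * α) ^ (t : ℝ) := by
    rw [← inv_inv ((β * α) ^ (t : ℝ)), ← Real.rpow_neg hβα.le]
    exact inv_anti₀ (by positivity) (Nat.le_ceil _)
  obtain ⟨x, hxS, hx⟩ := (hwin β ⟨hβ₀, by linarith⟩).exists_separated_coding hα₀ hβ₀ hβ hR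
    (Classical.arbitrary X) (N := N) fun ζ k => by
      have hle : α * (R * (β * α) ^ k) ≤ R := by
        have h₁ : R * (β * α) ^ k ≤ R := mul_le_of_le_one_right hR.le (pow_le_one₀ hβα.le hβα₁.le)
        exact (mul_le_of_le_one_left (by positivity) hα₁.le).trans h₁
      obtain ⟨c, hc, hc'⟩ := hsep ζ (α * (R * (β * α) ^ k)) β N (by positivity) hle hβ₀ hβ
        fun m hm => (Nat.lt_ceil.1 hm).trans_le hβD
      refine ⟨c, hc, fun i j hij => ?_⟩
      convert hc' i j hij using 1
      ring
  refine le_trans ?_ (dimH_mono hxS)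
  let C : ℝ := ((R * (β * α)) ^ (t : ℝ))⁻¹
  refine le_dimH_range_of_separated hN x t ht (Real.toNNReal C) fun a b n hab hne => ?_
  rw [Real.coe_toNNReal C (by positivity)]
  calc ((N : ℝ) ^ n)⁻¹ = (N : ℝ)⁻¹ ^ n := (inv_pow _ _).symm
    _ ≤ ((β * α) ^ (t : ℝ)) ^ n := by gcongr
    _ = C * (R * (β * α) ^ (n + 1)) ^ (t : ℝ) := by
      have : R * (β * α) ^ (n + 1) = R * (β * α) * (β * α) ^ n := by ring
      rw [this, Real.mul_rpow (x := R * (β * α)) (by positivity) (by positivity),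
        inv_mul_cancel_left₀ (by positivity), ← Real.rpow_natCast, ← Real.rpow_natCast,
        ← Real.rpow_mul hβα.le, ← Real.rpow_mul hβα.le, mul_comm (t : ℝ)]
    _ ≤ C * dist (x a) (x b) ^ (t : ℝ) := by
      gcongr
      exact hx a b n hab hne

/-- Let `s > 0` and let `X` be a complete metric space which is
Ahlfors `s`-regular, i.e. `X` is the support of an Ahlfors `s`-regular Borel
probability measure (full support is expressed by every nonempty open set having
positive measure).  If `S ⊆ X` is winning for Schmidt's game (`α`-winning for some
`α ∈ (0,1)`), then the Hausdorff dimension of `S` equals `s`. -/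
theorem dimH_eq_of_schmidt_winning {X : Type*} [MetricSpace X] [CompleteSpace X]
    [MeasurableSpace X] [BorelSpace X] (s : ℝ) (hs : 0 < s)
    (hreg : ∃ μ : MeasureTheory.Measure X, MeasureTheory.IsProbabilityMeasure μ ∧
      AhlforsRegularMeasure μ s ∧
      (∀ U : Set X, IsOpen U → U.Nonempty → 0 < μ U))
    (S : Set X)
    (hwin : ∃ α ∈ Set.Ioo (0:ℝ) 1, ∀ β ∈ Set.Ioo (0:ℝ) 1, SchmidtWinning S α β) :
    dimH S = ENNReal.ofReal s := by
  obtain ⟨μ, hμ, hreg, -⟩ := hreg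
  obtain ⟨α, hα, hwin⟩ := hwin
  have : Nonempty X := μ.nonempty_of_neZero
  exact ((dimH_mono (subset_univ S)).trans (hreg.dimH_univ_le hs)).antisymm
    (hreg.le_dimH_of_schmidtWinning hα hwin)
end
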